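/- arXiv:2502.09094 — 2 statements merged into one kernel-verified Lean document; each statement's English description precedes it below -/
import Mathlib

section
/- Let a₁,…,a_l ∈ H^∞ satisfy the pairwise corona condition: there exists δ > 0 such that |a_i(z)| + |a_j(z)| ≥ δ for all z ∈ 𝔻 and all i ≠ j. Then the intersection of the ranges of the Toeplitz operators with symbols conj(a_j) equals the range of the Toeplitz operator with symbol conj(a₁⋯a_l): ⋂_{j=1}^l T_{conj(a_j)}H² = T_{conj(a₁⋯a_l)}H². -/
open Complex MeasureTheory Metric Set Finset Filter
open scoped ENNReal Topology

noncomputable section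

/-- Membership in the Hardy space `H²` of the unit disk. -/
def MemHardy2 (f : ℂ → ℂ) : Prop :=
  DifferentiableOn ℂ f (ball (0 : ℂ) 1) ∧
  ∃ C : ℝ, ∀ r : ℝ, 0 < r → r < 1 →
    (1 / (2 * Real.pi)) * ∫ t in (0 : ℝ)..(2 * Real.pi),
      ‖f ((r : ℂ) * Complex.exp ((t : ℂ) * Complex.I))‖ ^ 2 ≤ C

/-- Membership in `H^∞`: bounded holomorphic functions on the unit disk. -/
def MemHinf (f : ℂ → ℂ) : Prop :=
  DifferentiableOn ℂ f (ball (0 : ℂ) 1) ∧ ∃ C : ℝ, ∀ z ∈ ball (0 : ℂ) 1, ‖f z‖ ≤ C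

/-- The `n`-th Taylor coefficient of `f` at `0` (the `n`-th Fourier coefficient of its
boundary values). -/
def taylorCoeff (f : ℂ → ℂ) (n : ℕ) : ℂ := iteratedDeriv n f 0 / (n.factorial : ℂ)

/-- The range `T_{conj φ} H²` of the Toeplitz operator with symbol `conj φ`, `φ ∈ H^∞`:
in terms of Taylor/Fourier coefficients, `T_{conj φ} g` is the element of `H²` whose `n`-th
coefficient is `∑_{k≥0} conj(φ̂(k)) · ĝ(n+k)` (this is `P₊(conj φ · g)`, `P₊` the Riesz
projection). -/
def rangeToeplitzConj (φ : ℂ → ℂ) : Set (ℂ → ℂ) :=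
  {f | MemHardy2 f ∧ ∃ g : ℂ → ℂ, MemHardy2 g ∧
    ∀ n : ℕ, taylorCoeff f n =
      ∑' k : ℕ, (starRingEnd ℂ) (taylorCoeff φ k) * taylorCoeff g (n + k)}

/-- The point `r e^{it}`. -/
def polarPt (r t : ℝ) : ℂ := (r : ℂ) * Complex.exp ((t : ℂ) * Complex.I)

lemma norm_polarPt (r t : ℝ) : ‖polarPt r t‖ = |r| := by
  simp [polarPt, Complex.norm_exp_ofReal_mul_I]

lemma continuous_polarPt (r : ℝ) : Continuous (polarPt r) := by
  unfold polarPt; fun_prop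

lemma integral_exp_int_mul (n : ℤ) (hn : n ≠ 0) :
    ∫ t in (0 : ℝ)..(2 * Real.pi), Complex.exp ((n : ℂ) * (t * Complex.I)) = 0 := by
  have h : ((n : ℂ) * Complex.I) ≠ 0 := by simp [hn]
  have := integral_exp_mul_complex (a := 0) (b := 2 * Real.pi) h
  have h2 : ∀ t : ℝ, (n : ℂ) * (t * Complex.I) = (n : ℂ) * Complex.I * t := fun t => by ring
  simp_rw [h2, this]
  have : (n : ℂ) * Complex.I * ((2 * Real.pi : ℝ) : ℂ) = n * (2 * Real.pi * Complex.I) := by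
    push_cast; ring
  rw [this, Complex.exp_int_mul_two_pi_mul_I]
  simp

lemma polarPt_pow_mul_conj (r t : ℝ) (m n : ℕ) :
    polarPt r t ^ m * (starRingEnd ℂ) (polarPt r t ^ n) =
      (r : ℂ) ^ (m + n) * Complex.exp ((((m : ℤ) - (n : ℤ) : ℤ) : ℂ) * (t * Complex.I)) := by
  have : (starRingEnd ℂ) (Complex.exp ((t : ℂ) * Complex.I)) =
      Complex.exp (-((t : ℂ) * Complex.I)) := by
    rw [← Complex.exp_conj]; simp
  simp only [polarPt, mul_pow, map_mul, map_pow, Complex.conj_ofReal, this]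
  rw [← Complex.exp_nat_mul, ← Complex.exp_nat_mul, mul_mul_mul_comm, ← pow_add, ← Complex.exp_add]
  push_cast
  ring_nf

/-- Parseval's identity for polynomials on the circle of radius `r`. -/
lemma integral_normSq_sum (c : ℕ → ℂ) (N : ℕ) (r : ℝ) :
    ∫ t in (0 : ℝ)..(2 * Real.pi), ‖∑ n ∈ range N, c n * polarPt r t ^ n‖ ^ 2 =
      2 * Real.pi * ∑ n ∈ range N, ‖c n‖ ^ 2 * r ^ (2 * n) := by
  induction N with
  | zero => simp
  | succ N ih =>
    have hcont := continuous_polarPt r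
    have key : ∀ t : ℝ, ‖∑ n ∈ range (N + 1), c n * polarPt r t ^ n‖ ^ 2 =
        ‖∑ n ∈ range N, c n * polarPt r t ^ n‖ ^ 2 + (‖c N‖ ^ 2 * r ^ (2 * N) +
        2 * (∑ n ∈ range N, c n * (starRingEnd ℂ) (c N) * (r : ℂ) ^ (n + N) *
          Complex.exp ((((n : ℤ) - (N : ℤ) : ℤ) : ℂ) * (t * Complex.I))).re) := by
      intro t
      rw [sum_range_succ, ← Complex.normSq_eq_norm_sq, Complex.normSq_add,
        Complex.normSq_eq_norm_sq, Complex.normSq_eq_norm_sq, add_assoc]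
      congr 2
      · rw [norm_mul, norm_pow, norm_polarPt, mul_pow, ← pow_mul, mul_comm N 2,
          pow_mul |r|, sq_abs, ← pow_mul]
      · rw [sum_mul]
        congr 2
        refine sum_congr rfl fun n _ => ?_
        rw [map_mul, mul_mul_mul_comm, polarPt_pow_mul_conj]
        ring
    simp_rw [key]
    have hc1 : Continuous fun t : ℝ => (∑ n ∈ range N, c n * (starRingEnd ℂ) (c N) *
        (r : ℂ) ^ (n + N) *
          Complex.exp ((((n : ℤ) - (N : ℤ) : ℤ) : ℂ) * (t * Complex.I))) := by
      fun_prop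
    rw [intervalIntegral.integral_add (Continuous.intervalIntegrable (by fun_prop) _ _)
      (Continuous.intervalIntegrable (by fun_prop) _ _), ih,
      intervalIntegral.integral_add (Continuous.intervalIntegrable (by fun_prop) _ _)
      (Continuous.intervalIntegrable (by fun_prop) _ _),
      intervalIntegral.integral_const_mul, intervalIntegral.integral_const_mul]
    have hre := Complex.reCLM.intervalIntegral_comp_comm
      (hc1.intervalIntegrable (μ := volume) 0 (2 * Real.pi))
    simp only [Complex.reCLM_apply] at hre
    rw [hre, intervalIntegral.integral_finsetSum
      (fun n _ => Continuous.intervalIntegrable (by fun_prop) _ _)]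
    have hz : ∑ n ∈ range N, ∫ t in (0 : ℝ)..(2 * Real.pi), c n * (starRingEnd ℂ) (c N) *
        (r : ℂ) ^ (n + N) * Complex.exp ((((n : ℤ) - (N : ℤ) : ℤ) : ℂ) * (t * Complex.I)) = 0 := by
      refine sum_eq_zero fun n hn => ?_
      rw [intervalIntegral.integral_const_mul, integral_exp_int_mul, mul_zero]
      have := Finset.mem_range.1 hn
      omega
    rw [hz, sum_range_succ]
    simp
    ring

section PolyNorm

open Polynomial

/-- The squared `H²` norm of a polynomial. -/
def polyNormSq (f : ℂ[X]) : ℝ := ∑ n ∈ range (f.natDegree + 1), ‖f.coeff n‖ ^ 2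

lemma integral_normSq_eval (f : ℂ[X]) (r : ℝ) :
    ∫ t in (0 : ℝ)..(2 * Real.pi), ‖f.eval (polarPt r t)‖ ^ 2 =
      2 * Real.pi * ∑ n ∈ range (f.natDegree + 1), ‖f.coeff n‖ ^ 2 * r ^ (2 * n) := by
  rw [← integral_normSq_sum]
  simp_rw [eval_eq_sum_range]

lemma integral_normSq_eval_one (f : ℂ[X]) :
    ∫ t in (0 : ℝ)..(2 * Real.pi), ‖f.eval (polarPt 1 t)‖ ^ 2 = 2 * Real.pi * polyNormSq f := by
  simp [integral_normSq_eval, polyNormSq]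

lemma polyNormSq_nonneg (f : ℂ[X]) : 0 ≤ polyNormSq f := sum_nonneg fun _ _ => by positivity

lemma norm_coeff_sq_le (f : ℂ[X]) (n : ℕ) : ‖f.coeff n‖ ^ 2 ≤ polyNormSq f := by
  by_cases h : n ≤ f.natDegree
  · exact single_le_sum (f := fun n => ‖f.coeff n‖ ^ 2) (fun _ _ => by positivity)
      (Finset.mem_range.2 (by omega))
  · rw [coeff_eq_zero_of_natDegree_lt (by omega)]
    simpa using polyNormSq_nonneg f

lemma polyNormSq_mul_le (a f : ℂ[X]) (M : ℝ) (ha : ∀ z : ℂ, ‖z‖ ≤ 1 → ‖a.eval z‖ ≤ M) :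
    polyNormSq (a * f) ≤ M ^ 2 * polyNormSq f := by
  have h : 2 * Real.pi * polyNormSq (a * f) ≤ M ^ 2 * (2 * Real.pi * polyNormSq f) := by
    rw [← integral_normSq_eval_one, ← integral_normSq_eval_one,
      ← intervalIntegral.integral_const_mul]
    have hc := continuous_polarPt 1
    refine intervalIntegral.integral_mono (by positivity)
      (Continuous.intervalIntegrable (by fun_prop) _ _)
      (Continuous.intervalIntegrable (by fun_prop) _ _) fun t => ?_
    simp only [eval_mul, norm_mul, mul_pow]
    have := ha (polarPt 1 t) (by simp [norm_polarPt])
    gcongr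
  have : 0 < 2 * Real.pi := by positivity
  nlinarith

/-- The Littlewood–Paley inequality for polynomials. -/
lemma integral_derivative_le (f : ℂ[X]) :
    ∫ r in (0 : ℝ)..1, (1 - r ^ 2) * ∫ t in (0 : ℝ)..(2 * Real.pi),
      ‖f.derivative.eval (polarPt r t)‖ ^ 2 ≤ 2 * Real.pi * polyNormSq f := by
  have hev : ∀ z : ℂ, f.derivative.eval z =
      ∑ n ∈ range (f.natDegree + 1), (f.coeff (n + 1) * (n + 1)) * z ^ n := by
    intro z
    rw [eval_eq_sum_range' (n := f.natDegree + 1)]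
    · simp [coeff_derivative]
    · have := natDegree_derivative_le f
      omega
  simp_rw [hev, integral_normSq_sum]
  have e : ∀ r : ℝ, (1 - r ^ 2) * (2 * Real.pi * ∑ n ∈ range (f.natDegree + 1),
      ‖f.coeff (n + 1) * (n + 1)‖ ^ 2 * r ^ (2 * n)) =
      2 * Real.pi * ∑ n ∈ range (f.natDegree + 1),
        ‖f.coeff (n + 1) * (n + 1)‖ ^ 2 * (r ^ (2 * n) - r ^ (2 * n + 2)) := by
    intro r
    rw [mul_left_comm, mul_sum]
    congr 1
    exact sum_congr rfl fun n _ => by ring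
  simp_rw [e]
  rw [intervalIntegral.integral_const_mul, intervalIntegral.integral_finsetSum
      (fun n _ => Continuous.intervalIntegrable (by fun_prop) _ _)]
  gcongr
  have hle : ∑ n ∈ range (f.natDegree + 1), ‖f.coeff (n + 1)‖ ^ 2 ≤ polyNormSq f := by
    have : ∑ n ∈ range (f.natDegree + 2), ‖f.coeff n‖ ^ 2 = polyNormSq f := by
      rw [sum_range_succ, coeff_eq_zero_of_natDegree_lt (n := f.natDegree + 1) (by omega)]
      simp [polyNormSq]
    rw [← this, sum_range_succ' _ (f.natDegree + 1)]
    have := sq_nonneg ‖f.coeff 0‖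
    linarith
  refine le_trans (sum_le_sum fun n _ => ?_) hle
  rw [intervalIntegral.integral_const_mul, intervalIntegral.integral_sub
    (Continuous.intervalIntegrable (by fun_prop) _ _)
    (Continuous.intervalIntegrable (by fun_prop) _ _), integral_pow, integral_pow,
    norm_mul, mul_pow, mul_assoc]
  refine mul_le_of_le_one_right (by positivity) ?_
  have : ‖((n : ℂ) + 1)‖ = n + 1 := by
    rw [← Nat.cast_succ, Complex.norm_natCast]; simp
  rw [this]
  push_cast
  simp only [one_pow, ne_eq, Nat.add_eq_zero_iff, mul_eq_zero, OfNat.ofNat_ne_zero, false_or,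
    one_ne_zero, and_false, not_false_eq_true, zero_pow, sub_zero]
  rw [div_sub_div _ _ (by positivity) (by positivity), ← mul_div_assoc, div_le_one (by positivity)]
  nlinarith [(Nat.cast_nonneg n : (0 : ℝ) ≤ n)]

end PolyNorm

/-- `F` is real-differentiable at `z` with Wirtinger derivatives `∂F = p` and `∂̄F = q`. -/
def HasWirtingerAt (F : ℂ → ℂ) (p q z : ℂ) : Prop :=
  HasFDerivAt F (p • (1 : ℂ →L[ℝ] ℂ) + q • (Complex.conjCLE : ℂ →L[ℝ] ℂ)) z

namespace HasWirtingerAt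

variable {F G : ℂ → ℂ} {p q p' q' z : ℂ}

lemma of_hasDerivAt (h : HasDerivAt F p z) : HasWirtingerAt F p 0 z := by
  refine (h.hasFDerivAt.restrictScalars ℝ).congr_fderiv ?_
  refine ContinuousLinearMap.ext fun w => ?_
  simp [mul_comm]

lemma mul (hF : HasWirtingerAt F p q z) (hG : HasWirtingerAt G p' q' z) :
    HasWirtingerAt (fun z => F z * G z) (p * G z + F z * p') (q * G z + F z * q') z := by
  refine (HasFDerivAt.mul hF hG).congr_fderiv ?_
  refine ContinuousLinearMap.ext fun w => ?_
  simp
  ring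

lemma add (hF : HasWirtingerAt F p q z) (hG : HasWirtingerAt G p' q' z) :
    HasWirtingerAt (fun z => F z + G z) (p + p') (q + q') z := by
  refine (HasFDerivAt.add hF hG).congr_fderiv ?_
  refine ContinuousLinearMap.ext fun w => ?_
  simp
  ring

lemma conj (hF : HasWirtingerAt F p q z) :
    HasWirtingerAt (fun z => (starRingEnd ℂ) (F z)) ((starRingEnd ℂ) q) ((starRingEnd ℂ) p) z := by
  have h := (Complex.conjCLE : ℂ →L[ℝ] ℂ).hasFDerivAt (x := F z)
  refine (h.comp z hF).congr_fderiv ?_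
  refine ContinuousLinearMap.ext fun w => ?_
  simp
  ring

lemma inv (hF : HasWirtingerAt F p q z) (h0 : F z ≠ 0) :
    HasWirtingerAt (fun z => (F z)⁻¹) (-p / F z ^ 2) (-q / F z ^ 2) z := by
  have h := ((hasDerivAt_inv h0).hasFDerivAt.restrictScalars ℝ).comp z hF
  refine h.congr_fderiv ?_
  refine ContinuousLinearMap.ext fun w => ?_
  simp
  ring

lemma continuousAt (hF : HasWirtingerAt F p q z) : ContinuousAt F z :=
  HasFDerivAt.continuousAt hF

lemma comp_hasDerivAt {γ : ℝ → ℂ} {γ' : ℂ} {t : ℝ} (hF : HasWirtingerAt F p q (γ t))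
    (hγ : HasDerivAt γ γ' t) :
    HasDerivAt (fun t => F (γ t)) (p * γ' + q * (starRingEnd ℂ) γ') t := by
  have := HasFDerivAt.comp_hasDerivAt t hF hγ
  simpa [Function.comp_def] using this

end HasWirtingerAt

lemma hasDerivAt_polarPt_left (r t : ℝ) : HasDerivAt (fun r => polarPt r t)
    (Complex.exp ((t : ℂ) * Complex.I)) r := by
  have := (Complex.ofRealCLM.hasDerivAt (x := r)).mul_const (Complex.exp ((t : ℂ) * Complex.I))
  simpa [polarPt] using this

lemma hasDerivAt_polarPt_right (r t : ℝ) : HasDerivAt (fun t => polarPt r t)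
    (r * Complex.I * Complex.exp ((t : ℂ) * Complex.I)) t := by
  have h : HasDerivAt (fun t : ℝ => (t : ℂ) * Complex.I) Complex.I t := by
    simpa using (Complex.ofRealCLM.hasDerivAt (x := t)).mul_const Complex.I
  have := h.cexp.const_mul (r : ℂ)
  refine this.congr_deriv ?_
  ring

lemma continuous_exp_mul_I : Continuous fun t : ℝ => Complex.exp ((t : ℂ) * Complex.I) := by
  fun_prop

lemma continuous_conj_exp_mul_I :
    Continuous fun t : ℝ => (starRingEnd ℂ) (Complex.exp ((t : ℂ) * Complex.I)) :=
  Complex.continuous_conj.comp continuous_exp_mul_I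

lemma continuous_polarPt_left (t : ℝ) : Continuous fun r => polarPt r t := by
  unfold polarPt; fun_prop

lemma ContinuousOn.comp_polarPt {F : ℂ → ℂ} (hF : ContinuousOn F (closedBall 0 1)) {r : ℝ}
    (h0 : 0 ≤ r) (h1 : r ≤ 1) : Continuous fun t => F (polarPt r t) := by
  refine hF.comp_continuous (continuous_polarPt r) fun t => ?_
  simp [norm_polarPt, abs_of_nonneg h0, h1]

/-- The integral of `F` over the circle of radius `r`, with respect to the angle. -/
def angleIntegral (F : ℂ → ℂ) (r : ℝ) : ℂ := ∫ t in (0 : ℝ)..(2 * Real.pi), F (polarPt r t)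

lemma continuousOn_angleIntegral {F : ℂ → ℂ} (hF : ContinuousOn F (closedBall 0 1)) :
    ContinuousOn (angleIntegral F) (Icc 0 1) := by
  obtain ⟨C, hC⟩ := (isCompact_closedBall (0 : ℂ) 1).exists_bound_of_continuousOn hF
  intro r hr
  have hmem : ∀ r ∈ Icc (0 : ℝ) 1, ∀ t, polarPt r t ∈ closedBall (0 : ℂ) 1 := fun r hr t => by
    simp [norm_polarPt, abs_of_nonneg hr.1, hr.2]
  refine intervalIntegral.continuousWithinAt_of_dominated_interval (bound := fun _ => C) ?_ ?_ ?_ ?_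
  · filter_upwards [self_mem_nhdsWithin] with x hx
    exact (hF.comp_polarPt hx.1 hx.2).aestronglyMeasurable
  · filter_upwards [self_mem_nhdsWithin] with x hx
    exact Eventually.of_forall fun t _ => hC _ (hmem x hx t)
  · simp
  · refine Eventually.of_forall fun t _ => ?_
    exact (hF _ (hmem r hr t)).comp (f := fun r => polarPt r t)
      (continuous_polarPt_left t).continuousWithinAt fun x hx => hmem x hx t

section

variable {F p q : ℂ → ℂ} (hF : ∀ z : ℂ, ‖z‖ ≤ 1 → HasWirtingerAt F (p z) (q z) z)
  (hp : ContinuousOn p (closedBall 0 1)) (hq : ContinuousOn q (closedBall 0 1))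

include hF in
lemma continuousOn_of_hasWirtingerAt : ContinuousOn F (closedBall 0 1) := fun z hz =>
  (hF z (by simpa using hz)).continuousAt.continuousWithinAt

include hF hp hq in
lemma hasDerivAt_angleIntegral_aux {r : ℝ} (h0 : 0 < r) (h1 : r < 1) :
    HasDerivAt (angleIntegral F) (∫ t in (0 : ℝ)..(2 * Real.pi),
      (p (polarPt r t) * Complex.exp ((t : ℂ) * Complex.I) +
        q (polarPt r t) * (starRingEnd ℂ) (Complex.exp ((t : ℂ) * Complex.I)))) r := by
  obtain ⟨C, hC⟩ := (isCompact_closedBall (0 : ℂ) 1).exists_bound_of_continuousOn hp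
  obtain ⟨C', hC'⟩ := (isCompact_closedBall (0 : ℂ) 1).exists_bound_of_continuousOn hq
  have hFc := continuousOn_of_hasWirtingerAt hF
  have hs : Ioo (0 : ℝ) 1 ∈ 𝓝 r := Ioo_mem_nhds h0 h1
  have hmem : ∀ r ∈ Ioo (0 : ℝ) 1, ∀ t, ‖polarPt r t‖ ≤ 1 := fun r hr t => by
    simp [norm_polarPt, abs_of_nonneg hr.1.le, hr.2.le]
  refine (intervalIntegral.hasDerivAt_integral_of_dominated_loc_of_deriv_le
    (F := fun r t => F (polarPt r t)) (F' := fun r t =>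
      (p (polarPt r t) * Complex.exp ((t : ℂ) * Complex.I) +
        q (polarPt r t) * (starRingEnd ℂ) (Complex.exp ((t : ℂ) * Complex.I))))
      (bound := fun _ => C + C') hs ?_ ?_ ?_ ?_ ?_ ?_).2
  · filter_upwards [hs] with x hx
    exact (hFc.comp_polarPt hx.1.le hx.2.le).aestronglyMeasurable
  · exact (hFc.comp_polarPt h0.le h1.le).intervalIntegrable _ _
  · refine Continuous.aestronglyMeasurable ?_
    exact ((hp.comp_polarPt h0.le h1.le).mul continuous_exp_mul_I).add
      ((hq.comp_polarPt h0.le h1.le).mul continuous_conj_exp_mul_I)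
  · refine Eventually.of_forall fun t _ x hx => ?_
    refine (norm_add_le _ _).trans ?_
    simp only [norm_mul, RCLike.norm_conj, Complex.norm_exp_ofReal_mul_I, mul_one]
    exact add_le_add (hC _ (by simpa using hmem x hx t)) (hC' _ (by simpa using hmem x hx t))
  · simp
  · refine Eventually.of_forall fun t _ x hx => ?_
    exact (hF _ (hmem x hx t)).comp_hasDerivAt (γ := fun r => polarPt r t)
      (hasDerivAt_polarPt_left x t)

include hF hp hq in
lemma integral_wirtinger_sub {r : ℝ} (h0 : 0 < r) (h1 : r < 1) :
    ∫ t in (0 : ℝ)..(2 * Real.pi), p (polarPt r t) * Complex.exp ((t : ℂ) * Complex.I) =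
      ∫ t in (0 : ℝ)..(2 * Real.pi),
        q (polarPt r t) * (starRingEnd ℂ) (Complex.exp ((t : ℂ) * Complex.I)) := by
  have hp' : Continuous fun t => p (polarPt r t) * Complex.exp ((t : ℂ) * Complex.I) :=
    (hp.comp_polarPt h0.le h1.le).mul continuous_exp_mul_I
  have hq' : Continuous fun t =>
      q (polarPt r t) * (starRingEnd ℂ) (Complex.exp ((t : ℂ) * Complex.I)) :=
    (hq.comp_polarPt h0.le h1.le).mul continuous_conj_exp_mul_I
  have hmem : ∀ t, ‖polarPt r t‖ ≤ 1 := fun t => by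
    simp [norm_polarPt, abs_of_nonneg h0.le, h1.le]
  have hd : ∀ t : ℝ, HasDerivAt (fun t => F (polarPt r t))
      ((r * Complex.I) * (p (polarPt r t) * Complex.exp ((t : ℂ) * Complex.I) -
        q (polarPt r t) * (starRingEnd ℂ) (Complex.exp ((t : ℂ) * Complex.I)))) t := fun t => by
    refine ((hF _ (hmem t)).comp_hasDerivAt (hasDerivAt_polarPt_right r t)).congr_deriv ?_
    simp only [map_mul, Complex.conj_ofReal, Complex.conj_I]
    ring
  have h := intervalIntegral.integral_eq_sub_of_hasDerivAt (a := 0) (b := 2 * Real.pi)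
    (fun t _ => hd t) ((continuous_const.mul (hp'.sub hq')).intervalIntegrable _ _)
  have hper : polarPt r (2 * Real.pi) = polarPt r 0 := by
    simp [polarPt, Complex.exp_two_pi_mul_I]
  rw [hper, sub_self, intervalIntegral.integral_const_mul, intervalIntegral.integral_sub
    (hp'.intervalIntegrable _ _) (hq'.intervalIntegrable _ _)] at h
  have hr : (r * Complex.I : ℂ) ≠ 0 := by simp [h0.ne']
  exact sub_eq_zero.1 ((mul_eq_zero.1 h).resolve_left hr)

include hF hp hq in
lemma hasDerivAt_angleIntegral_left {r : ℝ} (h0 : 0 < r) (h1 : r < 1) :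
    HasDerivAt (angleIntegral F) (2 * ∫ t in (0 : ℝ)..(2 * Real.pi),
      p (polarPt r t) * Complex.exp ((t : ℂ) * Complex.I)) r := by
  have hp' : Continuous fun t => p (polarPt r t) * Complex.exp ((t : ℂ) * Complex.I) :=
    (hp.comp_polarPt h0.le h1.le).mul continuous_exp_mul_I
  have hq' : Continuous fun t =>
      q (polarPt r t) * (starRingEnd ℂ) (Complex.exp ((t : ℂ) * Complex.I)) :=
    (hq.comp_polarPt h0.le h1.le).mul continuous_conj_exp_mul_I
  refine (hasDerivAt_angleIntegral_aux hF hp hq h0 h1).congr_deriv ?_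
  rw [intervalIntegral.integral_add
    (hp'.intervalIntegrable _ _) (hq'.intervalIntegrable _ _),
    ← integral_wirtinger_sub hF hp hq h0 h1]
  ring

include hF hp hq in
lemma hasDerivAt_angleIntegral_right {r : ℝ} (h0 : 0 < r) (h1 : r < 1) :
    HasDerivAt (angleIntegral F) (2 * ∫ t in (0 : ℝ)..(2 * Real.pi),
      q (polarPt r t) * (starRingEnd ℂ) (Complex.exp ((t : ℂ) * Complex.I))) r := by
  rw [← integral_wirtinger_sub hF hp hq h0 h1]
  exact hasDerivAt_angleIntegral_left hF hp hq h0 h1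

end

/-- A quantitative Green formula: if `∂̄F = z K` and `F 0 = 0`, then the mean of `F` over the unit
circle is controlled by `K 0` and a weighted area integral of a bound `B` for `∂K`. -/
lemma norm_angleIntegral_one_le {F p K k₁ k₂ : ℂ → ℂ} {B : ℂ → ℝ}
    (hF : ∀ z : ℂ, ‖z‖ ≤ 1 → HasWirtingerAt F (p z) (z * K z) z)
    (hp : ContinuousOn p (closedBall 0 1)) (hF0 : F 0 = 0)
    (hK : ∀ z : ℂ, ‖z‖ ≤ 1 → HasWirtingerAt K (k₁ z) (k₂ z) z)
    (hk₁ : ContinuousOn k₁ (closedBall 0 1)) (hk₂ : ContinuousOn k₂ (closedBall 0 1))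
    (hB : Continuous B) (hkB : ∀ z : ℂ, ‖z‖ ≤ 1 → ‖k₁ z‖ ≤ B z) :
    ‖angleIntegral F 1‖ ≤ 2 * Real.pi * ‖K 0‖ +
      2 * ∫ r in (0 : ℝ)..1, (1 - r ^ 2) * ∫ t in (0 : ℝ)..(2 * Real.pi), B (polarPt r t) := by
  have hKc := continuousOn_of_hasWirtingerAt hK
  have hFc := continuousOn_of_hasWirtingerAt hF
  have hzK : ContinuousOn (fun z => z * K z) (closedBall 0 1) := continuousOn_id.mul hKc
  set Φ : ℝ → ℂ := fun r => angleIntegral F r + (1 - (r : ℂ) ^ 2) * angleIntegral K r with hΦ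
  have hΦ1 : Φ 1 = angleIntegral F 1 := by simp [hΦ]
  have hΦ0 : Φ 0 = 2 * Real.pi * K 0 := by
    simp [hΦ, angleIntegral, polarPt, hF0]
  have hder : ∀ r ∈ Ioo (0 : ℝ) 1, HasDerivAt Φ ((1 - (r : ℂ) ^ 2) *
      (2 * ∫ t in (0 : ℝ)..(2 * Real.pi),
        k₁ (polarPt r t) * Complex.exp ((t : ℂ) * Complex.I))) r := by
    intro r hr
    have d1 := hasDerivAt_angleIntegral_right hF hp hzK hr.1 hr.2
    have d2 := hasDerivAt_angleIntegral_left hK hk₁ hk₂ hr.1 hr.2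
    have d3 : HasDerivAt (fun r : ℝ => 1 - (r : ℂ) ^ 2) (-(2 * r : ℂ)) r := by
      have := ((Complex.ofRealCLM.hasDerivAt (x := r)).pow 2).const_sub 1
      simpa using this
    refine (d1.add (d3.mul d2)).congr_deriv ?_
    have e : ∀ t : ℝ, polarPt r t * K (polarPt r t) *
        (starRingEnd ℂ) (Complex.exp ((t : ℂ) * Complex.I)) = r * K (polarPt r t) := by
      intro t
      have : polarPt r t * (starRingEnd ℂ) (Complex.exp ((t : ℂ) * Complex.I)) = r := by
        rw [polarPt, mul_assoc, Complex.mul_conj, Complex.normSq_eq_norm_sq,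
          Complex.norm_exp_ofReal_mul_I]
        simp
      rw [mul_right_comm, this]
    simp_rw [e]
    rw [intervalIntegral.integral_const_mul]
    simp only [angleIntegral]
    ring
  have hBc : Continuous fun r : ℝ => ∫ t in (0 : ℝ)..(2 * Real.pi), B (polarPt r t) := by
    refine intervalIntegral.continuous_parametric_intervalIntegral_of_continuous' ?_ _ _
    unfold Function.uncurry polarPt
    fun_prop
  have hmain := norm_sub_le_integral_of_norm_deriv_le_of_le (f := Φ) (a := 0) (b := 1)
    (B := fun r => 2 * ((1 - r ^ 2) * ∫ t in (0 : ℝ)..(2 * Real.pi), B (polarPt r t)))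
    zero_le_one ?_ ?_ ?_ ?_
  · rw [hΦ1, hΦ0, intervalIntegral.integral_const_mul] at hmain
    have h2 := norm_sub_norm_le (angleIntegral F 1) (2 * Real.pi * K 0)
    have h3 : ‖(2 * Real.pi * K 0 : ℂ)‖ = 2 * Real.pi * ‖K 0‖ := by
      simp [abs_of_pos Real.pi_pos]
    linarith
  · refine (continuousOn_angleIntegral hFc).add
      (ContinuousOn.mul ?_ (continuousOn_angleIntegral hKc))
    exact Continuous.continuousOn (by fun_prop)
  · exact fun r hr => (hder r hr).differentiableAt.differentiableWithinAt
  · refine Eventually.of_forall fun r hr => ?_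
    rw [(hder r hr).deriv, norm_mul, norm_mul]
    have h1 : ‖(1 - (r : ℂ) ^ 2)‖ = 1 - r ^ 2 := by
      rw [← Complex.ofReal_pow, ← Complex.ofReal_one, ← Complex.ofReal_sub, Complex.norm_real,
        Real.norm_of_nonneg]
      nlinarith [hr.1, hr.2]
    rw [h1, Complex.norm_ofNat, mul_left_comm]
    have h4 : 0 ≤ 1 - r ^ 2 := by nlinarith [hr.1, hr.2]
    gcongr
    refine intervalIntegral.norm_integral_le_of_norm_le (by positivity) ?_
      (Continuous.intervalIntegrable (hB.comp (continuous_polarPt r)) _ _)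
    refine Eventually.of_forall fun t _ => ?_
    rw [norm_mul, Complex.norm_exp_ofReal_mul_I, mul_one]
    exact hkB _ (by simp [norm_polarPt, abs_of_nonneg hr.1.le, hr.2.le])
  · exact Continuous.intervalIntegrable (by fun_prop) _ _

local notation "cj" => starRingEnd ℂ

section Corona

open Polynomial

lemma hasWirtingerAt_eval (f : ℂ[X]) (z : ℂ) :
    HasWirtingerAt (fun z => f.eval z) (f.derivative.eval z) 0 z :=
  .of_hasDerivAt (f.hasDerivAt z)

lemma hasWirtingerAt_conj_eval (f : ℂ[X]) (z : ℂ) :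
    HasWirtingerAt (fun z => cj (f.eval z)) 0 (cj (f.derivative.eval z)) z := by
  simpa using (hasWirtingerAt_eval f z).conj

lemma HasWirtingerAt.congr_values {F : ℂ → ℂ} {p q p' q' z : ℂ} (h : HasWirtingerAt F p q z)
    (hp : p = p') (hq : q = q') : HasWirtingerAt F p' q' z := hp ▸ hq ▸ h

/-- The gradient energy density used in Wolff's estimate. -/
def wolffEnergy (M : ℝ) (a b f : ℂ[X]) (z : ℂ) : ℝ :=
  4 * (‖(a * f).derivative.eval z‖ ^ 2 + ‖(b * f).derivative.eval z‖ ^ 2) +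
    (8 * M ^ 2 + 1) * ‖f.derivative.eval z‖ ^ 2

lemma continuous_wolffEnergy (M : ℝ) (a b f : ℂ[X]) : Continuous (wolffEnergy M a b f) := by
  unfold wolffEnergy
  fun_prop

lemma integral_wolffEnergy_le {M : ℝ} {a b : ℂ[X]} (ha : ∀ z : ℂ, ‖z‖ ≤ 1 → ‖a.eval z‖ ≤ M)
    (hb : ∀ z : ℂ, ‖z‖ ≤ 1 → ‖b.eval z‖ ≤ M) (f : ℂ[X]) :
    ∫ r in (0 : ℝ)..1, (1 - r ^ 2) * ∫ t in (0 : ℝ)..(2 * Real.pi),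
      wolffEnergy M a b f (polarPt r t) ≤ 2 * Real.pi * ((16 * M ^ 2 + 1) * polyNormSq f) := by
  have hi : ∀ (f : ℂ[X]) (r : ℝ), IntervalIntegrable
      (fun t => ‖f.eval (polarPt r t)‖ ^ 2) volume 0 (2 * Real.pi) := fun f r =>
    Continuous.intervalIntegrable (by have := continuous_polarPt r; fun_prop) _ _
  have hj : ∀ f : ℂ[X], IntervalIntegrable (fun r : ℝ => (1 - r ^ 2) *
      ∫ t in (0 : ℝ)..(2 * Real.pi), ‖f.eval (polarPt r t)‖ ^ 2) volume 0 1 := by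
    intro f
    refine Continuous.intervalIntegrable (Continuous.mul (by fun_prop) ?_) _ _
    refine intervalIntegral.continuous_parametric_intervalIntegral_of_continuous' ?_ _ _
    unfold Function.uncurry polarPt
    fun_prop
  have e : ∀ r : ℝ, (1 - r ^ 2) * ∫ t in (0 : ℝ)..(2 * Real.pi),
      wolffEnergy M a b f (polarPt r t) =
      4 * ((1 - r ^ 2) * (∫ t in (0 : ℝ)..(2 * Real.pi),
        ‖(a * f).derivative.eval (polarPt r t)‖ ^ 2) + (1 - r ^ 2) *
          ∫ t in (0 : ℝ)..(2 * Real.pi), ‖(b * f).derivative.eval (polarPt r t)‖ ^ 2) +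
      (8 * M ^ 2 + 1) * ((1 - r ^ 2) *
          ∫ t in (0 : ℝ)..(2 * Real.pi), ‖f.derivative.eval (polarPt r t)‖ ^ 2) := by
    intro r
    unfold wolffEnergy
    rw [intervalIntegral.integral_add (((hi _ r).add (hi _ r)).const_mul _) ((hi _ r).const_mul _),
      intervalIntegral.integral_const_mul, intervalIntegral.integral_const_mul,
      intervalIntegral.integral_add (hi _ r) (hi _ r)]
    ring
  simp_rw [e]
  rw [intervalIntegral.integral_add (((hj _).add (hj _)).const_mul _) ((hj _).const_mul _),
    intervalIntegral.integral_const_mul, intervalIntegral.integral_const_mul,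
    intervalIntegral.integral_add (hj _) (hj _)]
  have h1 := integral_derivative_le (a * f)
  have h2 := integral_derivative_le (b * f)
  have h3 := integral_derivative_le f
  have h4 := mul_le_mul_of_nonneg_left (polyNormSq_mul_le a f M ha) Real.two_pi_pos.le
  have h5 := mul_le_mul_of_nonneg_left (polyNormSq_mul_le b f M hb) Real.two_pi_pos.le
  have h6 := mul_le_mul_of_nonneg_left h3 (by positivity : 0 ≤ 8 * M ^ 2 + 1)
  linarith

lemma wolffEnergy_zero_le {M : ℝ} {a b : ℂ[X]} (ha : ∀ z : ℂ, ‖z‖ ≤ 1 → ‖a.eval z‖ ≤ M)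
    (hb : ∀ z : ℂ, ‖z‖ ≤ 1 → ‖b.eval z‖ ≤ M) (f : ℂ[X]) :
    wolffEnergy M a b f 0 ≤ (16 * M ^ 2 + 1) * polyNormSq f := by
  have h : ∀ f : ℂ[X], ‖f.derivative.eval 0‖ ^ 2 ≤ polyNormSq f := fun f => by
    rw [← coeff_zero_eq_eval_zero, coeff_derivative]
    simpa using norm_coeff_sq_le f 1
  unfold wolffEnergy
  have h1 := (h (a * f)).trans (polyNormSq_mul_le a f M ha)
  have h2 := (h (b * f)).trans (polyNormSq_mul_le b f M hb)
  have h3 := mul_le_mul_of_nonneg_left (h f) (by positivity : 0 ≤ 8 * M ^ 2 + 1)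
  linarith

lemma norm_add_sq_le (x y : ℂ) : ‖x + y‖ ^ 2 ≤ 2 * (‖x‖ ^ 2 + ‖y‖ ^ 2) := by
  have := norm_add_le x y
  nlinarith [norm_nonneg (x + y), norm_nonneg x, norm_nonneg y, sq_nonneg (‖x‖ - ‖y‖)]

lemma energy_bound {M : ℝ} {a b : ℂ[X]} (f : ℂ[X]) {z : ℂ} (ha : ‖a.eval z‖ ≤ M)
    (hb : ‖b.eval z‖ ≤ M) :
    (‖a.derivative.eval z‖ + ‖b.derivative.eval z‖) ^ 2 * ‖f.eval z‖ ^ 2 +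
      ‖f.derivative.eval z‖ ^ 2 ≤ wolffEnergy M a b f z := by
  have key : ∀ a : ℂ[X], ‖a.eval z‖ ≤ M → ‖a.derivative.eval z‖ ^ 2 * ‖f.eval z‖ ^ 2 ≤
      2 * ‖(a * f).derivative.eval z‖ ^ 2 + 2 * (M ^ 2 * ‖f.derivative.eval z‖ ^ 2) := by
    intro a ha
    have h := norm_add_sq_le ((a * f).derivative.eval z)
      (-(a.eval z * f.derivative.eval z))
    have e : (a * f).derivative.eval z + -(a.eval z * f.derivative.eval z) =
        a.derivative.eval z * f.eval z := by
      simp [derivative_mul]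
    rw [e, norm_neg, norm_mul, norm_mul, mul_pow, mul_pow, mul_add] at h
    refine h.trans ?_
    gcongr
  have h1 := key a ha
  have h2 := key b hb
  have h3 : (‖a.derivative.eval z‖ + ‖b.derivative.eval z‖) ^ 2 * ‖f.eval z‖ ^ 2 ≤
      2 * (‖a.derivative.eval z‖ ^ 2 * ‖f.eval z‖ ^ 2) +
      2 * (‖b.derivative.eval z‖ ^ 2 * ‖f.eval z‖ ^ 2) := by
    nlinarith [mul_nonneg (sq_nonneg (‖a.derivative.eval z‖ - ‖b.derivative.eval z‖))
      (sq_nonneg ‖f.eval z‖)]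
  unfold wolffEnergy
  linarith

/-- Young's inequality with a parameter. -/
lemma mul_le_young {x y τ : ℝ} (hτ : 0 < τ) : x * y ≤ (τ * x ^ 2 + τ⁻¹ * y ^ 2) / 2 := by
  have h : 0 ≤ τ * (x - τ⁻¹ * y) ^ 2 := by positivity
  have e : τ * (x - τ⁻¹ * y) ^ 2 = τ * x ^ 2 - 2 * (x * y) + τ⁻¹ * y ^ 2 := by
    field_simp
    ring
  linarith

lemma wolff_pointwise {M G A B f f' s s' τ C : ℝ} (hτ : 0 < τ) (hM : 0 ≤ M) (hG : 0 ≤ G)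
    (hC : M ^ 2 * G ^ 3 + M * G ^ 2 ≤ C) :
    M * (A + B) * (2 * G ^ 3 * (M * (A + B)) * (s * f) + G ^ 2 * (s' * f + s * f')) ≤
      C * (τ * ((A + B) ^ 2 * f ^ 2 + f' ^ 2) + τ⁻¹ * ((A + B) ^ 2 * s ^ 2 + s' ^ 2)) := by
  have h1 := mul_le_young (x := (A + B) * f) (y := (A + B) * s) hτ
  have h2 := mul_le_young (x := (A + B) * f) (y := s') hτ
  have h3 := mul_le_young (x := f') (y := (A + B) * s) hτ
  have hτ' : 0 < τ⁻¹ := inv_pos.2 hτ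
  set X := τ * ((A + B) ^ 2 * f ^ 2 + f' ^ 2) + τ⁻¹ * ((A + B) ^ 2 * s ^ 2 + s' ^ 2) with hX
  have hX0 : 0 ≤ X := by positivity
  have p1 : 0 ≤ τ * f' ^ 2 := by positivity
  have p2 : 0 ≤ τ⁻¹ * s' ^ 2 := by positivity
  have p3 : 0 ≤ τ * ((A + B) ^ 2 * f ^ 2) := by positivity
  have p4 : 0 ≤ τ⁻¹ * ((A + B) ^ 2 * s ^ 2) := by positivity
  have k1 : 2 * ((A + B) * f * ((A + B) * s)) ≤ X := by
    simp only [mul_pow] at h1; linarith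
  have k2 : (A + B) * f * s' + f' * ((A + B) * s) ≤ X := by
    simp only [mul_pow] at h2 h3; linarith
  have m1 := mul_le_mul_of_nonneg_left k1 (by positivity : 0 ≤ M ^ 2 * G ^ 3)
  have m2 := mul_le_mul_of_nonneg_left k2 (by positivity : 0 ≤ M * G ^ 2)
  have m3 := mul_le_mul_of_nonneg_right hC hX0
  linarith

/-- The reciprocal of `|a|² + |b|²`. -/
def invNormSq (a b : ℂ[X]) (z : ℂ) : ℂ :=
  (a.eval z * cj (a.eval z) + b.eval z * cj (b.eval z))⁻¹

lemma norm_sq_add_eq (x y : ℂ) :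
    x * cj x + y * cj y = ((‖x‖ ^ 2 + ‖y‖ ^ 2 : ℝ) : ℂ) := by
  rw [Complex.mul_conj, Complex.mul_conj, Complex.normSq_eq_norm_sq, Complex.normSq_eq_norm_sq]
  push_cast
  rfl

lemma norm_sq_add_ne_zero {x y : ℂ} {δ : ℝ} (hδ : 0 < δ) (h : δ ≤ ‖x‖ ^ 2 + ‖y‖ ^ 2) :
    x * cj x + y * cj y ≠ 0 := by
  rw [norm_sq_add_eq, Complex.ofReal_ne_zero]
  linarith

lemma norm_invNormSq_le {a b : ℂ[X]} {z : ℂ} {δ : ℝ} (hδ : 0 < δ)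
    (h : δ ≤ ‖a.eval z‖ ^ 2 + ‖b.eval z‖ ^ 2) : ‖invNormSq a b z‖ ≤ δ⁻¹ := by
  rw [invNormSq, norm_sq_add_eq, norm_inv, Complex.norm_real, Real.norm_of_nonneg (by positivity)]
  gcongr

lemma hasWirtingerAt_invNormSq {a b : ℂ[X]} {z : ℂ}
    (h : a.eval z * cj (a.eval z) + b.eval z * cj (b.eval z) ≠ 0) :
    HasWirtingerAt (invNormSq a b)
      (-(a.derivative.eval z * cj (a.eval z) + b.derivative.eval z * cj (b.eval z)) *
        invNormSq a b z ^ 2)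
      (-(a.eval z * cj (a.derivative.eval z) + b.eval z * cj (b.derivative.eval z)) *
        invNormSq a b z ^ 2) z := by
  have h1 := (((hasWirtingerAt_eval a z).mul (hasWirtingerAt_conj_eval a z)).add
    ((hasWirtingerAt_eval b z).mul (hasWirtingerAt_conj_eval b z))).inv h
  refine HasWirtingerAt.congr_values h1 ?_ ?_
  · rw [invNormSq, inv_pow, div_eq_mul_inv]
    congr 1
    ring
  · rw [invNormSq, inv_pow, div_eq_mul_inv]
    congr 1
    ring

/-- The Wronskian of `b` and `a`. -/
def wronsk (a b : ℂ[X]) : ℂ[X] := b * a.derivative - a * b.derivative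

lemma norm_wronsk_le {M : ℝ} {a b : ℂ[X]} {z : ℂ} (ha : ‖a.eval z‖ ≤ M) (hb : ‖b.eval z‖ ≤ M) :
    ‖(wronsk a b).eval z‖ ≤ M * (‖a.derivative.eval z‖ + ‖b.derivative.eval z‖) := by
  rw [wronsk, eval_sub, eval_mul, eval_mul]
  refine (norm_sub_le _ _).trans ?_
  rw [norm_mul, norm_mul, mul_add]
  gcongr

/-- The kernel appearing as the `∂̄`-derivative in Wolff's argument. -/
def wolffKernel (a b h : ℂ[X]) (z : ℂ) : ℂ :=
  cj ((wronsk a b).eval z) * (invNormSq a b z * invNormSq a b z) * h.eval z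

/-- The holomorphic derivative `∂` of `wolffKernel`. -/
def wolffKernelDeriv (a b h : ℂ[X]) (z : ℂ) : ℂ :=
  cj ((wronsk a b).eval z) *
    (-2 * (a.derivative.eval z * cj (a.eval z) + b.derivative.eval z * cj (b.eval z)) *
      invNormSq a b z ^ 3 * h.eval z + invNormSq a b z ^ 2 * h.derivative.eval z)

/-- The antiholomorphic derivative `∂̄` of `wolffKernel`. -/
def wolffKernelDerivBar (a b h : ℂ[X]) (z : ℂ) : ℂ :=
  (cj ((wronsk a b).derivative.eval z) * invNormSq a b z ^ 2 - 2 * cj ((wronsk a b).eval z) *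
    (a.eval z * cj (a.derivative.eval z) + b.eval z * cj (b.derivative.eval z)) *
      invNormSq a b z ^ 3) * h.eval z

lemma hasWirtingerAt_wolffKernel {a b : ℂ[X]} (h : ℂ[X]) {z : ℂ}
    (hne : a.eval z * cj (a.eval z) + b.eval z * cj (b.eval z) ≠ 0) :
    HasWirtingerAt (wolffKernel a b h) (wolffKernelDeriv a b h z) (wolffKernelDerivBar a b h z)
      z := by
  have hG := hasWirtingerAt_invNormSq hne
  refine HasWirtingerAt.congr_values (((hasWirtingerAt_conj_eval (wronsk a b) z).mul
    (hG.mul hG)).mul (hasWirtingerAt_eval h z)) ?_ ?_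
  · simp only [wolffKernelDeriv]; ring
  · simp only [wolffKernelDerivBar]; ring

/-- The function whose circle mean is estimated in Wolff's argument. -/
def wolffPotential (a b r₁ r₂ g : ℂ[X]) (z : ℂ) : ℂ :=
  (cj (a.eval z) * r₁.eval z + cj (b.eval z) * r₂.eval z) * invNormSq a b z * (g.eval z * z)

/-- The holomorphic derivative `∂` of `wolffPotential`. -/
def wolffPotentialDeriv (a b r₁ r₂ g : ℂ[X]) (z : ℂ) : ℂ :=
  ((cj (a.eval z) * r₁.derivative.eval z +
    cj (b.eval z) * r₂.derivative.eval z) * invNormSq a b z -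
    (cj (a.eval z) * r₁.eval z + cj (b.eval z) * r₂.eval z) *
      (a.derivative.eval z * cj (a.eval z) + b.derivative.eval z * cj (b.eval z)) *
        invNormSq a b z ^ 2) * (g.eval z * z) +
    (cj (a.eval z) * r₁.eval z + cj (b.eval z) * r₂.eval z) * invNormSq a b z *
      (g.derivative.eval z * z + g.eval z)

lemma hasWirtingerAt_wolffPotential {a b : ℂ[X]} (r₁ r₂ g : ℂ[X]) {z : ℂ}
    (hne : a.eval z * cj (a.eval z) + b.eval z * cj (b.eval z) ≠ 0) :
    HasWirtingerAt (wolffPotential a b r₁ r₂ g) (wolffPotentialDeriv a b r₁ r₂ g z)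
      (z * wolffKernel a b ((b * r₁ - a * r₂) * g) z) z := by
  have hid : HasWirtingerAt (fun z : ℂ => z) 1 0 z := .of_hasDerivAt (hasDerivAt_id z)
  refine HasWirtingerAt.congr_values (((((hasWirtingerAt_conj_eval a z).mul
    (hasWirtingerAt_eval r₁ z)).add ((hasWirtingerAt_conj_eval b z).mul
    (hasWirtingerAt_eval r₂ z))).mul (hasWirtingerAt_invNormSq hne)).mul
    ((hasWirtingerAt_eval g z).mul hid)) ?_ ?_
  · simp only [wolffPotentialDeriv]; ring
  · have h1 : (a.eval z * cj (a.eval z) + b.eval z * cj (b.eval z)) * invNormSq a b z = 1 :=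
      mul_inv_cancel₀ hne
    simp only [wolffKernel, wronsk, eval_mul, eval_sub, map_sub, map_mul]
    linear_combination (-(cj (a.derivative.eval z) * r₁.eval z +
      cj (b.derivative.eval z) * r₂.eval z) * invNormSq a b z * g.eval z * z) * h1

lemma norm_wolffKernelDeriv_le {M δ τ : ℝ} (hδ : 0 < δ) (hM : 0 ≤ M) (hτ : 0 < τ) {a b : ℂ[X]}
    {z : ℂ} (ha : ‖a.eval z‖ ≤ M) (hb : ‖b.eval z‖ ≤ M)
    (hab : δ ≤ ‖a.eval z‖ ^ 2 + ‖b.eval z‖ ^ 2) (s g : ℂ[X]) :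
    ‖wolffKernelDeriv a b (s * g) z‖ ≤ (M ^ 2 * δ⁻¹ ^ 3 + M * δ⁻¹ ^ 2) *
      (τ * wolffEnergy M a b g z + τ⁻¹ * wolffEnergy M a b s z) := by
  have e1 := energy_bound g ha hb
  have e2 := energy_bound s ha hb
  have hτ' : 0 < τ⁻¹ := inv_pos.2 hτ
  have h2 := norm_invNormSq_le hδ hab
  have h1 : ‖a.derivative.eval z * cj (a.eval z) + b.derivative.eval z * cj (b.eval z)‖
      ≤ M * (‖a.derivative.eval z‖ + ‖b.derivative.eval z‖) := by
    refine (norm_add_le _ _).trans ?_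
    rw [norm_mul, norm_mul, RCLike.norm_conj, RCLike.norm_conj, mul_add, mul_comm,
      mul_comm _ ‖b.eval z‖]
    gcongr
  calc ‖wolffKernelDeriv a b (s * g) z‖
      ≤ M * (‖a.derivative.eval z‖ + ‖b.derivative.eval z‖) *
      (2 * δ⁻¹ ^ 3 * (M * (‖a.derivative.eval z‖ + ‖b.derivative.eval z‖)) *
        (‖s.eval z‖ * ‖g.eval z‖) + δ⁻¹ ^ 2 *
          (‖s.derivative.eval z‖ * ‖g.eval z‖ + ‖s.eval z‖ * ‖g.derivative.eval z‖)) := by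
        rw [wolffKernelDeriv, norm_mul, RCLike.norm_conj]
        refine mul_le_mul (norm_wronsk_le ha hb) ?_ (norm_nonneg _) (by positivity)
        refine (norm_add_le _ _).trans (add_le_add ?_ ?_)
        · rw [norm_mul, norm_mul, norm_mul, norm_pow, eval_mul, norm_mul, norm_neg,
            Complex.norm_ofNat, mul_right_comm 2 (δ⁻¹ ^ 3)]
          gcongr
        · rw [norm_mul, norm_pow, derivative_mul, eval_add, eval_mul, eval_mul]
          gcongr
          refine (norm_add_le _ _).trans ?_
          rw [norm_mul, norm_mul]
    _ ≤ (M ^ 2 * δ⁻¹ ^ 3 + M * δ⁻¹ ^ 2) *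
        (τ * ((‖a.derivative.eval z‖ + ‖b.derivative.eval z‖) ^ 2 * ‖g.eval z‖ ^ 2 +
          ‖g.derivative.eval z‖ ^ 2) + τ⁻¹ *
          ((‖a.derivative.eval z‖ + ‖b.derivative.eval z‖) ^ 2 * ‖s.eval z‖ ^ 2 +
          ‖s.derivative.eval z‖ ^ 2)) :=
        wolff_pointwise hτ hM (by positivity) le_rfl
    _ ≤ _ := by gcongr

lemma norm_wolffKernel_zero_le {M δ τ : ℝ} (hδ : 0 < δ) (hM : 0 ≤ M) (hτ : 0 < τ) {a b : ℂ[X]}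
    (ha : ∀ z : ℂ, ‖z‖ ≤ 1 → ‖a.eval z‖ ≤ M) (hb : ∀ z : ℂ, ‖z‖ ≤ 1 → ‖b.eval z‖ ≤ M)
    (hab : δ ≤ ‖a.eval 0‖ ^ 2 + ‖b.eval 0‖ ^ 2) (s g : ℂ[X]) :
    ‖wolffKernel a b (s * g) 0‖ ≤ (M ^ 2 * δ⁻¹ ^ 3 + M * δ⁻¹ ^ 2) *
      ((16 * M ^ 2 + 1) * (τ * polyNormSq g + τ⁻¹ * polyNormSq s)) := by
  have hz : ‖(0 : ℂ)‖ ≤ 1 := by simp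
  have hs0 : ‖s.eval 0‖ ^ 2 ≤ polyNormSq s := by
    rw [← coeff_zero_eq_eval_zero]; exact norm_coeff_sq_le s 0
  have e1 := energy_bound g (ha 0 hz) (hb 0 hz)
  have e2 := wolffEnergy_zero_le ha hb g
  have hy := mul_le_young
    (x := (‖a.derivative.eval 0‖ + ‖b.derivative.eval 0‖) * ‖g.eval 0‖) (y := ‖s.eval 0‖) hτ
  have hτ' : 0 < τ⁻¹ := inv_pos.2 hτ
  have hNs := polyNormSq_nonneg s
  have hNg := polyNormSq_nonneg g
  calc ‖wolffKernel a b (s * g) 0‖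
      ≤ M * (‖a.derivative.eval 0‖ + ‖b.derivative.eval 0‖) * (δ⁻¹ * δ⁻¹) *
      (‖s.eval 0‖ * ‖g.eval 0‖) := by
        rw [wolffKernel, norm_mul, norm_mul, norm_mul, RCLike.norm_conj, eval_mul, norm_mul]
        have h2 := norm_invNormSq_le hδ hab
        have h3 := norm_wronsk_le (ha 0 hz) (hb 0 hz)
        gcongr
    _ = (M * δ⁻¹ ^ 2) * ((‖a.derivative.eval 0‖ + ‖b.derivative.eval 0‖) * ‖g.eval 0‖ *
          ‖s.eval 0‖) := by ring
    _ ≤ (M * δ⁻¹ ^ 2) * ((16 * M ^ 2 + 1) * (τ * polyNormSq g + τ⁻¹ * polyNormSq s)) := by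
        refine mul_le_mul_of_nonneg_left (hy.trans ?_) (by positivity)
        rw [mul_pow]
        have i1 : (‖a.derivative.eval 0‖ + ‖b.derivative.eval 0‖) ^ 2 * ‖g.eval 0‖ ^ 2 ≤
          (16 * M ^ 2 + 1) * polyNormSq g := by
          have := sq_nonneg ‖g.derivative.eval 0‖
          linarith
        have i2 : ‖s.eval 0‖ ^ 2 ≤ (16 * M ^ 2 + 1) * polyNormSq s := by
          nlinarith [mul_nonneg (sq_nonneg M) hNs]
        have i3 := mul_le_mul_of_nonneg_left i1 hτ.le
        have i4 := mul_le_mul_of_nonneg_left i2 hτ'.le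
        have i5 : 0 ≤ τ * ((16 * M ^ 2 + 1) * polyNormSq g) := by positivity
        have i6 : 0 ≤ τ⁻¹ * ((16 * M ^ 2 + 1) * polyNormSq s) := by positivity
        linarith
    _ ≤ _ := by
        gcongr
        have : 0 ≤ M ^ 2 * δ⁻¹ ^ 3 := by positivity
        linarith

lemma integral_wolffBound_le {M C τ : ℝ} (hC : 0 ≤ C) (hτ : 0 < τ) {a b : ℂ[X]}
    (ha : ∀ z : ℂ, ‖z‖ ≤ 1 → ‖a.eval z‖ ≤ M) (hb : ∀ z : ℂ, ‖z‖ ≤ 1 → ‖b.eval z‖ ≤ M)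
    (s g : ℂ[X]) :
    ∫ r in (0 : ℝ)..1, (1 - r ^ 2) * ∫ t in (0 : ℝ)..(2 * Real.pi),
      C * (τ * wolffEnergy M a b g (polarPt r t) + τ⁻¹ * wolffEnergy M a b s (polarPt r t)) ≤
      2 * Real.pi * (C * ((16 * M ^ 2 + 1) * (τ * polyNormSq g + τ⁻¹ * polyNormSq s))) := by
  have hi : ∀ (f : ℂ[X]) (r : ℝ), IntervalIntegrable
      (fun t => wolffEnergy M a b f (polarPt r t)) volume 0 (2 * Real.pi) := fun f r =>
    ((continuous_wolffEnergy M a b f).comp (continuous_polarPt r)).intervalIntegrable _ _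
  have hj : ∀ f : ℂ[X], IntervalIntegrable (fun r : ℝ => (1 - r ^ 2) *
      ∫ t in (0 : ℝ)..(2 * Real.pi), wolffEnergy M a b f (polarPt r t)) volume 0 1 := by
    intro f
    refine Continuous.intervalIntegrable (Continuous.mul (by fun_prop) ?_) _ _
    refine intervalIntegral.continuous_parametric_intervalIntegral_of_continuous' ?_ _ _
    have := continuous_wolffEnergy M a b f
    unfold Function.uncurry polarPt
    fun_prop
  have e : ∀ r : ℝ, (1 - r ^ 2) * ∫ t in (0 : ℝ)..(2 * Real.pi),
      C * (τ * wolffEnergy M a b g (polarPt r t) + τ⁻¹ * wolffEnergy M a b s (polarPt r t)) =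
      C * (τ * ((1 - r ^ 2) * ∫ t in (0 : ℝ)..(2 * Real.pi),
        wolffEnergy M a b g (polarPt r t)) +
        τ⁻¹ * ((1 - r ^ 2) * ∫ t in (0 : ℝ)..(2 * Real.pi),
        wolffEnergy M a b s (polarPt r t))) := by
    intro r
    rw [intervalIntegral.integral_const_mul, intervalIntegral.integral_add
      ((hi g r).const_mul _) ((hi s r).const_mul _), intervalIntegral.integral_const_mul,
      intervalIntegral.integral_const_mul]
    ring
  simp_rw [e]
  rw [intervalIntegral.integral_const_mul, intervalIntegral.integral_add
      ((hj g).const_mul _) ((hj s).const_mul _), intervalIntegral.integral_const_mul,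
      intervalIntegral.integral_const_mul]
  have h1 := mul_le_mul_of_nonneg_left (integral_wolffEnergy_le ha hb g) hτ.le
  have h2 := mul_le_mul_of_nonneg_left (integral_wolffEnergy_le ha hb s) (inv_pos.2 hτ).le
  have h3 := mul_le_mul_of_nonneg_left (add_le_add h1 h2) hC
  linarith

/-- Wolff's estimate, for polynomials. -/
lemma wolff_estimate {M δ τ : ℝ} (hδ : 0 < δ) (hM : 0 ≤ M) (hτ : 0 < τ) {a b : ℂ[X]}
    (ha : ∀ z : ℂ, ‖z‖ ≤ 1 → ‖a.eval z‖ ≤ M) (hb : ∀ z : ℂ, ‖z‖ ≤ 1 → ‖b.eval z‖ ≤ M)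
    (hab : ∀ z : ℂ, ‖z‖ ≤ 1 → δ ≤ ‖a.eval z‖ ^ 2 + ‖b.eval z‖ ^ 2) (r₁ r₂ g : ℂ[X]) :
    ‖angleIntegral (wolffPotential a b r₁ r₂ g) 1‖ ≤
      2 * Real.pi * (3 * ((M ^ 2 * δ⁻¹ ^ 3 + M * δ⁻¹ ^ 2) * ((16 * M ^ 2 + 1) *
        (τ * polyNormSq g + τ⁻¹ * polyNormSq (b * r₁ - a * r₂))))) := by
  have hne : ∀ z : ℂ, ‖z‖ ≤ 1 →
      a.eval z * cj (a.eval z) + b.eval z * cj (b.eval z) ≠ 0 := fun z hz =>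
    norm_sq_add_ne_zero hδ (hab z hz)
  have hGc : ContinuousOn (invNormSq a b) (closedBall 0 1) :=
    continuousOn_of_hasWirtingerAt fun z hz => hasWirtingerAt_invNormSq (hne z hz)
  obtain ⟨s, hs⟩ : ∃ s, s = b * r₁ - a * r₂ := ⟨_, rfl⟩
  rw [← hs]
  have hpc : ContinuousOn (wolffPotentialDeriv a b r₁ r₂ g) (closedBall 0 1) := by
    unfold wolffPotentialDeriv; fun_prop
  have hk₁c : ContinuousOn (wolffKernelDeriv a b (s * g)) (closedBall 0 1) := by
    unfold wolffKernelDeriv; fun_prop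
  have hk₂c : ContinuousOn (wolffKernelDerivBar a b (s * g)) (closedBall 0 1) := by
    unfold wolffKernelDerivBar; fun_prop
  have hBc : Continuous fun z => (M ^ 2 * δ⁻¹ ^ 3 + M * δ⁻¹ ^ 2) *
      (τ * wolffEnergy M a b g z + τ⁻¹ * wolffEnergy M a b s z) := by
    exact continuous_const.mul ((continuous_const.mul (continuous_wolffEnergy M a b g)).add
      (continuous_const.mul (continuous_wolffEnergy M a b s)))
  have hFw : ∀ z : ℂ, ‖z‖ ≤ 1 → HasWirtingerAt (wolffPotential a b r₁ r₂ g)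
      (wolffPotentialDeriv a b r₁ r₂ g z) (z * wolffKernel a b (s * g) z) z := fun z hz => by
    rw [hs]; exact hasWirtingerAt_wolffPotential r₁ r₂ g (hne z hz)
  have hF0 : wolffPotential a b r₁ r₂ g 0 = 0 := by simp [wolffPotential]
  have main := norm_angleIntegral_one_le hFw hpc hF0
    (fun z hz => hasWirtingerAt_wolffKernel (s * g) (hne z hz)) hk₁c hk₂c hBc
    (fun z hz => norm_wolffKernelDeriv_le hδ hM hτ (ha z hz) (hb z hz) (hab z hz) s g)
  have hint := integral_wolffBound_le (C := M ^ 2 * δ⁻¹ ^ 3 + M * δ⁻¹ ^ 2) (by positivity) hτ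
    ha hb s g
  have hK0 := mul_le_mul_of_nonneg_left
    (norm_wolffKernel_zero_le hδ hM hτ ha hb (hab 0 (by simp)) s g) Real.two_pi_pos.le
  refine main.trans ?_
  linarith

end Corona

section PolyToeplitz

open Polynomial

/-- The Toeplitz operator with symbol `conj a` applied to a monomial `z ^ m`. -/
def monomialToeplitz (a : ℂ[X]) (m : ℕ) : ℂ[X] :=
  ∑ k ∈ range (m + 1), monomial (m - k) (cj (a.coeff k))

/-- The Toeplitz operator with symbol `conj a` applied to a polynomial. -/
def polyToeplitz (a g : ℂ[X]) : ℂ[X] :=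
  ∑ m ∈ range (g.natDegree + 1), C (g.coeff m) * monomialToeplitz a m

lemma coeff_monomialToeplitz (a : ℂ[X]) (m n : ℕ) :
    (monomialToeplitz a m).coeff n = if n ≤ m then cj (a.coeff (m - n)) else 0 := by
  simp only [monomialToeplitz, finsetSum_coeff, coeff_monomial]
  split_ifs with h
  · rw [sum_eq_single (m - n)]
    · simp only [if_pos (show m - (m - n) = n by omega)]
    · intro k hk hkn
      rw [Finset.mem_range] at hk
      rw [if_neg (by omega)]
    · intro h'
      simp at h'
  · refine sum_eq_zero fun k _ => if_neg (by omega)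

lemma coeff_polyToeplitz (a g : ℂ[X]) (n : ℕ) :
    (polyToeplitz a g).coeff n = ∑ m ∈ range (g.natDegree + 1),
      g.coeff m * if n ≤ m then cj (a.coeff (m - n)) else 0 := by
  simp [polyToeplitz, finsetSum_coeff, coeff_monomialToeplitz]

lemma natDegree_polyToeplitz_le (a g : ℂ[X]) : (polyToeplitz a g).natDegree ≤ g.natDegree := by
  rw [natDegree_le_iff_coeff_eq_zero]
  intro n hn
  rw [coeff_polyToeplitz]
  refine sum_eq_zero fun m hm => ?_
  rw [Finset.mem_range] at hm
  rw [if_neg (by omega), mul_zero]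

lemma exists_monomialToeplitz_remainder (a : ℂ[X]) (m : ℕ) : ∃ r : ℂ[X], ∀ z : ℂ, ‖z‖ = 1 →
    cj (a.eval z) * z ^ m = (monomialToeplitz a m).eval z + cj (z * r.eval z) := by
  refine ⟨∑ j ∈ range (a.natDegree + 1), monomial j (a.coeff (m + 1 + j)), fun z hz => ?_⟩
  have hzz : z * cj z = 1 := by
    rw [Complex.mul_conj, Complex.normSq_eq_norm_sq, hz]; simp
  have hp : ∀ k : ℕ, z ^ k * cj z ^ k = 1 := fun k => by rw [← mul_pow, hzz, one_pow]
  rw [eval_eq_sum_range' (n := m + 1 + (a.natDegree + 1)) (by omega), Finset.sum_range_add,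
    map_add, add_mul]
  congr 1
  · simp only [monomialToeplitz, eval_finsetSum, eval_monomial, map_sum, map_mul, map_pow,
      Finset.sum_mul]
    refine sum_congr rfl fun k hk => ?_
    rw [Finset.mem_range] at hk
    have : z ^ m = z ^ (m - k) * z ^ k := by rw [← pow_add]; congr 1; omega
    rw [this]
    linear_combination (cj (a.coeff k) * z ^ (m - k)) * hp k
  · simp only [eval_finsetSum, eval_monomial, map_sum, map_mul, map_pow, Finset.sum_mul,
      Finset.mul_sum]
    refine sum_congr rfl fun k hk => ?_
    rw [pow_add, pow_add]
    linear_combination (cj (a.coeff (m + 1 + k)) * cj z * cj z ^ k) * hp m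

lemma exists_polyToeplitz_remainder (a g : ℂ[X]) : ∃ r : ℂ[X], ∀ z : ℂ, ‖z‖ = 1 →
    cj (a.eval z) * g.eval z = (polyToeplitz a g).eval z + cj (z * r.eval z) := by
  choose r hr using exists_monomialToeplitz_remainder a
  refine ⟨∑ m ∈ range (g.natDegree + 1), C (cj (g.coeff m)) * r m, fun z hz => ?_⟩
  rw [eval_eq_sum_range (p := g), polyToeplitz, eval_finsetSum, eval_finsetSum, Finset.mul_sum,
    Finset.mul_sum, map_sum, ← Finset.sum_add_distrib]
  refine sum_congr rfl fun m _ => ?_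
  have := hr m z hz
  simp only [eval_mul, eval_C, map_mul, Complex.conj_conj] at this ⊢
  linear_combination g.coeff m * this

/-- The coupling term of the two remainders is controlled by the Toeplitz images. -/
lemma polyNormSq_coupling_le {M : ℝ} {a b p q g r₁ r₂ : ℂ[X]}
    (ha : ∀ z : ℂ, ‖z‖ ≤ 1 → ‖a.eval z‖ ≤ M) (hb : ∀ z : ℂ, ‖z‖ ≤ 1 → ‖b.eval z‖ ≤ M)
    (h₁ : ∀ z : ℂ, ‖z‖ = 1 → cj (a.eval z) * g.eval z = p.eval z + cj (z * r₁.eval z))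
    (h₂ : ∀ z : ℂ, ‖z‖ = 1 → cj (b.eval z) * g.eval z = q.eval z + cj (z * r₂.eval z)) :
    polyNormSq (b * r₁ - a * r₂) ≤ 2 * M ^ 2 * (polyNormSq p + polyNormSq q) := by
  have hpt : ∀ t : ℝ, ‖(b * r₁ - a * r₂).eval (polarPt 1 t)‖ ^ 2 ≤
      2 * M ^ 2 * (‖p.eval (polarPt 1 t)‖ ^ 2 + ‖q.eval (polarPt 1 t)‖ ^ 2) := by
    intro t
    have hz : ‖polarPt 1 t‖ = 1 := by simp [norm_polarPt]
    generalize polarPt 1 t = z at hz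
    have e₁ := congrArg cj (h₁ z hz)
    have e₂ := congrArg cj (h₂ z hz)
    simp only [map_mul, map_add, Complex.conj_conj] at e₁ e₂
    have e : z * (b * r₁ - a * r₂).eval z =
        a.eval z * cj (q.eval z) + -(b.eval z * cj (p.eval z)) := by
      simp only [eval_sub, eval_mul]
      linear_combination a.eval z * e₂ - b.eval z * e₁
    have := norm_add_sq_le (a.eval z * cj (q.eval z)) (-(b.eval z * cj (p.eval z)))
    rw [← e, norm_mul, hz, one_mul, norm_neg, norm_mul, norm_mul, RCLike.norm_conj,
      RCLike.norm_conj, mul_pow, mul_pow] at this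
    have hA : ‖a.eval z‖ ^ 2 ≤ M ^ 2 := by gcongr; exact ha z hz.le
    have hB : ‖b.eval z‖ ^ 2 ≤ M ^ 2 := by gcongr; exact hb z hz.le
    nlinarith [mul_le_mul_of_nonneg_right hA (sq_nonneg ‖q.eval z‖),
      mul_le_mul_of_nonneg_right hB (sq_nonneg ‖p.eval z‖)]
  have hc : ∀ f : ℂ[X], Continuous fun t => ‖f.eval (polarPt 1 t)‖ ^ 2 := fun f =>
    ((f.continuous.comp (continuous_polarPt 1)).norm.pow 2)
  have hi := intervalIntegral.integral_mono_on (μ := volume) Real.two_pi_pos.le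
    ((hc (b * r₁ - a * r₂)).intervalIntegrable 0 (2 * Real.pi))
    ((((hc p).add (hc q)).const_mul (2 * M ^ 2)).intervalIntegrable 0 (2 * Real.pi))
    (fun t _ => hpt t)
  simp only [Pi.add_apply] at hi
  rw [intervalIntegral.integral_const_mul, intervalIntegral.integral_add
    ((hc p).intervalIntegrable _ _) ((hc q).intervalIntegrable _ _),
    integral_normSq_eval_one, integral_normSq_eval_one, integral_normSq_eval_one] at hi
  have := Real.two_pi_pos
  nlinarith

lemma polyNormSq_le_of_remainder {M δ τ : ℝ} (hδ : 0 < δ) (hM : 0 ≤ M) (hτ : 0 < τ)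
    {a b p q g r₁ r₂ : ℂ[X]}
    (ha : ∀ z : ℂ, ‖z‖ ≤ 1 → ‖a.eval z‖ ≤ M) (hb : ∀ z : ℂ, ‖z‖ ≤ 1 → ‖b.eval z‖ ≤ M)
    (hab : ∀ z : ℂ, ‖z‖ ≤ 1 → δ ≤ ‖a.eval z‖ ^ 2 + ‖b.eval z‖ ^ 2)
    (h₁ : ∀ z : ℂ, ‖z‖ = 1 → cj (a.eval z) * g.eval z = p.eval z + cj (z * r₁.eval z))
    (h₂ : ∀ z : ℂ, ‖z‖ = 1 → cj (b.eval z) * g.eval z = q.eval z + cj (z * r₂.eval z)) :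
    polyNormSq g ≤ M * δ⁻¹ * (τ * polyNormSq g + τ⁻¹ * (polyNormSq p + polyNormSq q)) +
      3 * ((M ^ 2 * δ⁻¹ ^ 3 + M * δ⁻¹ ^ 2) * ((16 * M ^ 2 + 1) *
        (τ * polyNormSq g + τ⁻¹ * polyNormSq (b * r₁ - a * r₂)))) := by
  have hW := wolff_estimate hδ hM hτ ha hb hab r₁ r₂ g
  have hpt : ∀ t : ℝ, ‖g.eval (polarPt 1 t)‖ ^ 2 ≤
      M * δ⁻¹ * (τ * ‖g.eval (polarPt 1 t)‖ ^ 2 +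
        τ⁻¹ * (‖p.eval (polarPt 1 t)‖ ^ 2 + ‖q.eval (polarPt 1 t)‖ ^ 2)) +
      (wolffPotential a b r₁ r₂ g (polarPt 1 t)).re := by
    intro t
    have hz : ‖polarPt 1 t‖ = 1 := by simp [norm_polarPt]
    generalize polarPt 1 t = z at hz
    have hD : (a.eval z * cj (a.eval z) + b.eval z * cj (b.eval z)) * invNormSq a b z = 1 :=
      mul_inv_cancel₀ (norm_sq_add_ne_zero hδ (hab z hz.le))
    have hDc : cj (invNormSq a b z) = invNormSq a b z := by
      rw [invNormSq, norm_sq_add_eq, map_inv₀, Complex.conj_ofReal]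
    have e : ((‖g.eval z‖ ^ 2 : ℝ) : ℂ) =
        (a.eval z * p.eval z + b.eval z * q.eval z) * cj (g.eval z) * invNormSq a b z +
          cj (wolffPotential a b r₁ r₂ g z) := by
      have e₁ := h₁ z hz
      have e₂ := h₂ z hz
      have e₀ : ((‖g.eval z‖ ^ 2 : ℝ) : ℂ) = g.eval z * cj (g.eval z) := by
        rw [Complex.mul_conj, Complex.normSq_eq_norm_sq]
      rw [e₀]
      simp only [wolffPotential, map_mul, map_add, Complex.conj_conj, hDc] at e₁ e₂ ⊢
      linear_combination (-(g.eval z * cj (g.eval z))) * hD +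
        (a.eval z * cj (g.eval z) * invNormSq a b z) * e₁ +
        (b.eval z * cj (g.eval z) * invNormSq a b z) * e₂
    have e' := congrArg Complex.re e
    rw [Complex.ofReal_re, Complex.add_re, Complex.conj_re] at e'
    have hT : ((a.eval z * p.eval z + b.eval z * q.eval z) * cj (g.eval z) *
        invNormSq a b z).re ≤ M * δ⁻¹ * (τ * ‖g.eval z‖ ^ 2 +
        τ⁻¹ * (‖p.eval z‖ ^ 2 + ‖q.eval z‖ ^ 2)) := by
      refine (Complex.re_le_norm _).trans ?_
      rw [norm_mul, norm_mul, RCLike.norm_conj]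
      have n1 : ‖a.eval z * p.eval z + b.eval z * q.eval z‖ ≤
          M * (‖p.eval z‖ + ‖q.eval z‖) := by
        refine (norm_add_le _ _).trans ?_
        rw [norm_mul, norm_mul, mul_add]
        gcongr
        · exact ha z hz.le
        · exact hb z hz.le
      have n2 := norm_invNormSq_le hδ (hab z hz.le)
      have y1 := mul_le_young (x := ‖g.eval z‖) (y := ‖p.eval z‖) hτ
      have y2 := mul_le_young (x := ‖g.eval z‖) (y := ‖q.eval z‖) hτ
      calc _ ≤ M * (‖p.eval z‖ + ‖q.eval z‖) * ‖g.eval z‖ * δ⁻¹ := by gcongr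
        _ = M * δ⁻¹ * (‖g.eval z‖ * ‖p.eval z‖ + ‖g.eval z‖ * ‖q.eval z‖) := by ring
        _ ≤ _ := by
          refine mul_le_mul_of_nonneg_left ?_ (by positivity)
          have : 0 ≤ τ⁻¹ * (‖p.eval z‖ ^ 2 + ‖q.eval z‖ ^ 2) := by positivity
          linarith
    linarith
  have hc : ∀ f : ℂ[X], Continuous fun t => ‖f.eval (polarPt 1 t)‖ ^ 2 := fun f =>
    ((f.continuous.comp (continuous_polarPt 1)).norm.pow 2)
  have hFc : Continuous fun t => wolffPotential a b r₁ r₂ g (polarPt 1 t) := by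
    have h : ContinuousOn (wolffPotential a b r₁ r₂ g) (closedBall 0 1) :=
      continuousOn_of_hasWirtingerAt fun z hz =>
        hasWirtingerAt_wolffPotential r₁ r₂ g (norm_sq_add_ne_zero hδ (hab z hz))
    refine h.comp_continuous (continuous_polarPt 1) fun t => ?_
    simp [norm_polarPt]
  have hRc : Continuous fun t => (wolffPotential a b r₁ r₂ g (polarPt 1 t)).re :=
    Complex.continuous_re.comp hFc
  have hpq : Continuous fun t =>
      ‖p.eval (polarPt 1 t)‖ ^ 2 + ‖q.eval (polarPt 1 t)‖ ^ 2 := (hc p).add (hc q)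
  have h2c : Continuous fun t => τ * ‖g.eval (polarPt 1 t)‖ ^ 2 +
      τ⁻¹ * (‖p.eval (polarPt 1 t)‖ ^ 2 + ‖q.eval (polarPt 1 t)‖ ^ 2) :=
    ((hc g).const_mul τ).add (hpq.const_mul τ⁻¹)
  have hi := intervalIntegral.integral_mono_on (μ := volume) Real.two_pi_pos.le
    ((hc g).intervalIntegrable 0 (2 * Real.pi))
    (((h2c.const_mul (M * δ⁻¹)).add hRc).intervalIntegrable 0 (2 * Real.pi))
    (fun t _ => hpt t)
  simp only [Pi.add_apply] at hi
  rw [intervalIntegral.integral_add ((h2c.const_mul _).intervalIntegrable _ _)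
    (hRc.intervalIntegrable _ _), intervalIntegral.integral_const_mul,
    intervalIntegral.integral_add (((hc g).const_mul _).intervalIntegrable _ _)
    ((hpq.const_mul _).intervalIntegrable _ _),
    intervalIntegral.integral_const_mul, intervalIntegral.integral_const_mul,
    intervalIntegral.integral_add
    ((hc p).intervalIntegrable _ _) ((hc q).intervalIntegrable _ _),
    integral_normSq_eval_one, integral_normSq_eval_one, integral_normSq_eval_one] at hi
  have hre : ∫ t in (0 : ℝ)..(2 * Real.pi), (wolffPotential a b r₁ r₂ g (polarPt 1 t)).re ≤
      ‖angleIntegral (wolffPotential a b r₁ r₂ g) 1‖ := by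
    refine le_trans (le_of_eq ?_) (Complex.re_le_norm _)
    exact intervalIntegral.intervalIntegral_re (hFc.intervalIntegrable _ _)
  have hpi := Real.two_pi_pos
  have hfin := hi.trans (add_le_add_right (hre.trans hW) _)
  refine le_of_mul_le_mul_left (hfin.trans (le_of_eq ?_)) hpi
  ring

/-- The polynomial form of the Toeplitz corona lower bound. -/
lemma exists_polyToeplitz_lower_bound {M δ : ℝ} (hδ : 0 < δ) (hM : 0 < M) :
    ∃ K : ℝ, 0 < K ∧ ∀ a b : ℂ[X], (∀ z : ℂ, ‖z‖ ≤ 1 → ‖a.eval z‖ ≤ M) →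
      (∀ z : ℂ, ‖z‖ ≤ 1 → ‖b.eval z‖ ≤ M) →
      (∀ z : ℂ, ‖z‖ ≤ 1 → δ ≤ ‖a.eval z‖ ^ 2 + ‖b.eval z‖ ^ 2) → ∀ g : ℂ[X],
      polyNormSq g ≤ K * (polyNormSq (polyToeplitz a g) + polyNormSq (polyToeplitz b g)) := by
  obtain ⟨C₁, hC₁⟩ : ∃ C, C = M * δ⁻¹ := ⟨_, rfl⟩
  obtain ⟨C₂, hC₂⟩ : ∃ C, C = 3 * ((M ^ 2 * δ⁻¹ ^ 3 + M * δ⁻¹ ^ 2) * (16 * M ^ 2 + 1)) :=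
    ⟨_, rfl⟩
  have hC₁' : 0 < C₁ := by rw [hC₁]; positivity
  have hC₂' : 0 < C₂ := by rw [hC₂]; positivity
  obtain ⟨L, hL⟩ : ∃ L, L = C₁ + C₂ * (1 + 2 * M ^ 2) := ⟨_, rfl⟩
  have hL' : 0 < L := by rw [hL]; positivity
  refine ⟨4 * L ^ 2, by positivity, fun a b ha hb hab g => ?_⟩
  obtain ⟨r₁, h₁⟩ := exists_polyToeplitz_remainder a g
  obtain ⟨r₂, h₂⟩ := exists_polyToeplitz_remainder b g
  have hs := polyNormSq_coupling_le ha hb h₁ h₂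
  have hτ : 0 < (2 * L)⁻¹ := by positivity
  have key := polyNormSq_le_of_remainder hδ hM.le hτ ha hb hab h₁ h₂
  rw [← hC₁, inv_inv] at key
  have hG := polyNormSq_nonneg g
  have hP : 0 ≤ polyNormSq (polyToeplitz a g) + polyNormSq (polyToeplitz b g) :=
    add_nonneg (polyNormSq_nonneg _) (polyNormSq_nonneg _)
  generalize polyNormSq (polyToeplitz a g) + polyNormSq (polyToeplitz b g) = P at *
  generalize polyNormSq g = G at *
  generalize polyNormSq (b * r₁ - a * r₂) = S at *
  have key' : G ≤ (C₁ + C₂) * (2 * L)⁻¹ * G + 2 * L * (C₁ * P + C₂ * S) := by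
    refine key.trans (le_of_eq ?_)
    rw [hC₂]; ring
  have t1 : (C₁ + C₂) * (2 * L)⁻¹ ≤ 1 / 2 := by
    rw [← div_eq_mul_inv, div_le_div_iff₀ (by positivity) (by norm_num)]
    have : 0 ≤ C₂ * (2 * M ^ 2) := by positivity
    linarith
  have t2 : C₁ * P + C₂ * S ≤ L * P := by
    have h3 := mul_le_mul_of_nonneg_left hs hC₂'.le
    have : 0 ≤ C₂ * P := by positivity
    rw [hL]
    linarith
  have t3 := mul_le_mul_of_nonneg_right t1 hG
  have t4 := mul_le_mul_of_nonneg_left t2 (show 0 ≤ 2 * L by positivity)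
  linarith

end PolyToeplitz

section Taylor

lemma hasSum_taylorCoeff {f : ℂ → ℂ} (hf : DifferentiableOn ℂ f (ball 0 1)) {z : ℂ}
    (hz : z ∈ ball (0 : ℂ) 1) : HasSum (fun n => taylorCoeff f n * z ^ n) (f z) := by
  have := Complex.hasSum_taylorSeries_on_ball hf hz
  simp only [sub_zero, smul_eq_mul] at this
  convert! this using 2 with n
  rw [taylorCoeff]
  ring

lemma hasFPowerSeriesOnBall_tsum {c : ℕ → ℂ} {K : ℝ} (hc : ∀ n, ‖c n‖ ≤ K) :
    HasFPowerSeriesOnBall (fun z => ∑' n, c n * z ^ n) (FormalMultilinearSeries.ofScalars ℂ c)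
      0 1 := by
  have hr : 1 ≤ (FormalMultilinearSeries.ofScalars ℂ c).radius := by
    have := (FormalMultilinearSeries.ofScalars ℂ c).le_radius_of_bound K (r := 1) fun n => by
      simpa [FormalMultilinearSeries.ofScalars_norm] using hc n
    simpa using this
  have h := (FormalMultilinearSeries.ofScalars ℂ c).hasFPowerSeriesOnBall
    (lt_of_lt_of_le one_pos hr)
  have := h.mono one_pos hr
  convert! this using 1
  ext z
  simp [FormalMultilinearSeries.sum, mul_comm]

lemma differentiableOn_tsum_pow {c : ℕ → ℂ} {K : ℝ} (hc : ∀ n, ‖c n‖ ≤ K) :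
    DifferentiableOn ℂ (fun z => ∑' n, c n * z ^ n) (ball 0 1) := by
  have := (hasFPowerSeriesOnBall_tsum hc).differentiableOn
  rwa [← ENNReal.ofReal_one, Metric.eball_ofReal] at this

lemma taylorCoeff_tsum_pow {c : ℕ → ℂ} {K : ℝ} (hc : ∀ n, ‖c n‖ ≤ K) (n : ℕ) :
    taylorCoeff (fun z => ∑' n, c n * z ^ n) n = c n := by
  have h1 := (hasFPowerSeriesOnBall_tsum hc).hasFPowerSeriesAt
  have h2 := AnalyticAt.hasFPowerSeriesAt h1.analyticAt
  have h3 := h2.eq_formalMultilinearSeries h1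
  have h4 := congrArg (fun p => FormalMultilinearSeries.coeff p n) h3
  simpa [taylorCoeff, FormalMultilinearSeries.coeff_ofScalars] using h4

lemma taylorCoeff_mul {f g : ℂ → ℂ} (hf : DifferentiableOn ℂ f (ball 0 1))
    (hg : DifferentiableOn ℂ g (ball 0 1)) (n : ℕ) :
    taylorCoeff (fun z => f z * g z) n =
      ∑ k ∈ range (n + 1), taylorCoeff f k * taylorCoeff g (n - k) := by
  have h0 : ball (0 : ℂ) 1 ∈ 𝓝 (0 : ℂ) := ball_mem_nhds 0 one_pos
  have h1 : ContDiffAt ℂ n f 0 := (hf.analyticAt h0).contDiffAt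
  have h2 : ContDiffAt ℂ n g 0 := (hg.analyticAt h0).contDiffAt
  rw [taylorCoeff, iteratedDeriv_fun_mul h1 h2, Finset.sum_div]
  refine sum_congr rfl fun k hk => ?_
  have hk' : k ≤ n := Nat.lt_succ_iff.1 (Finset.mem_range.1 hk)
  have e : ((n.choose k : ℕ) : ℂ) = (n.factorial : ℂ) / (k.factorial * (n - k).factorial) := by
    rw [Nat.cast_choose ℂ hk']
  have a1 : (n.factorial : ℂ) ≠ 0 := by exact_mod_cast n.factorial_ne_zero
  have a2 : (k.factorial : ℂ) ≠ 0 := by exact_mod_cast k.factorial_ne_zero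
  have a3 : ((n - k).factorial : ℂ) ≠ 0 := by exact_mod_cast (n - k).factorial_ne_zero
  rw [e, taylorCoeff, taylorCoeff]
  field_simp

lemma polarPt_mem_ball {r : ℝ} (h0 : 0 ≤ r) (h1 : r < 1) (t : ℝ) :
    polarPt r t ∈ ball (0 : ℂ) 1 := by
  rw [mem_ball_zero_iff, norm_polarPt, abs_of_nonneg h0]
  exact h1

lemma continuous_comp_polarPt {f : ℂ → ℂ} (hf : DifferentiableOn ℂ f (ball 0 1)) {r : ℝ}
    (h0 : 0 ≤ r) (h1 : r < 1) : Continuous fun t => f (polarPt r t) :=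
  hf.continuousOn.comp_continuous (continuous_polarPt r) fun t => polarPt_mem_ball h0 h1 t

lemma summable_norm_taylorCoeff_mul_pow {f : ℂ → ℂ} (hf : DifferentiableOn ℂ f (ball 0 1))
    {r : ℝ} (h0 : 0 ≤ r) (h1 : r < 1) : Summable fun n => ‖taylorCoeff f n‖ * r ^ n := by
  have hz : (r : ℂ) ∈ ball (0 : ℂ) 1 := by
    simpa [abs_of_nonneg h0] using h1
  have := (hasSum_taylorCoeff hf hz).summable.norm
  simpa [abs_of_nonneg h0] using this

/-- Parseval's identity on a circle of radius less than one, as a limit. -/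
lemma tendsto_sum_taylorCoeff_sq {f : ℂ → ℂ} (hf : DifferentiableOn ℂ f (ball 0 1))
    {r : ℝ} (h0 : 0 ≤ r) (h1 : r < 1) :
    Tendsto (fun N => 2 * Real.pi * ∑ n ∈ range N, ‖taylorCoeff f n‖ ^ 2 * r ^ (2 * n)) atTop
      (𝓝 (∫ t in (0 : ℝ)..(2 * Real.pi), ‖f (polarPt r t)‖ ^ 2)) := by
  simp_rw [← integral_normSq_sum]
  have hs := summable_norm_taylorCoeff_mul_pow hf h0 h1
  refine intervalIntegral.tendsto_integral_filter_of_dominated_convergence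
    (fun _ => (∑' n, ‖taylorCoeff f n‖ * r ^ n) ^ 2) ?_ ?_ ?_ ?_
  · refine Eventually.of_forall fun N => Continuous.aestronglyMeasurable ?_
    have := continuous_polarPt r
    fun_prop
  · refine Eventually.of_forall fun N => ae_of_all _ fun t _ => ?_
    rw [norm_pow, norm_norm]
    gcongr
    refine (norm_sum_le _ _).trans ?_
    have e : ∀ n, ‖taylorCoeff f n * polarPt r t ^ n‖ = ‖taylorCoeff f n‖ * r ^ n := fun n => by
      rw [norm_mul, norm_pow, norm_polarPt, abs_of_nonneg h0]
    simp_rw [e]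
    exact hs.sum_le_tsum _ fun n _ => by positivity
  · exact intervalIntegrable_const
  · refine ae_of_all _ fun t _ => ?_
    exact ((hasSum_taylorCoeff hf (polarPt_mem_ball h0 h1 t)).tendsto_sum_nat).norm.pow 2

lemma MemHardy2.summable {f : ℂ → ℂ} (hf : MemHardy2 f) :
    Summable fun n => ‖taylorCoeff f n‖ ^ 2 := by
  obtain ⟨hd, C, hC⟩ := hf
  refine summable_of_sum_range_le (c := C) (fun n => by positivity) fun N => ?_
  have hpi := Real.two_pi_pos
  have key : ∀ r : ℝ, 0 < r → r < 1 → ∑ n ∈ range N, ‖taylorCoeff f n‖ ^ 2 * r ^ (2 * n) ≤ C := by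
    intro r h0 h1
    have ht := tendsto_sum_taylorCoeff_sq hd h0.le h1
    have hmono : Monotone fun N =>
        2 * Real.pi * ∑ n ∈ range N, ‖taylorCoeff f n‖ ^ 2 * r ^ (2 * n) := by
      intro m n hmn
      refine mul_le_mul_of_nonneg_left ?_ hpi.le
      exact sum_le_sum_of_subset_of_nonneg (range_mono hmn) fun _ _ _ => by positivity
    have h2 := hmono.ge_of_tendsto ht N
    have h3 := hC r h0 h1
    have h4 : ∫ t in (0 : ℝ)..(2 * Real.pi), ‖f (polarPt r t)‖ ^ 2 ≤ 2 * Real.pi * C := by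
      rw [one_div, inv_mul_le_iff₀ hpi] at h3
      exact h3
    exact le_of_mul_le_mul_left (h2.trans h4) hpi
  have hcont : Tendsto (fun r : ℝ => ∑ n ∈ range N, ‖taylorCoeff f n‖ ^ 2 * r ^ (2 * n))
      (𝓝[<] 1) (𝓝 (∑ n ∈ range N, ‖taylorCoeff f n‖ ^ 2 * (1 : ℝ) ^ (2 * n))) := by
    refine Tendsto.mono_left (Continuous.tendsto ?_ 1) nhdsWithin_le_nhds
    fun_prop
  simp only [one_pow, mul_one] at hcont
  refine le_of_tendsto hcont ?_
  filter_upwards [Ioo_mem_nhdsLT (show (0 : ℝ) < 1 by norm_num)] with r hr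
  exact key r hr.1 hr.2

lemma memHardy2_of_summable {f : ℂ → ℂ} (hd : DifferentiableOn ℂ f (ball 0 1))
    (hs : Summable fun n => ‖taylorCoeff f n‖ ^ 2) : MemHardy2 f := by
  refine ⟨hd, ∑' n, ‖taylorCoeff f n‖ ^ 2, fun r h0 h1 => ?_⟩
  have hpi := Real.two_pi_pos
  rw [one_div, inv_mul_le_iff₀ hpi]
  refine le_of_tendsto (tendsto_sum_taylorCoeff_sq hd h0.le h1)
    (Eventually.of_forall fun N => mul_le_mul_of_nonneg_left ?_ hpi.le)
  refine le_trans (sum_le_sum fun n _ => ?_) (hs.sum_le_tsum (range N) fun n _ => by positivity)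
  exact mul_le_of_le_one_right (by positivity) (pow_le_one₀ h0.le h1.le)

lemma exists_memHardy2_of_summable {c : ℕ → ℂ} (hs : Summable fun n => ‖c n‖ ^ 2) :
    ∃ f, MemHardy2 f ∧ ∀ n, taylorCoeff f n = c n := by
  have hb : ∃ K, ∀ n, ‖c n‖ ≤ K := by
    refine ⟨√(∑' n, ‖c n‖ ^ 2), fun n => Real.le_sqrt_of_sq_le ?_⟩
    exact hs.le_tsum n fun _ _ => by positivity
  obtain ⟨K, hK⟩ := hb
  have e := taylorCoeff_tsum_pow hK
  exact ⟨_, memHardy2_of_summable (differentiableOn_tsum_pow hK) (by simpa only [e] using hs), e⟩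

lemma eqOn_of_taylorCoeff_eq {f g : ℂ → ℂ} (hf : DifferentiableOn ℂ f (ball 0 1))
    (hg : DifferentiableOn ℂ g (ball 0 1)) (h : ∀ n, taylorCoeff f n = taylorCoeff g n) :
    EqOn f g (ball 0 1) := fun z hz => by
  have h1 := hasSum_taylorCoeff hf hz
  simp_rw [h] at h1
  exact h1.unique (hasSum_taylorCoeff hg hz)

end Taylor

section Approximation

open Polynomial

lemma exists_poly_approx_dilation {f : ℂ → ℂ} (hf : DifferentiableOn ℂ f (ball 0 1)) {r ε : ℝ}
    (h0 : 0 ≤ r) (h1 : r < 1) (hε : 0 < ε) (n : ℕ) : ∃ p : ℂ[X],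
    (∀ z : ℂ, ‖z‖ ≤ 1 → ‖p.eval z - f (r * z)‖ ≤ ε) ∧
      ∀ k < n, p.coeff k = taylorCoeff f k * r ^ k := by
  have hs := summable_norm_taylorCoeff_mul_pow hf h0 h1
  have ht := tendsto_sum_nat_add fun k => ‖taylorCoeff f k‖ * r ^ k
  obtain ⟨N, hN, hnN⟩ := ((ht.eventually (gt_mem_nhds hε)).and (eventually_ge_atTop n)).exists
  refine ⟨∑ k ∈ range N, monomial k (taylorCoeff f k * r ^ k), fun z hz => ?_, fun k hk => ?_⟩
  · have hmem : (r : ℂ) * z ∈ ball (0 : ℂ) 1 := by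
      rw [mem_ball_zero_iff, norm_mul, Complex.norm_real, Real.norm_of_nonneg h0]
      exact lt_of_le_of_lt (mul_le_of_le_one_right h0 hz) h1
    have hsum := hasSum_taylorCoeff hf hmem
    have hsplit := hsum.summable.sum_add_tsum_nat_add N
    rw [hsum.tsum_eq] at hsplit
    have e : (∑ k ∈ range N, monomial k (taylorCoeff f k * (r : ℂ) ^ k)).eval z =
        ∑ k ∈ range N, taylorCoeff f k * (r * z) ^ k := by
      simp only [eval_finsetSum, eval_monomial, mul_pow, mul_assoc]
    have hbd : ∀ k, ‖taylorCoeff f (k + N) * (r * z) ^ (k + N)‖ ≤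
        ‖taylorCoeff f (k + N)‖ * r ^ (k + N) := fun k => by
      rw [norm_mul, norm_pow, norm_mul, Complex.norm_real, Real.norm_of_nonneg h0]
      gcongr
      exact mul_le_of_le_one_right h0 hz
    rw [e, ← hsplit, sub_add_cancel_left, norm_neg]
    exact (tsum_of_norm_bounded ((summable_nat_add_iff N).2 hs).hasSum hbd).trans hN.le
  · simp only [finsetSum_coeff, coeff_monomial]
    rw [sum_ite_eq' (range N) k, if_pos (Finset.mem_range.2 (by omega))]

/-- The radii of the dilations used to approximate holomorphic functions by polynomials. -/
def approxRadius (n : ℕ) : ℝ := 1 - 1 / ((n : ℝ) + 1)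

lemma approxRadius_nonneg (n : ℕ) : 0 ≤ approxRadius n := by
  rw [approxRadius, sub_nonneg, div_le_one (by positivity)]
  linarith [(Nat.cast_nonneg n : (0 : ℝ) ≤ n)]

lemma approxRadius_lt_one (n : ℕ) : approxRadius n < 1 := by
  have : 0 < 1 / ((n : ℝ) + 1) := by positivity
  rw [approxRadius]
  linarith

lemma tendsto_approxRadius : Tendsto approxRadius atTop (𝓝 1) := by
  have := (tendsto_const_nhds (x := (1 : ℝ))).sub tendsto_one_div_add_atTop_nhds_zero_nat
  rwa [sub_zero] at this

lemma exists_poly_approx {f : ℂ → ℂ} (hf : DifferentiableOn ℂ f (ball 0 1)) :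
    ∃ p : ℕ → ℂ[X],
      (∀ n, ∀ z : ℂ, ‖z‖ ≤ 1 → ‖(p n).eval z - f (approxRadius n * z)‖ ≤ 1 / ((n : ℝ) + 1)) ∧
      ∀ k, Tendsto (fun n => (p n).coeff k) atTop (𝓝 (taylorCoeff f k)) := by
  choose p hp hc using fun n : ℕ => exists_poly_approx_dilation hf (approxRadius_nonneg n)
    (approxRadius_lt_one n) (show 0 < 1 / ((n : ℝ) + 1) by positivity) n
  refine ⟨p, hp, fun k => ?_⟩
  have h1 : Tendsto (fun n => taylorCoeff f k * (approxRadius n : ℂ) ^ k) atTop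
      (𝓝 (taylorCoeff f k * ((1 : ℝ) : ℂ) ^ k)) :=
    (((Complex.continuous_ofReal.tendsto 1).comp tendsto_approxRadius).pow k).const_mul _
  rw [Complex.ofReal_one, one_pow, mul_one] at h1
  refine h1.congr' ?_
  filter_upwards [eventually_gt_atTop k] with n hn
  exact (hc n k hn).symm

lemma approxRadius_mul_mem_ball (n : ℕ) {z : ℂ} (hz : ‖z‖ ≤ 1) :
    (approxRadius n : ℂ) * z ∈ ball (0 : ℂ) 1 := by
  rw [mem_ball_zero_iff, norm_mul, Complex.norm_real, Real.norm_of_nonneg (approxRadius_nonneg n)]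
  exact lt_of_le_of_lt (mul_le_of_le_one_right (approxRadius_nonneg n) hz) (approxRadius_lt_one n)

lemma polyNormSq_eq_sum_range {f : ℂ[X]} {N : ℕ} (h : f.natDegree < N) :
    polyNormSq f = ∑ n ∈ range N, ‖f.coeff n‖ ^ 2 := by
  rw [polyNormSq]
  refine sum_subset (range_mono h) fun n _ hn => ?_
  rw [Finset.mem_range, not_lt] at hn
  rw [coeff_eq_zero_of_natDegree_lt (by omega)]
  simp

lemma sum_range_norm_coeff_sq_le (f : ℂ[X]) (N : ℕ) :
    ∑ n ∈ range N, ‖f.coeff n‖ ^ 2 ≤ polyNormSq f := by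
  rw [polyNormSq_eq_sum_range (N := max N (f.natDegree + 1)) (by omega)]
  exact sum_le_sum_of_subset_of_nonneg (range_mono (le_max_left _ _)) fun _ _ _ => by positivity

/-- The polynomial with the first `N` coefficients given by `x`. -/
def truncPoly (x : ℕ → ℂ) (N : ℕ) : ℂ[X] := ∑ j ∈ range N, monomial j (x j)

lemma coeff_truncPoly (x : ℕ → ℂ) (N n : ℕ) :
    (truncPoly x N).coeff n = if n < N then x n else 0 := by
  simp only [truncPoly, finsetSum_coeff, coeff_monomial]
  rw [sum_ite_eq' (range N) n]
  simp

lemma natDegree_truncPoly_lt (x : ℕ → ℂ) {N : ℕ} (hN : 0 < N) :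
    (truncPoly x N).natDegree < N := by
  refine lt_of_le_of_lt (b := N - 1) ?_ (by omega)
  rw [natDegree_le_iff_coeff_eq_zero]
  intro n hn
  rw [coeff_truncPoly, if_neg (by omega)]

lemma polyNormSq_truncPoly (x : ℕ → ℂ) (N : ℕ) :
    polyNormSq (truncPoly x N) = ∑ n ∈ range N, ‖x n‖ ^ 2 := by
  rcases Nat.eq_zero_or_pos N with rfl | hN
  · simp [truncPoly, polyNormSq]
  · rw [polyNormSq_eq_sum_range (natDegree_truncPoly_lt x hN)]
    refine sum_congr rfl fun n hn => ?_
    rw [coeff_truncPoly, if_pos (Finset.mem_range.1 hn)]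

/-- Multiplication by a bounded holomorphic function is bounded in the `ℓ²` norm of the
coefficients. -/
lemma sum_cauchyProduct_sq_le {φ : ℂ → ℂ} {M : ℝ} (hφ : DifferentiableOn ℂ φ (ball 0 1))
    (hM : ∀ z ∈ ball (0 : ℂ) 1, ‖φ z‖ ≤ M) (x : ℕ → ℂ) (N : ℕ) :
    ∑ n ∈ range N, ‖∑ k ∈ range (n + 1), taylorCoeff φ k * x (n - k)‖ ^ 2 ≤
      (M + 1) ^ 2 * ∑ n ∈ range N, ‖x n‖ ^ 2 := by
  obtain ⟨p, hp, hc⟩ := exists_poly_approx hφ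
  have hlim : Tendsto (fun i => ∑ n ∈ range N,
      ‖∑ k ∈ range (n + 1), (p i).coeff k * x (n - k)‖ ^ 2) atTop
      (𝓝 (∑ n ∈ range N, ‖∑ k ∈ range (n + 1), taylorCoeff φ k * x (n - k)‖ ^ 2)) :=
    tendsto_finsetSum _ fun n _ => ((tendsto_finsetSum _ fun k _ =>
      (hc k).mul_const _).norm.pow 2)
  refine le_of_tendsto hlim (Eventually.of_forall fun i => ?_)
  have hb : ∀ z : ℂ, ‖z‖ ≤ 1 → ‖(p i).eval z‖ ≤ M + 1 := fun z hz => by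
    have h1 := hp i z hz
    have h2 := hM _ (approxRadius_mul_mem_ball i hz)
    have h3 : 1 / ((i : ℝ) + 1) ≤ 1 := by
      rw [div_le_one (by positivity)]
      linarith [(Nat.cast_nonneg i : (0 : ℝ) ≤ i)]
    have h4 := norm_add_le ((p i).eval z - φ (approxRadius i * z)) (φ (approxRadius i * z))
    rw [sub_add_cancel] at h4
    linarith
  have h := (sum_range_norm_coeff_sq_le (p i * truncPoly x N) N).trans
    (polyNormSq_mul_le (p i) (truncPoly x N) (M + 1) hb)
  rw [polyNormSq_truncPoly] at h
  refine le_trans (le_of_eq (sum_congr rfl fun n hn => ?_)) h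
  rw [coeff_mul, Finset.Nat.sum_antidiagonal_eq_sum_range_succ_mk]
  congr 2
  refine sum_congr rfl fun k _ => ?_
  rw [Finset.mem_range] at hn
  rw [coeff_truncPoly, if_pos (by omega)]

lemma coeff_polyToeplitz_truncPoly (a : ℂ[X]) (x : ℕ → ℂ) {N : ℕ} (hN : 0 < N) (n : ℕ) :
    (polyToeplitz a (truncPoly x N)).coeff n =
      ∑ m ∈ range N, x m * if n ≤ m then cj (a.coeff (m - n)) else 0 := by
  have hd := natDegree_truncPoly_lt x hN
  rw [coeff_polyToeplitz]
  have hsub : range ((truncPoly x N).natDegree + 1) ⊆ range N := range_mono hd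
  rw [sum_subset hsub]
  · refine sum_congr rfl fun m hm => ?_
    rw [coeff_truncPoly, if_pos (Finset.mem_range.1 hm)]
  · intro m _ hm
    rw [Finset.mem_range, not_lt] at hm
    rw [coeff_eq_zero_of_natDegree_lt (by omega), zero_mul]

lemma polyNormSq_polyToeplitz_truncPoly (a : ℂ[X]) (x : ℕ → ℂ) {N : ℕ} (hN : 0 < N) :
    polyNormSq (polyToeplitz a (truncPoly x N)) = ∑ n ∈ range N,
      ‖∑ m ∈ range N, x m * if n ≤ m then cj (a.coeff (m - n)) else 0‖ ^ 2 := by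
  rw [polyNormSq_eq_sum_range (lt_of_le_of_lt (natDegree_polyToeplitz_le _ _)
    (natDegree_truncPoly_lt x hN))]
  simp_rw [coeff_polyToeplitz_truncPoly a x hN]

/-- The Toeplitz corona lower bound on finitely supported sequences. -/
lemma exists_toeplitz_lower_bound {a b : ℂ → ℂ} {δ : ℝ} (ha : MemHinf a) (hb : MemHinf b)
    (hδ : 0 < δ) (hab : ∀ z ∈ ball (0 : ℂ) 1, δ ≤ ‖a z‖ + ‖b z‖) :
    ∃ K : ℝ, 0 < K ∧ ∀ (x : ℕ → ℂ) (N : ℕ), ∑ n ∈ range N, ‖x n‖ ^ 2 ≤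
      K * ((∑ n ∈ range N,
        ‖∑ m ∈ range N, x m * if n ≤ m then cj (taylorCoeff a (m - n)) else 0‖ ^ 2) +
      ∑ n ∈ range N,
        ‖∑ m ∈ range N, x m * if n ≤ m then cj (taylorCoeff b (m - n)) else 0‖ ^ 2) := by
  obtain ⟨had, A, hA⟩ := ha
  obtain ⟨hbd, B, hB⟩ := hb
  obtain ⟨p, hp, hpc⟩ := exists_poly_approx had
  obtain ⟨q, hq, hqc⟩ := exists_poly_approx hbd
  have hM : 0 < max A B + 1 := by
    have h1 := (norm_nonneg _).trans (hA 0 (by simp))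
    have h2 := le_max_left A B
    linarith
  obtain ⟨K, hK, hbound⟩ := exists_polyToeplitz_lower_bound
    (show 0 < δ ^ 2 / 8 by positivity) hM
  refine ⟨K, hK, fun x N => ?_⟩
  rcases Nat.eq_zero_or_pos N with rfl | hN
  · simp
  have hlim : ∀ (p : ℕ → ℂ[X]) (f : ℂ → ℂ),
      (∀ k, Tendsto (fun n => (p n).coeff k) atTop (𝓝 (taylorCoeff f k))) →
      Tendsto (fun i => polyNormSq (polyToeplitz (p i) (truncPoly x N))) atTop
      (𝓝 (∑ n ∈ range N,
        ‖∑ m ∈ range N, x m * if n ≤ m then cj (taylorCoeff f (m - n)) else 0‖ ^ 2)) := by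
    intro p f hpf
    simp_rw [polyNormSq_polyToeplitz_truncPoly _ x hN]
    refine tendsto_finsetSum _ fun n _ => ((tendsto_finsetSum _ fun m _ => ?_).norm.pow 2)
    refine Tendsto.const_mul _ ?_
    split_ifs
    · exact (Complex.continuous_conj.tendsto _).comp (hpf _)
    · exact tendsto_const_nhds
  refine ge_of_tendsto (((hlim p a hpc).add (hlim q b hqc)).const_mul K) ?_
  have hsmall : ∀ᶠ i : ℕ in atTop, 1 / ((i : ℝ) + 1) < min (δ / 4) 1 :=
    tendsto_one_div_add_atTop_nhds_zero_nat.eventually (gt_mem_nhds (by positivity))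
  filter_upwards [hsmall] with i hi
  rw [← polyNormSq_truncPoly]
  have hi1 := hi.trans_le (min_le_left _ _)
  have hi2 := hi.trans_le (min_le_right _ _)
  have hupper : ∀ (p : ℕ → ℂ[X]) (f : ℂ → ℂ) (C : ℝ), C ≤ max A B →
      (∀ n, ∀ z : ℂ, ‖z‖ ≤ 1 → ‖(p n).eval z - f (approxRadius n * z)‖ ≤ 1 / ((n : ℝ) + 1)) →
      (∀ z ∈ ball (0 : ℂ) 1, ‖f z‖ ≤ C) →
      ∀ z : ℂ, ‖z‖ ≤ 1 → ‖(p i).eval z‖ ≤ max A B + 1 := by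
    intro p f C hC hpf hf z hz
    have h1 := hpf i z hz
    have h2 := hf _ (approxRadius_mul_mem_ball i hz)
    have h4 := norm_add_le ((p i).eval z - f (approxRadius i * z)) (f (approxRadius i * z))
    rw [sub_add_cancel] at h4
    linarith
  refine hbound (p i) (q i) (hupper p a A (le_max_left _ _) hp hA)
    (hupper q b B (le_max_right _ _) hq hB) (fun z hz => ?_) _
  have h1 := hp i z hz
  have h2 := hq i z hz
  have h3 := hab _ (approxRadius_mul_mem_ball i hz)
  have h4 := norm_sub_norm_le (a (approxRadius i * z)) ((p i).eval z)
  have h5 := norm_sub_norm_le (b (approxRadius i * z)) ((q i).eval z)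
  rw [norm_sub_rev] at h4 h5
  have h6 : δ / 2 ≤ ‖(p i).eval z‖ + ‖(q i).eval z‖ := by linarith
  nlinarith [sq_nonneg (‖(p i).eval z‖ - ‖(q i).eval z‖), mul_self_le_mul_self (by positivity) h6]

end Approximation

section Operators

open ContinuousLinearMap

/-- For commuting operators satisfying a corona-type lower bound and exactness of the associated
Koszul complex, the ranges of the adjoints intersect in the range of the adjoint of the
product. -/
lemma exists_eq_adjoint_of_adjoint_eq {H : Type*} [NormedAddCommGroup H] [InnerProductSpace ℂ H]
    [CompleteSpace H] {A B : H →L[ℂ] H} (hcomm : A ∘L B = B ∘L A) {K : ℝ} (hK : 0 < K)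
    (hlow : ∀ x, ‖x‖ ^ 2 ≤ K * (‖adjoint A x‖ ^ 2 + ‖adjoint B x‖ ^ 2))
    (hexact : ∀ u v, B u + A v = 0 → ∃ x, u = A x ∧ v = -B x) {g h : H}
    (hgh : adjoint A g = adjoint B h) : ∃ k, g = adjoint B k := by
  have hS : IsUnit (A ∘L adjoint A + B ∘L adjoint B) := by
    refine isUnit_of_forall_le_norm_inner_map _ (c := ⟨K⁻¹, (inv_pos.2 hK).le⟩)
      (inv_pos.2 hK) fun x => ?_
    have e : inner ℂ ((A ∘L adjoint A + B ∘L adjoint B) x) x =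
        ((‖adjoint A x‖ ^ 2 + ‖adjoint B x‖ ^ 2 : ℝ) : ℂ) := by
      rw [add_apply, comp_apply, comp_apply, inner_add_left, ← adjoint_inner_right A,
        ← adjoint_inner_right B, inner_self_eq_norm_sq_to_K, inner_self_eq_norm_sq_to_K]
      push_cast
      rfl
    rw [e, Complex.norm_real, Real.norm_of_nonneg (by positivity)]
    change ‖x‖ ^ 2 * K⁻¹ ≤ _
    rw [mul_inv_le_iff₀ hK, mul_comm]
    exact hlow x
  obtain ⟨k, hk⟩ := (isUnit_iff_bijective.1 hS).2 (B g + A h)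
  rw [add_apply, comp_apply, comp_apply] at hk
  obtain ⟨x, hx₁, hx₂⟩ := hexact (g - adjoint B k) (h - adjoint A k) (by
    rw [map_sub, map_sub]
    rw [← sub_eq_zero] at hk
    rw [← neg_eq_zero, ← hk]
    abel)
  have hadj : adjoint A (adjoint B k) = adjoint B (adjoint A k) := by
    have := congrArg (fun T => adjoint T k) hcomm
    simp only [adjoint_comp, comp_apply] at this
    exact this.symm
  have hz : adjoint A (g - adjoint B k) - adjoint B (h - adjoint A k) = 0 := by
    rw [map_sub, map_sub, hgh, hadj]
    abel
  have hin : inner ℂ x (adjoint A (g - adjoint B k) - adjoint B (h - adjoint A k)) =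
      ((‖g - adjoint B k‖ ^ 2 + ‖h - adjoint A k‖ ^ 2 : ℝ) : ℂ) := by
    have hx₂' : B x = -(h - adjoint A k) := by rw [hx₂, neg_neg]
    rw [inner_sub_right, adjoint_inner_right, adjoint_inner_right, ← hx₁, hx₂', inner_neg_left,
      sub_neg_eq_add, inner_self_eq_norm_sq_to_K, inner_self_eq_norm_sq_to_K]
    push_cast
    rfl
  rw [hz, inner_zero_right] at hin
  have hsum : ‖g - adjoint B k‖ ^ 2 + ‖h - adjoint A k‖ ^ 2 = 0 := by exact_mod_cast hin.symm
  have hg : ‖g - adjoint B k‖ ^ 2 = 0 :=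
    ((add_eq_zero_iff_of_nonneg (sq_nonneg _) (sq_nonneg _)).1 hsum).1
  exact ⟨k, sub_eq_zero.1 (norm_eq_zero.1 (pow_eq_zero_iff two_ne_zero |>.1 hg))⟩

/-- The Hilbert space of square summable sequences. -/
abbrev SeqSpace : Type := lp (fun _ : ℕ => ℂ) 2

lemma memlp_two_iff {c : ℕ → ℂ} : Memℓp c 2 ↔ Summable fun n => ‖c n‖ ^ 2 := by
  rw [memℓp_gen_iff (by norm_num)]
  norm_num

lemma SeqSpace.norm_sq (x : SeqSpace) : ‖x‖ ^ 2 = ∑' n, ‖x n‖ ^ 2 := by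
  have := lp.norm_rpow_eq_tsum (p := 2) (by norm_num) x
  simpa using this

lemma SeqSpace.summable (x : SeqSpace) : Summable fun n => ‖x n‖ ^ 2 :=
  memlp_two_iff.1 (lp.memℓp x)

lemma SeqSpace.sum_range_le (x : SeqSpace) (N : ℕ) :
    ∑ n ∈ range N, ‖x n‖ ^ 2 ≤ ‖x‖ ^ 2 := by
  rw [x.norm_sq]
  exact x.summable.sum_le_tsum _ fun _ _ => by positivity

/-- `T` acts on sequences as the Cauchy product with the Taylor coefficients of `φ`. -/
def IsMulOp (φ : ℂ → ℂ) (T : SeqSpace →L[ℂ] SeqSpace) : Prop :=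
  ∀ (x : SeqSpace) (n : ℕ), T x n = ∑ k ∈ range (n + 1), taylorCoeff φ k * x (n - k)

lemma exists_isMulOp {φ : ℂ → ℂ} (hφ : MemHinf φ) : ∃ T, IsMulOp φ T := by
  obtain ⟨hd, M, hM⟩ := hφ
  have hM0 : 0 ≤ M := (norm_nonneg _).trans (hM 0 (by simp))
  have hN : ∀ (x : SeqSpace) (N : ℕ), ∑ n ∈ range N,
      ‖∑ k ∈ range (n + 1), taylorCoeff φ k * x (n - k)‖ ^ 2 ≤ (M + 1) ^ 2 * ‖x‖ ^ 2 := by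
    intro x N
    refine (sum_cauchyProduct_sq_le hd hM x N).trans ?_
    gcongr
    exact x.sum_range_le N
  have hmem : ∀ x : SeqSpace,
      Memℓp (fun n => ∑ k ∈ range (n + 1), taylorCoeff φ k * x (n - k)) 2 := fun x =>
    memlp_two_iff.2 (summable_of_sum_range_le (fun n => by positivity) (hN x))
  let L : SeqSpace →ₗ[ℂ] SeqSpace :=
    { toFun := fun x => ⟨_, hmem x⟩
      map_add' := fun x y => by
        ext n
        change ∑ k ∈ range (n + 1), taylorCoeff φ k * (x (n - k) + y (n - k)) =
          (∑ k ∈ range (n + 1), taylorCoeff φ k * x (n - k)) +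
            ∑ k ∈ range (n + 1), taylorCoeff φ k * y (n - k)
        simp_rw [mul_add, Finset.sum_add_distrib]
      map_smul' := fun c x => by
        ext n
        change ∑ k ∈ range (n + 1), taylorCoeff φ k * (c * x (n - k)) =
          c * ∑ k ∈ range (n + 1), taylorCoeff φ k * x (n - k)
        rw [Finset.mul_sum]
        exact sum_congr rfl fun k _ => by ring }
  refine ⟨L.mkContinuous (M + 1) fun x => ?_, fun x n => rfl⟩
  refine le_of_sq_le_sq ?_ (by positivity)
  rw [SeqSpace.norm_sq, mul_pow]
  exact Real.tsum_le_of_sum_range_le (fun n => by positivity) (hN x)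

lemma IsMulOp.apply_single {φ : ℂ → ℂ} {T : SeqSpace →L[ℂ] SeqSpace} (hT : IsMulOp φ T)
    (n m : ℕ) : T (lp.single 2 n 1) m = if n ≤ m then taylorCoeff φ (m - n) else 0 := by
  rw [hT]
  split_ifs with h
  · rw [sum_eq_single (m - n)]
    · rw [show m - (m - n) = n by omega, lp.single_apply_self, mul_one]
    · intro k hk hkn
      rw [Finset.mem_range] at hk
      rw [lp.single_apply_ne _ _ _ (by omega), mul_zero]
    · intro h'
      rw [Finset.mem_range] at h'
      omega
  · refine sum_eq_zero fun k hk => ?_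
    rw [lp.single_apply_ne _ _ _ (by omega), mul_zero]

lemma IsMulOp.hasSum_adjoint {φ : ℂ → ℂ} {T : SeqSpace →L[ℂ] SeqSpace} (hT : IsMulOp φ T)
    (g : SeqSpace) (n : ℕ) :
    HasSum (fun m => g m * if n ≤ m then cj (taylorCoeff φ (m - n)) else 0) (adjoint T g n) := by
  have h1 := lp.hasSum_inner (𝕜 := ℂ) (T (lp.single 2 n (1 : ℂ))) g
  rw [← adjoint_inner_right, lp.inner_single_left] at h1
  simp only [RCLike.inner_apply, map_one, mul_one] at h1
  convert! h1 using 2 with m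
  rw [hT.apply_single]
  split_ifs <;> simp

lemma IsMulOp.adjoint_apply {φ : ℂ → ℂ} {T : SeqSpace →L[ℂ] SeqSpace} (hT : IsMulOp φ T)
    (g : SeqSpace) (n : ℕ) :
    adjoint T g n = ∑' k, cj (taylorCoeff φ k) * g (n + k) := by
  have h := hT.hasSum_adjoint g n
  rw [← h.tsum_eq, ← h.summable.sum_add_tsum_nat_add n, sum_eq_zero, zero_add]
  · refine tsum_congr fun k => ?_
    rw [if_pos (by omega), show k + n - n = k by omega, mul_comm, add_comm]
  · intro m hm
    rw [Finset.mem_range] at hm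
    rw [if_neg (by omega), mul_zero]

lemma IsMulOp.exists_lower_bound {a b : ℂ → ℂ} {A B : SeqSpace →L[ℂ] SeqSpace}
    (hA : IsMulOp a A) (hB : IsMulOp b B) (ha : MemHinf a) (hb : MemHinf b) {δ : ℝ} (hδ : 0 < δ)
    (hab : ∀ z ∈ ball (0 : ℂ) 1, δ ≤ ‖a z‖ + ‖b z‖) :
    ∃ K : ℝ, 0 < K ∧ ∀ x, ‖x‖ ^ 2 ≤ K * (‖adjoint A x‖ ^ 2 + ‖adjoint B x‖ ^ 2) := by
  obtain ⟨K, hK, hbd⟩ := exists_toeplitz_lower_bound ha hb hδ hab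
  refine ⟨K, hK, fun x => ?_⟩
  have hlim : Tendsto (fun N => ∑ j ∈ range N, lp.single 2 j (x j)) atTop (𝓝 x) :=
    (lp.hasSum_single (by norm_num) x).tendsto_sum_nat
  have hcoord : ∀ N m, (∑ j ∈ range N, lp.single 2 j (x j) : SeqSpace) m =
      if m < N then x m else 0 := by
    intro N m
    rw [lp.coeFn_sum, Finset.sum_apply]
    simp only [lp.coeFn_single, Finset.sum_pi_single, Finset.mem_range]
  have hadj : ∀ {φ : ℂ → ℂ} {T : SeqSpace →L[ℂ] SeqSpace}, IsMulOp φ T → ∀ N n,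
      adjoint T (∑ j ∈ range N, lp.single 2 j (x j)) n =
        ∑ m ∈ range N, x m * if n ≤ m then cj (taylorCoeff φ (m - n)) else 0 := by
    intro φ T hT N n
    rw [← (hT.hasSum_adjoint _ n).tsum_eq, tsum_eq_sum (s := range N)]
    · refine sum_congr rfl fun m hm => ?_
      rw [hcoord, if_pos (Finset.mem_range.1 hm)]
    · intro m hm
      rw [hcoord, if_neg (by simpa using hm), zero_mul]
  have hfin : ∀ N, ‖(∑ j ∈ range N, lp.single 2 j (x j) : SeqSpace)‖ ^ 2 ≤
      K * (‖adjoint A (∑ j ∈ range N, lp.single 2 j (x j))‖ ^ 2 +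
        ‖adjoint B (∑ j ∈ range N, lp.single 2 j (x j))‖ ^ 2) := by
    intro N
    have h := lp.norm_sum_single (p := 2) (by norm_num) (fun j => x j) (range N)
    simp only [ENNReal.toReal_ofNat, Real.rpow_ofNat] at h
    rw [h]
    refine (hbd x N).trans ?_
    simp_rw [← hadj hA, ← hadj hB]
    gcongr <;> exact SeqSpace.sum_range_le _ N
  refine le_of_tendsto_of_tendsto' (hlim.norm.pow 2) ?_ hfin
  exact (((((adjoint A).continuous.tendsto x).comp hlim).norm.pow 2).add
    ((((adjoint B).continuous.tendsto x).comp hlim).norm.pow 2)).const_mul K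

end Operators

section Ranges

open ContinuousLinearMap

lemma MemHinf.mul {f g : ℂ → ℂ} (hf : MemHinf f) (hg : MemHinf g) :
    MemHinf fun z => f z * g z := by
  obtain ⟨hf, A, hA⟩ := hf
  obtain ⟨hg, B, hB⟩ := hg
  refine ⟨hf.mul hg, A * B, fun z hz => ?_⟩
  rw [norm_mul]
  exact mul_le_mul (hA z hz) (hB z hz) (norm_nonneg _) ((norm_nonneg _).trans (hA z hz))

lemma MemHinf.prod {ι : Type*} {a : ι → ℂ → ℂ} (ha : ∀ j, MemHinf (a j)) (s : Finset ι) :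
    MemHinf fun z => ∏ j ∈ s, a j z := by
  classical
  induction s using Finset.induction_on with
  | empty => exact ⟨by simp, 1, by simp⟩
  | insert i s hi ih =>
    simp_rw [Finset.prod_insert hi]
    exact (ha i).mul ih

lemma SeqSpace.exists_memHardy2 (x : SeqSpace) :
    ∃ f, MemHardy2 f ∧ ∀ n, taylorCoeff f n = x n :=
  exists_memHardy2_of_summable x.summable

lemma MemHardy2.exists_seq {f : ℂ → ℂ} (hf : MemHardy2 f) :
    ∃ x : SeqSpace, ∀ n, x n = taylorCoeff f n :=
  ⟨⟨fun n => taylorCoeff f n, memlp_two_iff.2 hf.summable⟩, fun _ => rfl⟩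

lemma taylorCoeff_congr {f g : ℂ → ℂ} (h : EqOn f g (ball 0 1)) (n : ℕ) :
    taylorCoeff f n = taylorCoeff g n := by
  rw [taylorCoeff, taylorCoeff,
    (h.eventuallyEq_of_mem (ball_mem_nhds (0 : ℂ) one_pos)).iteratedDeriv_eq n]

lemma IsMulOp.apply_eq_taylorCoeff {φ f : ℂ → ℂ} {T : SeqSpace →L[ℂ] SeqSpace}
    (hT : IsMulOp φ T) (hφ : DifferentiableOn ℂ φ (ball 0 1))
    (hf : DifferentiableOn ℂ f (ball 0 1)) {x : SeqSpace} (hx : ∀ n, taylorCoeff f n = x n)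
    (n : ℕ) : taylorCoeff (fun z => φ z * f z) n = T x n := by
  rw [hT, taylorCoeff_mul hφ hf]
  simp_rw [hx]

lemma IsMulOp.comp {φ ψ : ℂ → ℂ} {S T U : SeqSpace →L[ℂ] SeqSpace} (hS : IsMulOp φ S)
    (hT : IsMulOp ψ T) (hU : IsMulOp (fun z => φ z * ψ z) U)
    (hφ : DifferentiableOn ℂ φ (ball 0 1)) (hψ : DifferentiableOn ℂ ψ (ball 0 1)) :
    U = S ∘L T := by
  ext x n
  obtain ⟨f, ⟨hf, -⟩, hfx⟩ := x.exists_memHardy2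
  rw [comp_apply, ← hU.apply_eq_taylorCoeff (hφ.mul hψ) hf hfx n,
    ← hS.apply_eq_taylorCoeff hφ (hψ.mul hf) (hT.apply_eq_taylorCoeff hψ hf hfx) n]
  simp_rw [mul_assoc]
  rfl

lemma mem_rangeToeplitzConj_iff {φ : ℂ → ℂ} {T : SeqSpace →L[ℂ] SeqSpace} (hT : IsMulOp φ T)
    {f : ℂ → ℂ} {x : SeqSpace} (hf : MemHardy2 f) (hx : ∀ n, x n = taylorCoeff f n) :
    f ∈ rangeToeplitzConj φ ↔ ∃ g, x = adjoint T g := by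
  constructor
  · rintro ⟨-, g, hg, h⟩
    obtain ⟨y, hy⟩ := hg.exists_seq
    refine ⟨y, ?_⟩
    ext n
    rw [hT.adjoint_apply, hx, h]
    simp_rw [hy]
  · rintro ⟨y, hy⟩
    obtain ⟨g, hg, hgy⟩ := y.exists_memHardy2
    refine ⟨hf, g, hg, fun n => ?_⟩
    rw [← hx, hy, hT.adjoint_apply]
    simp_rw [hgy]

lemma memHardy2_of_norm_sq_le {f u v : ℂ → ℂ} (hf : DifferentiableOn ℂ f (ball 0 1))
    (hu : MemHardy2 u) (hv : MemHardy2 v) {C : ℝ}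
    (h : ∀ z ∈ ball (0 : ℂ) 1, ‖f z‖ ^ 2 ≤ C * (‖u z‖ ^ 2 + ‖v z‖ ^ 2)) (hC : 0 ≤ C) :
    MemHardy2 f := by
  obtain ⟨hud, A, hA⟩ := hu
  obtain ⟨hvd, B, hB⟩ := hv
  refine ⟨hf, C * (A + B), fun r h0 h1 => ?_⟩
  have hc : ∀ {g : ℂ → ℂ}, DifferentiableOn ℂ g (ball 0 1) →
      IntervalIntegrable (fun t => ‖g (polarPt r t)‖ ^ 2) volume 0 (2 * Real.pi) := fun hg =>
    ((continuous_comp_polarPt hg h0.le h1).norm.pow 2).intervalIntegrable _ _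
  have hi := intervalIntegral.integral_mono_on Real.two_pi_pos.le (hc hf)
    (((hc hud).add (hc hvd)).const_mul C)
    (fun t _ => h (polarPt r t) (polarPt_mem_ball h0.le h1 t))
  rw [intervalIntegral.integral_const_mul, intervalIntegral.integral_add (hc hud) (hc hvd)] at hi
  have hA' := hA r h0 h1
  have hB' := hB r h0 h1
  have hpi : 0 < 1 / (2 * Real.pi) := one_div_pos.2 Real.two_pi_pos
  calc _ ≤ 1 / (2 * Real.pi) * (C * ((∫ t in (0 : ℝ)..(2 * Real.pi), ‖u (polarPt r t)‖ ^ 2) +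
        ∫ t in (0 : ℝ)..(2 * Real.pi), ‖v (polarPt r t)‖ ^ 2)) :=
        mul_le_mul_of_nonneg_left hi hpi.le
    _ = C * (1 / (2 * Real.pi) * (∫ t in (0 : ℝ)..(2 * Real.pi), ‖u (polarPt r t)‖ ^ 2) +
        1 / (2 * Real.pi) * ∫ t in (0 : ℝ)..(2 * Real.pi), ‖v (polarPt r t)‖ ^ 2) := by ring
    _ ≤ C * (A + B) := mul_le_mul_of_nonneg_left (add_le_add hA' hB') hC

/-- Under the corona condition, a relation `b u + a v = 0` in `H²` is trivial. -/
lemma exists_memHardy2_of_relation {a b u v : ℂ → ℂ} (ha : MemHinf a) (hb : MemHinf b) {δ : ℝ}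
    (hδ : 0 < δ) (hab : ∀ z ∈ ball (0 : ℂ) 1, δ ≤ ‖a z‖ + ‖b z‖) (hu : MemHardy2 u)
    (hv : MemHardy2 v) (h : ∀ z ∈ ball (0 : ℂ) 1, b z * u z + a z * v z = 0) :
    ∃ w, MemHardy2 w ∧ (∀ z ∈ ball (0 : ℂ) 1, u z = a z * w z) ∧
      ∀ z ∈ ball (0 : ℂ) 1, v z = -(b z * w z) := by
  classical
  have hball : ∀ z ∈ ball (0 : ℂ) 1, ball (0 : ℂ) 1 ∈ 𝓝 z := fun z hz => isOpen_ball.mem_nhds hz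
  let w : ℂ → ℂ := fun z => if a z = 0 then -(v z / b z) else u z / a z
  have hb0 : ∀ z ∈ ball (0 : ℂ) 1, a z = 0 → b z ≠ 0 := fun z hz h0 hb0 => by
    have := hab z hz
    rw [h0, hb0, norm_zero, add_zero] at this
    linarith
  have hw₁ : ∀ z ∈ ball (0 : ℂ) 1, u z = a z * w z := fun z hz => by
    by_cases h0 : a z = 0
    · have := h z hz
      rw [h0, zero_mul, add_zero] at this
      rw [h0, zero_mul]
      exact (mul_eq_zero.1 this).resolve_left (hb0 z hz h0)
    · simp only [w, if_neg h0]
      field_simp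
  have hw₂ : ∀ z ∈ ball (0 : ℂ) 1, v z = -(b z * w z) := fun z hz => by
    by_cases h0 : a z = 0
    · simp only [w, if_pos h0]
      have := hb0 z hz h0
      field_simp
    · have := h z hz
      rw [hw₁ z hz] at this
      have e : a z * (b z * w z + v z) = 0 := by linear_combination this
      linear_combination (mul_eq_zero.1 e).resolve_left h0
  have hwd : DifferentiableOn ℂ w (ball 0 1) := by
    intro z hz
    refine DifferentiableAt.differentiableWithinAt ?_
    have hda := ha.1.differentiableAt (hball z hz)
    have hdb := hb.1.differentiableAt (hball z hz)
    by_cases h0 : a z = 0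
    · have hne := hb0 z hz h0
      have hd : DifferentiableAt ℂ (fun y => -(v y / b y)) z :=
        ((hv.1.differentiableAt (hball z hz)).div hdb hne).neg
      refine hd.congr_of_eventuallyEq ?_
      filter_upwards [hball z hz, hdb.continuousAt.eventually_ne hne] with y hy hy0
      rw [hw₂ y hy]
      field_simp
    · have hd : DifferentiableAt ℂ (fun y => u y / a y) z :=
        (hu.1.differentiableAt (hball z hz)).div hda h0
      refine hd.congr_of_eventuallyEq ?_
      filter_upwards [hball z hz, hda.continuousAt.eventually_ne h0] with y hy hy0
      rw [hw₁ y hy]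
      field_simp
  refine ⟨w, memHardy2_of_norm_sq_le hwd hu hv (C := 2 * (δ⁻¹) ^ 2) (fun z hz => ?_)
    (by positivity), hw₁, hw₂⟩
  have h1 := congrArg norm (hw₁ z hz)
  have h2 := congrArg norm (hw₂ z hz)
  rw [norm_mul] at h1
  rw [norm_neg, norm_mul] at h2
  have h3 : ‖w z‖ ≤ δ⁻¹ * (‖u z‖ + ‖v z‖) := by
    rw [le_inv_mul_iff₀ hδ, h1, h2, ← add_mul]
    exact mul_le_mul_of_nonneg_right (hab z hz) (norm_nonneg _)
  calc ‖w z‖ ^ 2 ≤ (δ⁻¹ * (‖u z‖ + ‖v z‖)) ^ 2 := by gcongr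
    _ = (δ⁻¹) ^ 2 * (‖u z‖ + ‖v z‖) ^ 2 := by ring
    _ ≤ (δ⁻¹) ^ 2 * (2 * (‖u z‖ ^ 2 + ‖v z‖ ^ 2)) := by
      gcongr
      exact add_sq_le
    _ = _ := by ring

/-- The Koszul complex of a corona pair is exact on `H²`. -/
lemma IsMulOp.exists_of_relation {a b : ℂ → ℂ} {A B : SeqSpace →L[ℂ] SeqSpace}
    (hA : IsMulOp a A) (hB : IsMulOp b B) (ha : MemHinf a) (hb : MemHinf b) {δ : ℝ}
    (hδ : 0 < δ) (hab : ∀ z ∈ ball (0 : ℂ) 1, δ ≤ ‖a z‖ + ‖b z‖) {u v : SeqSpace}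
    (h : B u + A v = 0) : ∃ x, u = A x ∧ v = -B x := by
  obtain ⟨f, hf, hfu⟩ := u.exists_memHardy2
  obtain ⟨g, hg, hgv⟩ := v.exists_memHardy2
  have hneg : DifferentiableOn ℂ (fun z => -g z) (ball 0 1) := hg.1.neg
  have hgv' : ∀ n, taylorCoeff (fun z => -g z) n = (-v) n := fun n => by
    rw [lp.coeFn_neg, Pi.neg_apply, ← hgv, taylorCoeff, iteratedDeriv_fun_neg, neg_div,
      taylorCoeff]
  have heq : EqOn (fun z => b z * f z) (fun z => a z * -g z) (ball 0 1) := by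
    refine eqOn_of_taylorCoeff_eq (hb.1.mul hf.1) (ha.1.mul hneg) fun n => ?_
    rw [hB.apply_eq_taylorCoeff hb.1 hf.1 hfu, hA.apply_eq_taylorCoeff ha.1 hneg hgv', map_neg,
      eq_neg_of_add_eq_zero_left h]
  obtain ⟨w, hw, hw₁, hw₂⟩ := exists_memHardy2_of_relation ha hb hδ hab hf hg fun z hz => by
    have := heq hz
    simp only at this
    linear_combination this
  obtain ⟨x, hx⟩ := hw.exists_seq
  have hx' : ∀ n, taylorCoeff w n = x n := fun n => (hx n).symm
  refine ⟨x, ?_, ?_⟩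
  · ext n
    rw [← hA.apply_eq_taylorCoeff ha.1 hw.1 hx', ← hfu]
    exact taylorCoeff_congr (fun z hz => hw₁ z hz) n
  · rw [← neg_eq_iff_eq_neg]
    ext n
    rw [← hB.apply_eq_taylorCoeff hb.1 hw.1 hx', ← hgv']
    exact taylorCoeff_congr (fun z hz => by simp only [hw₂ z hz, neg_neg]) n

/-- The pairwise corona condition passes to finite products. -/
lemma exists_corona_prod {ι : Type*} {a : ι → ℂ → ℂ} {δ : ℝ} (hδ : 0 < δ) (s : Finset ι) (i : ι)
    (h : ∀ j ∈ s, ∀ z ∈ ball (0 : ℂ) 1, δ ≤ ‖a i z‖ + ‖a j z‖) :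
    ∃ ε : ℝ, 0 < ε ∧ ∀ z ∈ ball (0 : ℂ) 1, ε ≤ ‖a i z‖ + ‖∏ j ∈ s, a j z‖ := by
  refine ⟨min (δ / 2) ((δ / 2) ^ s.card), by positivity, fun z hz => ?_⟩
  rcases le_or_gt (δ / 2) ‖a i z‖ with h1 | h1
  · exact (min_le_left _ _).trans (h1.trans (le_add_of_nonneg_right (norm_nonneg _)))
  · refine (min_le_right _ _).trans (le_trans ?_ (le_add_of_nonneg_left (norm_nonneg _)))
    rw [norm_prod, ← Finset.prod_const]
    refine Finset.prod_le_prod (fun _ _ => by positivity) fun j hj => ?_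
    have := h j hj z hz
    linarith

lemma exists_eq_adjoint_prod {ι : Type*} {a : ι → ℂ → ℂ} (ha : ∀ j, MemHinf (a j)) {δ : ℝ}
    (hδ : 0 < δ) (hab : ∀ i j, i ≠ j → ∀ z ∈ ball (0 : ℂ) 1, δ ≤ ‖a i z‖ + ‖a j z‖)
    {T : ι → SeqSpace →L[ℂ] SeqSpace} (hT : ∀ j, IsMulOp (a j) (T j)) {x : SeqSpace}
    (s : Finset ι) (hx : ∀ j ∈ s, ∃ g, x = adjoint (T j) g) {P : SeqSpace →L[ℂ] SeqSpace}
    (hP : IsMulOp (fun z => ∏ j ∈ s, a j z) P) : ∃ g, x = adjoint P g := by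
  classical
  induction s using Finset.induction_on generalizing P with
  | empty =>
    have hid : IsMulOp (fun z => ∏ j ∈ (∅ : Finset ι), a j z) (.id ℂ SeqSpace) := by
      intro y n
      obtain ⟨f, ⟨hf, -⟩, hfy⟩ := y.exists_memHardy2
      simp_rw [ContinuousLinearMap.id_apply, ← hfy]
      rw [← taylorCoeff_mul (by simp) hf]
      simp
    have e : P = .id ℂ SeqSpace := by
      ext y n
      rw [hP, hid]
    refine ⟨x, ?_⟩
    rw [e, adjoint_id, ContinuousLinearMap.id_apply]
  | insert i s hi ih =>
    have hprod := MemHinf.prod ha s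
    obtain ⟨Q, hQ⟩ := exists_isMulOp hprod
    obtain ⟨ε, hε, hcor⟩ := exists_corona_prod hδ s i fun j hj =>
      hab i j fun e => hi (e ▸ hj)
    obtain ⟨h, hh⟩ := ih (fun j hj => hx j (Finset.mem_insert_of_mem hj)) hQ
    obtain ⟨g, hg⟩ := hx i (Finset.mem_insert_self i s)
    simp_rw [Finset.prod_insert hi] at hP
    have hP₁ := (hT i).comp hQ hP (ha i).1 hprod.1
    have hP₂ := hQ.comp (hT i) (by simpa only [mul_comm] using hP) hprod.1 (ha i).1
    obtain ⟨K, hK, hlow⟩ := (hT i).exists_lower_bound hQ (ha i) hprod hε hcor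
    obtain ⟨k, hk⟩ := exists_eq_adjoint_of_adjoint_eq (hP₁.symm.trans hP₂) hK hlow
      (fun u v huv => (hT i).exists_of_relation hQ (ha i) hprod hε hcor huv) (hg.symm.trans hh)
    refine ⟨k, ?_⟩
    rw [hP₂, adjoint_comp, comp_apply, ← hk, hg]

end Ranges

/-- **Proposition.** Let `a 1, …, a l ∈ H^∞` satisfy the pairwise corona condition: there is
`δ > 0` with `|a i z| + |a j z| ≥ δ` for all `z ∈ 𝔻` and `i ≠ j`.  Then
`⋂ j, T_{conj (a j)} H² = T_{conj (a 1 ⋯ a l)} H²`. -/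
theorem statement10 (l : ℕ) (hl : 1 ≤ l) (a : Fin l → ℂ → ℂ)
    (ha : ∀ j, MemHinf (a j))
    (hcorona : ∃ δ : ℝ, 0 < δ ∧ ∀ (i j : Fin l), i ≠ j →
      ∀ z ∈ ball (0 : ℂ) 1, δ ≤ ‖a i z‖ + ‖a j z‖) :
    ⋂ j, rangeToeplitzConj (a j) = rangeToeplitzConj fun z => ∏ j, a j z := by
  obtain ⟨δ, hδ, hab⟩ := hcorona
  choose T hT using fun j => exists_isMulOp (ha j)
  obtain ⟨P, hP⟩ := exists_isMulOp (MemHinf.prod ha Finset.univ)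
  ext f
  rw [Set.mem_iInter]
  constructor
  · intro h
    have hf : MemHardy2 f := (h ⟨0, hl⟩).1
    obtain ⟨x, hx⟩ := hf.exists_seq
    rw [mem_rangeToeplitzConj_iff hP hf hx]
    exact exists_eq_adjoint_prod ha hδ hab hT Finset.univ
      (fun j _ => (mem_rangeToeplitzConj_iff (hT j) hf hx).1 (h j)) hP
  · intro h j
    have hf : MemHardy2 f := h.1
    obtain ⟨x, hx⟩ := hf.exists_seq
    rw [mem_rangeToeplitzConj_iff hP hf hx] at h
    obtain ⟨g, hg⟩ := h
    rw [mem_rangeToeplitzConj_iff (hT j) hf hx]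
    have hprod := MemHinf.prod ha (Finset.univ.erase j)
    obtain ⟨Q, hQ⟩ := exists_isMulOp hprod
    have hP' : IsMulOp (fun z => (∏ i ∈ Finset.univ.erase j, a i z) * a j z) P := by
      simpa only [Finset.prod_erase_mul _ _ (Finset.mem_univ j)] using hP
    rw [hQ.comp (hT j) hP' hprod.1 (ha j).1, ContinuousLinearMap.adjoint_comp] at hg
    exact ⟨_, hg⟩
end
end

section
/- Let b be a rational, non-extreme function of the closed unit ball of H^∞ with ‖b‖_∞ = 1, Pythagorean mate a with zeros ζ₁,…,ζ_l on 𝕋 of multiplicities m₁,…,m_l, and N = m₁+⋯+m_l. Let Λ = (λ_n) be a sequence in 𝔻∖{0} with Σ_{n∈ℕ} (1−|λ_n|²)/|ζ_j−λ_n|^{2m_j} < ∞ for every 1 ≤ j ≤ l. Then the Blaschke product B_Λ admits a decomposition B_Λ(z) = ∏_{j=1}^l (z−ζ_j)^{m_j} g(z) + p(z) on 𝔻 with g ∈ H² and p a polynomial of degree < N; in particular B_Λ is a multiplier of H(b), i.e. B_Λ·f ∈ H(b) for every f ∈ H(b). -/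
open Complex MeasureTheory Metric Set Finset Filter ProbabilityTheory Polynomial
open scoped ENNReal NNReal Topology

noncomputable section

/-- The squared `H²` norm of `f`, as the supremum of the circle means. -/
def h2NormSq (f : ℂ → ℂ) : ℝ :=
  sSup {y : ℝ | ∃ r : ℝ, 0 < r ∧ r < 1 ∧
    y = (1 / (2 * Real.pi)) * ∫ t in (0 : ℝ)..(2 * Real.pi),
      ‖f ((r : ℂ) * Complex.exp ((t : ℂ) * Complex.I))‖ ^ 2}

/-- Membership in the de Branges-Rovnyak space `H(b)`, where `b` is rational and non-extreme
with Pythagorean mate `a` whose zeros on the circle are `ζ j` with multiplicities `m j`: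
`f = ∏ (z - ζ j)^(m j) · g + p` on `𝔻` with `g ∈ H²` and `p` a polynomial of degree `< ∑ m j`. -/
def MemHb {l : ℕ} (ζ : Fin l → ℂ) (m : Fin l → ℕ) (f : ℂ → ℂ) : Prop :=
  ∃ (g : ℂ → ℂ) (p : Polynomial ℂ), MemHardy2 g ∧ p.degree < ((∑ j, m j : ℕ) : ℕ) ∧
    ∀ z ∈ ball (0 : ℂ) 1, f z = (∏ j, (z - ζ j) ^ m j) * g z + p.eval z

/-- The Carleson condition: the pseudohyperbolic products `∏_{k ≠ n} ρ(Λ n, Λ k)` are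
uniformly bounded below (formulated over all finite subsets not containing `n`). -/
def CarlesonCond (Λ : ℕ → ℂ) : Prop :=
  ∃ δ : ℝ, 0 < δ ∧ ∀ n : ℕ, ∀ F : Finset ℕ, n ∉ F →
    δ ≤ ∏ k ∈ F, ‖(Λ n - Λ k) / (1 - (starRingEnd ℂ) (Λ k) * Λ n)‖

/-- `Λ` is universal interpolating for `H(b)`: the restriction map
`f ↦ (f(Λ n)/‖k^b_{Λ n}‖)` is bounded from `H(b)` into `ℓ²` and onto `ℓ²`.  Here
`‖k^b_λ‖² = (1-|b(λ)|²)/(1-|λ|²)`, and the `H(b)` norm of `f = ∏(z-ζ_j)^{m_j} g + p` is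
`(‖g‖² + ‖p‖²)^{1/2}`. -/
def UnivInterp {l : ℕ} (ζ : Fin l → ℂ) (m : Fin l → ℕ) (b : ℂ → ℂ) (Λ : ℕ → ℂ) : Prop :=
  (∃ C : ℝ, ∀ (g : ℂ → ℂ) (p : Polynomial ℂ), MemHardy2 g → p.degree < ((∑ j, m j : ℕ) : ℕ) →
    ∀ F : Finset ℕ,
      ∑ n ∈ F, ‖(∏ j, (Λ n - ζ j) ^ m j) * g (Λ n) + p.eval (Λ n)‖ ^ 2 *
          ((1 - ‖Λ n‖ ^ 2) / (1 - ‖b (Λ n)‖ ^ 2)) ≤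
        C * (h2NormSq g + h2NormSq fun z => p.eval z)) ∧
  ∀ w : ℕ → ℂ, Summable (fun n => ‖w n‖ ^ 2) →
    ∃ f : ℂ → ℂ, MemHb ζ m f ∧
      ∀ n, f (Λ n) * (Real.sqrt ((1 - ‖Λ n‖ ^ 2) / (1 - ‖b (Λ n)‖ ^ 2)) : ℂ) = w n

/-- `Λ` is multiplier interpolating for `H(b)`: every bounded sequence can be interpolated
by a multiplier of `H(b)`. -/
def MultInterp {l : ℕ} (ζ : Fin l → ℂ) (m : Fin l → ℕ) (Λ : ℕ → ℂ) : Prop :=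
  ∀ v : ℕ → ℂ, (∃ C : ℝ, ∀ n, ‖v n‖ ≤ C) →
    ∃ φ : ℂ → ℂ, (∀ f : ℂ → ℂ, MemHb ζ m f → MemHb ζ m fun z => φ z * f z) ∧
      ∀ n, φ (Λ n) = v n

open Real (circleAverage)

/-- The mean square of `F` over the unit circle. -/
def circleMeanSq (F : ℂ → ℂ) : ℝ := circleAverage (fun z => ‖F z‖ ^ 2) 0 1

/-- The unnormalised Blaschke factor with zero `w`. -/
def blaschkeFactor (w z : ℂ) : ℂ := (z - w) / (1 - (starRingEnd ℂ) w * z)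

lemma one_sub_conj_mul_ne_zero {w z : ℂ} (hw : ‖w‖ < 1) (hz : ‖z‖ ≤ 1) :
    1 - (starRingEnd ℂ) w * z ≠ 0 := by
  intro h
  have h1 : ‖(starRingEnd ℂ) w * z‖ = 1 := by
    rw [← sub_eq_zero.mp h, norm_one]
  rw [norm_mul, RCLike.norm_conj] at h1
  nlinarith [norm_nonneg w, norm_nonneg z]

lemma conj_eq_inv_of_norm_eq_one {z : ℂ} (hz : ‖z‖ = 1) : (starRingEnd ℂ) z = z⁻¹ :=
  (Complex.inv_eq_conj hz).symm

lemma norm_one_sub_conj_mul {w z : ℂ} (hz : ‖z‖ = 1) :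
    ‖1 - (starRingEnd ℂ) w * z‖ = ‖z - w‖ := by
  have hz0 : z ≠ 0 := norm_ne_zero_iff.mp (by simp [hz])
  have h : 1 - (starRingEnd ℂ) w * z = (starRingEnd ℂ) (z - w) * z := by
    rw [map_sub, sub_mul, conj_eq_inv_of_norm_eq_one hz, inv_mul_cancel₀ hz0]
  rw [h, norm_mul, RCLike.norm_conj, hz, mul_one]

lemma norm_blaschkeFactor {w z : ℂ} (hw : ‖w‖ < 1) (hz : ‖z‖ = 1) :
    ‖blaschkeFactor w z‖ = 1 := by
  rw [blaschkeFactor, norm_div, norm_one_sub_conj_mul hz]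
  refine div_self (norm_ne_zero_iff.mpr (sub_ne_zero.mpr ?_))
  rintro rfl
  exact hw.ne hz

lemma differentiableOn_blaschkeFactor {w : ℂ} (hw : ‖w‖ < 1) :
    DifferentiableOn ℂ (blaschkeFactor w) (closedBall 0 1) := by
  intro z hz
  unfold blaschkeFactor
  have := one_sub_conj_mul_ne_zero hw (by simpa using hz)
  fun_prop (disch := assumption)

lemma differentiableOn_const_div_one_sub {w : ℂ} (hw : ‖w‖ < 1) (c : ℂ) :
    DifferentiableOn ℂ (fun z => c / (1 - (starRingEnd ℂ) w * z)) (closedBall 0 1) := by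
  intro z hz
  have := one_sub_conj_mul_ne_zero hw (by simpa using hz)
  fun_prop (disch := assumption)

lemma diffContOnCl_of_differentiableOn {F : ℂ → ℂ}
    (hF : DifferentiableOn ℂ F (closedBall 0 1)) : DiffContOnCl ℂ F (ball 0 |(1 : ℝ)|) := by
  rw [abs_one]
  exact (hF.mono closure_ball_subset_closedBall).diffContOnCl

lemma continuousOn_sphere {F : ℂ → ℂ} (hF : DifferentiableOn ℂ F (closedBall 0 1)) :
    ContinuousOn F (sphere 0 1) :=
  hF.continuousOn.mono sphere_subset_closedBall

lemma circleIntegrable_norm_sq {F : ℂ → ℂ} (hF : ContinuousOn F (sphere 0 1)) :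
    CircleIntegrable (fun z => ‖F z‖ ^ 2) 0 1 :=
  (hF.norm.pow 2).circleIntegrable zero_le_one

/-- Cauchy's formula as the reproducing property of the Szegő kernel. -/
lemma circleAverage_mul_conj_kernel {F : ℂ → ℂ} (hF : DifferentiableOn ℂ F (closedBall 0 1))
    {w : ℂ} (hw : ‖w‖ < 1) (c : ℂ) :
    circleAverage (fun z => F z * (starRingEnd ℂ) (c / (1 - (starRingEnd ℂ) w * z))) 0 1
      = (starRingEnd ℂ) c * F w := by
  have h := (diffContOnCl_of_differentiableOn
    (hF.const_mul ((starRingEnd ℂ) c))).circleAverage_smul_div (w := w) (by simpa using hw)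
  rw [← h]
  refine Real.circleAverage_congr_sphere fun z hz => ?_
  have hz1 : ‖z‖ = 1 := by simpa using hz
  have hz0 : z ≠ 0 := norm_ne_zero_iff.mp (by simp [hz1])
  have hzw : z - w ≠ 0 := by
    rw [sub_ne_zero]; rintro rfl; exact hw.ne hz1
  have h1 : (1 : ℂ) - w * z⁻¹ ≠ 0 := by
    intro h0
    apply hzw
    field_simp at h0
    simpa using h0
  simp only [map_div₀, map_sub, map_one, map_mul, Complex.conj_conj, smul_eq_mul,
    conj_eq_inv_of_norm_eq_one hz1, sub_zero]
  field_simp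

lemma circleMeanSq_nonneg (F : ℂ → ℂ) : 0 ≤ circleMeanSq F :=
  Real.circleAverage_nonneg_of_nonneg fun _ _ => by positivity

lemma circleMeanSq_congr {F G : ℂ → ℂ} (h : ∀ z, ‖z‖ = 1 → ‖F z‖ = ‖G z‖) :
    circleMeanSq F = circleMeanSq G :=
  Real.circleAverage_congr_sphere fun z hz => by
    have := h z (by simpa using hz)
    simp [this]

lemma circleMeanSq_const_mul (c : ℂ) (F : ℂ → ℂ) :
    circleMeanSq (fun z => c * F z) = ‖c‖ ^ 2 * circleMeanSq F := by
  simp only [circleMeanSq, norm_mul, mul_pow]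
  exact Real.circleAverage_fun_smul (a := ‖c‖ ^ 2) (f := fun z => ‖F z‖ ^ 2)

/-- Polarisation for circle means. -/
lemma circleMeanSq_add {F G : ℂ → ℂ} (hF : ContinuousOn F (sphere 0 1))
    (hG : ContinuousOn G (sphere 0 1)) :
    circleMeanSq (fun z => F z + G z) = circleMeanSq F + circleMeanSq G
      + 2 * (circleAverage (fun z => G z * (starRingEnd ℂ) (F z)) 0 1).re := by
  have hi : CircleIntegrable (fun z => G z * (starRingEnd ℂ) (F z)) 0 1 :=
    (hG.mul (Complex.continuous_conj.comp_continuousOn hF)).circleIntegrable zero_le_one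
  have hire : CircleIntegrable (fun z => (G z * (starRingEnd ℂ) (F z)).re) 0 1 :=
    (Complex.continuous_re.comp_continuousOn
      (hG.mul (Complex.continuous_conj.comp_continuousOn hF))).circleIntegrable zero_le_one
  have h1 : (circleAverage (fun z => G z * (starRingEnd ℂ) (F z)) 0 1).re
      = circleAverage (fun z => (G z * (starRingEnd ℂ) (F z)).re) 0 1 :=
    (Complex.reCLM.circleAverage_comp_comm hi).symm
  have h2 : 2 * circleAverage (fun z => (G z * (starRingEnd ℂ) (F z)).re) 0 1
      = circleAverage (fun z => 2 * (G z * (starRingEnd ℂ) (F z)).re) 0 1 :=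
    (Real.circleAverage_fun_smul (a := (2 : ℝ))).symm
  have hire2 : CircleIntegrable (fun z => 2 * (G z * (starRingEnd ℂ) (F z)).re) 0 1 :=
    hire.const_smul (a := (2 : ℝ))
  rw [h1, h2, circleMeanSq, circleMeanSq, circleMeanSq,
    ← Real.circleAverage_fun_add (circleIntegrable_norm_sq hF) (circleIntegrable_norm_sq hG),
    ← Real.circleAverage_fun_add (f₁ := fun z => ‖F z‖ ^ 2 + ‖G z‖ ^ 2)
      ((circleIntegrable_norm_sq hF).add (circleIntegrable_norm_sq hG)) hire2]
  congr 1
  funext z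
  rw [add_comm (F z), ← Complex.normSq_eq_norm_sq, ← Complex.normSq_eq_norm_sq,
    ← Complex.normSq_eq_norm_sq, Complex.normSq_add]
  ring

lemma circleMeanSq_add_le {F G : ℂ → ℂ} (hF : ContinuousOn F (sphere 0 1))
    (hG : ContinuousOn G (sphere 0 1)) :
    circleMeanSq (fun z => F z + G z) ≤ 2 * circleMeanSq F + 2 * circleMeanSq G := by
  have h : 2 * circleMeanSq F + 2 * circleMeanSq G
      = circleAverage (fun z => 2 * ‖F z‖ ^ 2 + 2 * ‖G z‖ ^ 2) 0 1 := by
    rw [Real.circleAverage_fun_add (f₁ := fun z => 2 * ‖F z‖ ^ 2)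
      (f₂ := fun z => 2 * ‖G z‖ ^ 2) ((circleIntegrable_norm_sq hF).const_smul (a := (2 : ℝ)))
      ((circleIntegrable_norm_sq hG).const_smul (a := (2 : ℝ)))]
    congr 1 <;> exact (Real.circleAverage_fun_smul (a := (2 : ℝ))).symm
  rw [h]
  refine Real.circleAverage_mono (circleIntegrable_norm_sq (hF.add hG))
    (((circleIntegrable_norm_sq hF).const_smul (a := (2 : ℝ))).add
      ((circleIntegrable_norm_sq hG).const_smul (a := (2 : ℝ)))) fun z _ => ?_
  nlinarith [norm_add_le (F z) (G z), norm_nonneg (F z + G z), norm_nonneg (F z),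
    norm_nonneg (G z), sq_nonneg (‖F z‖ - ‖G z‖)]

lemma circleMeanSq_sum_le {ι : Type*} (s : Finset ι) (c : ι → ℂ) (F : ι → ℂ → ℂ) {S C : ℝ}
    (hF : ∀ i ∈ s, ContinuousOn (F i) (sphere 0 1)) (hC : ∀ i ∈ s, circleMeanSq (F i) ≤ C)
    (hC0 : 0 ≤ C) (hS : ∑ i ∈ s, ‖c i‖ ≤ S) :
    circleMeanSq (fun z => ∑ i ∈ s, c i * F i z) ≤ S ^ 2 * C := by
  have hS0 : 0 ≤ ∑ i ∈ s, ‖c i‖ := Finset.sum_nonneg fun _ _ => norm_nonneg _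
  have hint : ∀ i ∈ s, CircleIntegrable (fun z => ‖c i‖ * ‖F i z‖ ^ 2) 0 1 := fun i hi =>
    (circleIntegrable_norm_sq (hF i hi)).const_smul (a := ‖c i‖)
  have hint' : CircleIntegrable (fun z => ∑ i ∈ s, ‖c i‖ * ‖F i z‖ ^ 2) 0 1 := by
    refine ContinuousOn.circleIntegrable zero_le_one ?_
    exact continuousOn_finsetSum _ fun i hi => ((hF i hi).norm.pow 2).const_smul ‖c i‖
  calc circleMeanSq (fun z => ∑ i ∈ s, c i * F i z)
      ≤ circleAverage (fun z => (∑ i ∈ s, ‖c i‖) * ∑ i ∈ s, ‖c i‖ * ‖F i z‖ ^ 2) 0 1 := by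
        refine Real.circleAverage_mono (circleIntegrable_norm_sq
          (continuousOn_finsetSum _ fun i hi => continuousOn_const.mul (hF i hi)))
          (hint'.const_smul (a := ∑ i ∈ s, ‖c i‖)) fun z _ => ?_
        calc ‖∑ i ∈ s, c i * F i z‖ ^ 2 ≤ (∑ i ∈ s, ‖c i‖ * ‖F i z‖) ^ 2 := by
              refine pow_le_pow_left₀ (norm_nonneg _) ((norm_sum_le _ _).trans_eq ?_) 2
              simp
          _ ≤ _ := Finset.sum_sq_le_sum_mul_sum_of_sq_le_mul s (fun _ _ => norm_nonneg _)
              (fun _ _ => by positivity) fun i _ => by apply le_of_eq; ring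
    _ = (∑ i ∈ s, ‖c i‖) * ∑ i ∈ s, ‖c i‖ * circleMeanSq (F i) := by
        rw [show circleAverage (fun z => (∑ i ∈ s, ‖c i‖) * ∑ i ∈ s, ‖c i‖ * ‖F i z‖ ^ 2) 0 1
          = (∑ i ∈ s, ‖c i‖) * circleAverage (fun z => ∑ i ∈ s, ‖c i‖ * ‖F i z‖ ^ 2) 0 1 from
          Real.circleAverage_fun_smul (a := ∑ i ∈ s, ‖c i‖), Real.circleAverage_fun_sum hint]
        congr 1
        exact Finset.sum_congr rfl fun i _ => Real.circleAverage_fun_smul (a := ‖c i‖)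
    _ ≤ (∑ i ∈ s, ‖c i‖) * ∑ i ∈ s, ‖c i‖ * C := by
        gcongr with i hi
        exact hC i hi
    _ = (∑ i ∈ s, ‖c i‖) ^ 2 * C := by rw [← Finset.sum_mul]; ring
    _ ≤ S ^ 2 * C := by gcongr

/-- Orthogonality of the Takenaka–Malmquist system. -/
lemma circleMeanSq_takenakaMalmquist (n : ℕ) : ∀ (w κ c : ℕ → ℂ), (∀ k, ‖w k‖ < 1) →
    (∀ k, ‖κ k‖ = 1) →
    circleMeanSq (fun z => ∑ k ∈ range n, (∏ i ∈ range k, κ i * blaschkeFactor (w i) z)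
        * (c k / (1 - (starRingEnd ℂ) (w k) * z)))
      = ∑ k ∈ range n, ‖c k‖ ^ 2 / (1 - ‖w k‖ ^ 2) := by
  induction n with
  | zero => intro w κ c _ _; simp [circleMeanSq, Real.circleAverage_const]
  | succ n ih =>
    intro w κ c hw hκ
    set G : ℂ → ℂ := fun z => ∑ k ∈ range n,
      (∏ i ∈ range k, κ (i + 1) * blaschkeFactor (w (i + 1)) z)
        * (c (k + 1) / (1 - (starRingEnd ℂ) (w (k + 1)) * z)) with hGdef
    have hG : DifferentiableOn ℂ G (closedBall 0 1) :=
      DifferentiableOn.fun_sum fun k _ => DifferentiableOn.mul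
        (DifferentiableOn.fun_finsetProd fun i _ =>
          (differentiableOn_blaschkeFactor (hw _)).const_mul _)
        (differentiableOn_const_div_one_sub (hw _) _)
    have hbG : DifferentiableOn ℂ (fun z => κ 0 * blaschkeFactor (w 0) z * G z)
        (closedBall 0 1) := ((differentiableOn_blaschkeFactor (hw 0)).const_mul _).mul hG
    have hf := differentiableOn_const_div_one_sub (hw 0) (c 0)
    have hsplit : (fun z => ∑ k ∈ range (n + 1), (∏ i ∈ range k, κ i * blaschkeFactor (w i) z)
        * (c k / (1 - (starRingEnd ℂ) (w k) * z)))
        = fun z => c 0 / (1 - (starRingEnd ℂ) (w 0) * z)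
          + κ 0 * blaschkeFactor (w 0) z * G z := by
      funext z
      rw [Finset.sum_range_succ', add_comm, hGdef]
      simp only [Finset.prod_range_succ', Finset.prod_range_zero, one_mul, Finset.mul_sum]
      congr 1
      exact Finset.sum_congr rfl fun k _ => by ring
    rw [hsplit, circleMeanSq_add (continuousOn_sphere hf) (continuousOn_sphere hbG),
      circleAverage_mul_conj_kernel hbG (hw 0) (c 0)]
    have h1 : circleMeanSq (fun z => κ 0 * blaschkeFactor (w 0) z * G z) = circleMeanSq G :=
      circleMeanSq_congr fun z hz => by
        rw [norm_mul, norm_mul, hκ, norm_blaschkeFactor (hw 0) hz, one_mul, one_mul]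
    have h2 : circleMeanSq (fun z => c 0 / (1 - (starRingEnd ℂ) (w 0) * z))
        = ‖c 0‖ ^ 2 / (1 - ‖w 0‖ ^ 2) := by
      have h3 := circleAverage_mul_conj_kernel hf (hw 0) (c 0)
      have h4 : (fun z => c 0 / (1 - (starRingEnd ℂ) (w 0) * z)
          * (starRingEnd ℂ) (c 0 / (1 - (starRingEnd ℂ) (w 0) * z)))
          = Complex.ofRealCLM ∘
            fun z => ‖c 0 / (1 - (starRingEnd ℂ) (w 0) * z)‖ ^ 2 := by
        funext z
        rw [Complex.mul_conj, Complex.normSq_eq_norm_sq]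
        simp
      rw [h4, Complex.ofRealCLM.circleAverage_comp_comm
        (circleIntegrable_norm_sq (continuousOn_sphere hf))] at h3
      have h5 : ((circleMeanSq fun z => c 0 / (1 - (starRingEnd ℂ) (w 0) * z) : ℝ) : ℂ)
          = ((‖c 0‖ ^ 2 / (1 - ‖w 0‖ ^ 2) : ℝ) : ℂ) := by
        refine h3.trans ?_
        rw [mul_comm ((starRingEnd ℂ) (w 0)), Complex.mul_conj, Complex.normSq_eq_norm_sq,
          mul_div_assoc', mul_comm ((starRingEnd ℂ) (c 0)), Complex.mul_conj,
          Complex.normSq_eq_norm_sq]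
        push_cast
        rfl
      exact_mod_cast h5
    rw [h1, h2, hGdef, ih (fun k => w (k + 1)) (fun k => κ (k + 1)) (fun k => c (k + 1))
      (fun k => hw _) (fun k => hκ _), Finset.sum_range_succ']
    simp [blaschkeFactor, add_comm]

/-- Parseval's identity for polynomials. -/
lemma circleMeanSq_sum_monomials (n : ℕ) (c : ℕ → ℂ) :
    circleMeanSq (fun z => ∑ k ∈ range n, c k * z ^ k) = ∑ k ∈ range n, ‖c k‖ ^ 2 := by
  have h := circleMeanSq_takenakaMalmquist n (fun _ => 0) (fun _ => 1) c (by simp) (by simp)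
  simpa [blaschkeFactor, mul_comm] using h

/-- Bessel's inequality for the Taylor coefficients of a function holomorphic up to the
boundary. -/
lemma exists_taylor_coeff {F : ℂ → ℂ} (hF : DifferentiableOn ℂ F (closedBall 0 1)) :
    ∃ a : ℕ → ℂ, (∀ n, ∑ k ∈ range n, ‖a k‖ ^ 2 ≤ circleMeanSq F) ∧
      ∀ z ∈ ball (0 : ℂ) 1, HasSum (fun k => a k * z ^ k) (F z) := by
  set a : ℕ → ℂ := fun k => circleAverage (fun z => F z * (starRingEnd ℂ) (z ^ k)) 0 1 with ha
  have hFc := continuousOn_sphere hF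
  refine ⟨a, fun n => ?_, fun z hz => ?_⟩
  · have hSc : ContinuousOn (fun z : ℂ => ∑ k ∈ range n, -a k * z ^ k) (sphere 0 1) := by
      fun_prop
    have hcross : circleAverage
        (fun z => F z * (starRingEnd ℂ) (∑ k ∈ range n, -a k * z ^ k)) 0 1
        = -((∑ k ∈ range n, ‖a k‖ ^ 2 : ℝ) : ℂ) := by
      have h1 : (fun z => F z * (starRingEnd ℂ) (∑ k ∈ range n, -a k * z ^ k))
          = fun z => ∑ k ∈ range n,
            (-(starRingEnd ℂ) (a k)) • (F z * (starRingEnd ℂ) (z ^ k)) := by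
        funext z
        rw [map_sum, Finset.mul_sum]
        refine Finset.sum_congr rfl fun k _ => ?_
        simp only [map_mul, map_neg, smul_eq_mul]
        ring
      rw [h1, Real.circleAverage_fun_sum, Complex.ofReal_sum, ← Finset.sum_neg_distrib]
      · refine Finset.sum_congr rfl fun k _ => ?_
        rw [Real.circleAverage_fun_smul, smul_eq_mul, neg_mul, mul_comm]
        change -(a k * (starRingEnd ℂ) (a k)) = _
        rw [Complex.mul_conj, Complex.normSq_eq_norm_sq]
      · intro k _
        refine ContinuousOn.circleIntegrable zero_le_one ?_
        have hk : ContinuousOn (fun z : ℂ => (starRingEnd ℂ) (z ^ k)) (sphere 0 1) :=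
          (Complex.continuous_conj.comp (continuous_pow k)).continuousOn
        exact (hFc.mul hk).const_smul (-(starRingEnd ℂ) (a k))
    have h2 := circleMeanSq_add hSc hFc
    rw [hcross] at h2
    have h3 := circleMeanSq_sum_monomials n (fun k => -a k)
    have h4 := circleMeanSq_nonneg fun z => (∑ k ∈ range n, -a k * z ^ k) + F z
    simp only [norm_neg] at h3
    rw [h3, Complex.neg_re, Complex.ofReal_re] at h2
    linarith
  · have hd : DiffContOnCl ℂ F (ball 0 ((1 : ℝ≥0) : ℝ)) := by
      simpa using diffContOnCl_of_differentiableOn hF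
    have h := (hd.hasFPowerSeriesOnBall one_pos).hasSum
      (y := z) (by simpa [Metric.mem_eball, edist_zero_right, enorm_eq_nnnorm,
        ← NNReal.coe_lt_one] using hz)
    rw [zero_add] at h
    suffices hk : (fun k => a k * z ^ k) = fun k => cauchyPowerSeries F 0 ((1 : ℝ≥0) : ℝ) k
        fun _ => z by rwa [hk]
    funext k
    rw [cauchyPowerSeries_apply, NNReal.coe_one, ha]
    simp only [Real.circleAverage_eq_circleIntegral one_ne_zero]
    rw [smul_mul_assoc, ← smul_eq_mul (b := z ^ k), ← circleIntegral.integral_smul_const]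
    congr 1
    refine circleIntegral.integral_congr zero_le_one fun x hx => ?_
    have hx1 : ‖x‖ = 1 := by simpa using hx
    simp only [smul_eq_mul, map_pow, conj_eq_inv_of_norm_eq_one hx1, sub_zero, div_pow]
    rw [inv_pow, div_eq_mul_inv]
    ring

section PowerSeries

variable {a : ℕ → ℂ} {C : ℝ}

lemma norm_le_sqrt_of_sum_sq_le (ha : ∀ n, ∑ k ∈ range n, ‖a k‖ ^ 2 ≤ C) (k : ℕ) :
    ‖a k‖ ≤ √C :=
  Real.le_sqrt_of_sq_le <| (Finset.single_le_sum (f := fun k => ‖a k‖ ^ 2)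
    (fun _ _ => by positivity) (Finset.self_mem_range_succ k)).trans (ha (k + 1))

lemma norm_coeff_mul_pow_le (ha : ∀ n, ∑ k ∈ range n, ‖a k‖ ^ 2 ≤ C) {r : ℝ} {z : ℂ}
    (hz : ‖z‖ ≤ r) (k : ℕ) : ‖a k * z ^ k‖ ≤ √C * r ^ k := by
  rw [norm_mul, norm_pow]
  exact mul_le_mul (norm_le_sqrt_of_sum_sq_le ha k)
    (pow_le_pow_left₀ (norm_nonneg _) hz k) (by positivity) (Real.sqrt_nonneg _)

lemma summable_sqrt_mul_pow (C : ℝ) {r : ℝ} (hr0 : 0 ≤ r) (hr1 : r < 1) :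
    Summable fun k : ℕ => √C * r ^ k :=
  (summable_geometric_of_lt_one hr0 hr1).mul_left _

/-- A power series with square-summable coefficients belongs to `H²`. -/
lemma memHardy2_tsum (ha : ∀ n, ∑ k ∈ range n, ‖a k‖ ^ 2 ≤ C) :
    MemHardy2 fun z => ∑' k, a k * z ^ k := by
  refine ⟨fun z hz => ?_, C, fun r hr0 hr1 => ?_⟩
  · obtain ⟨r, hzr, hr1⟩ := exists_between (show ‖z‖ < 1 by simpa using hz)
    have hd : DifferentiableOn ℂ (fun z => ∑' k, a k * z ^ k) (ball 0 r) := by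
      refine differentiableOn_tsum_of_summable_norm
        (summable_sqrt_mul_pow C ((norm_nonneg z).trans hzr.le) hr1)
        (fun k => by fun_prop) isOpen_ball fun k w hw => ?_
      exact norm_coeff_mul_pow_le ha (mem_ball_zero_iff.mp hw).le k
    exact (hd.differentiableAt (isOpen_ball.mem_nhds (by simpa using hzr))).differentiableWithinAt
  · have hnorm : ∀ t : ℝ, ‖(r : ℂ) * Complex.exp ((t : ℂ) * Complex.I)‖ = r := fun t => by
      rw [norm_mul, Complex.norm_exp_ofReal_mul_I, mul_one, Complex.norm_real,
        Real.norm_of_nonneg hr0.le]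
    have hs := summable_sqrt_mul_pow C hr0.le hr1
    have hlim : Tendsto (fun n => (1 / (2 * Real.pi)) * ∫ t in (0 : ℝ)..(2 * Real.pi),
        ‖∑ k ∈ range n, a k * ((r : ℂ) * Complex.exp ((t : ℂ) * Complex.I)) ^ k‖ ^ 2) atTop
        (𝓝 ((1 / (2 * Real.pi)) * ∫ t in (0 : ℝ)..(2 * Real.pi),
          ‖∑' k, a k * ((r : ℂ) * Complex.exp ((t : ℂ) * Complex.I)) ^ k‖ ^ 2)) := by
      refine Tendsto.const_mul _ ?_
      refine intervalIntegral.tendsto_integral_filter_of_dominated_convergence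
        (fun _ => (∑' k, √C * r ^ k) ^ 2) ?_ ?_ intervalIntegrable_const ?_
      · refine Eventually.of_forall fun n => Continuous.aestronglyMeasurable ?_
        fun_prop
      · refine Eventually.of_forall fun n => Eventually.of_forall fun t _ => ?_
        rw [norm_pow, norm_norm]
        refine pow_le_pow_left₀ (norm_nonneg _) ?_ 2
        calc _ ≤ ∑ k ∈ range n, √C * r ^ k :=
              norm_sum_le_of_le _ fun k _ => norm_coeff_mul_pow_le ha (hnorm t).le k
          _ ≤ _ := hs.sum_le_tsum _ fun k _ => by positivity
      · refine Eventually.of_forall fun t _ => ?_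
        have := (hs.of_norm_bounded fun k =>
          norm_coeff_mul_pow_le ha (hnorm t).le k).hasSum.tendsto_sum_nat
        exact this.norm.pow 2
    refine le_of_tendsto hlim (Eventually.of_forall fun n => ?_)
    have h1 := circleMeanSq_sum_monomials n fun k => a k * (r : ℂ) ^ k
    have h2 : (1 / (2 * Real.pi)) * ∫ t in (0 : ℝ)..(2 * Real.pi),
        ‖∑ k ∈ range n, a k * ((r : ℂ) * Complex.exp ((t : ℂ) * Complex.I)) ^ k‖ ^ 2
        = circleMeanSq (fun z => ∑ k ∈ range n, a k * (r : ℂ) ^ k * z ^ k) := by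
      simp [circleMeanSq, circleAverage, circleMap, mul_pow, mul_assoc]
    rw [h2, h1]
    refine (Finset.sum_le_sum fun k _ => ?_).trans (ha n)
    refine pow_le_pow_left₀ (norm_nonneg _) ?_ 2
    rw [norm_mul, norm_pow, Complex.norm_real, Real.norm_of_nonneg hr0.le]
    exact mul_le_of_le_one_right (norm_nonneg _) (pow_le_one₀ hr0.le hr1.le)

end PowerSeries

/-- `F = (z - ζ) ^ s * g + p` on the closed disk with quantitative control on `g` and `p`. -/
def HasDecomp (ζ : ℂ) (s D : ℕ) (C : ℝ) (F : ℂ → ℂ) : Prop :=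
  ∃ (g : ℂ → ℂ) (p : Polynomial ℂ), DifferentiableOn ℂ g (closedBall 0 1) ∧
    circleMeanSq g ≤ C ∧ p.natDegree ≤ D ∧ (∀ j, ‖p.coeff j‖ ≤ C) ∧
    ∀ z ∈ closedBall (0 : ℂ) 1, F z = (z - ζ) ^ s * g z + p.eval z

lemma exists_tendsto_ultrafilter (U : Ultrafilter ℕ) {u : ℕ → ℂ} {M : ℝ} (h : ∀ n, ‖u n‖ ≤ M) :
    ∃ x, Tendsto u U (𝓝 x) := by
  obtain ⟨x, -, hx⟩ := (isCompact_closedBall (0 : ℂ) M).ultrafilter_le_nhds (U.map u) (by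
    rw [Filter.le_principal_iff, Ultrafilter.mem_coe, Ultrafilter.mem_map]
    exact Filter.univ_mem' fun n => by simpa using h n)
  exact ⟨x, hx⟩

/-- Uniform decompositions pass to pointwise limits, the quotient staying in `H²`. -/
lemma exists_decomp_of_tendsto {ζ : ℂ} {s D : ℕ} {C : ℝ} {F : ℕ → ℂ → ℂ} {B : ℂ → ℂ}
    (hF : ∀ n, HasDecomp ζ s D C (F n))
    (hB : ∀ z ∈ ball (0 : ℂ) 1, Tendsto (fun n => F n z) atTop (𝓝 (B z))) :
    ∃ (g : ℂ → ℂ) (p : Polynomial ℂ), MemHardy2 g ∧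
      ∀ z ∈ ball (0 : ℂ) 1, B z = (z - ζ) ^ s * g z + p.eval z := by
  choose g p hg hgC hpD hpC hdec using hF
  choose a ha hag using fun n => exists_taylor_coeff (hg n)
  replace ha : ∀ n N, ∑ k ∈ range N, ‖a n k‖ ^ 2 ≤ C := fun n N => (ha n N).trans (hgC n)
  set U : Ultrafilter ℕ := hyperfilter ℕ
  choose α hα using fun k => exists_tendsto_ultrafilter U (u := fun n => a n k)
    fun n => norm_le_sqrt_of_sum_sq_le (ha n) k
  choose c hc using fun j => exists_tendsto_ultrafilter U (u := fun n => (p n).coeff j)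
    fun n => hpC n j
  have hαC : ∀ N, ∑ k ∈ range N, ‖α k‖ ^ 2 ≤ C := fun N =>
    le_of_tendsto (tendsto_finsetSum _ fun k _ => (hα k).norm.pow 2)
      (Eventually.of_forall fun n => ha n N)
  refine ⟨_, ∑ j ∈ range (D + 1), Polynomial.C (c j) * Polynomial.X ^ j,
    memHardy2_tsum hαC, fun z hz => ?_⟩
  have hz1 : ‖z‖ < 1 := by simpa using hz
  have hlimg : Tendsto (fun n => g n z) U (𝓝 (∑' k, α k * z ^ k)) := by
    simp_rw [← fun n => (hag n z hz).tsum_eq]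
    exact tendsto_tsum_of_dominated_convergence
      (summable_sqrt_mul_pow C (norm_nonneg z) hz1)
      (fun k => (hα k).mul_const _)
      (Eventually.of_forall fun n k => norm_coeff_mul_pow_le (ha n) le_rfl k)
  have hlimp : Tendsto (fun n => (p n).eval z) U (𝓝 (∑ j ∈ range (D + 1), c j * z ^ j)) := by
    simp_rw [fun n => Polynomial.eval_eq_sum_range' (Nat.lt_succ_of_le (hpD n)) z]
    exact tendsto_finsetSum _ fun j _ => (hc j).mul_const _
  have h1 := (hB z hz).mono_left Nat.hyperfilter_le_atTop
  have h2 := (hlimg.const_mul ((z - ζ) ^ s)).add hlimp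
  simp_rw [← fun n => hdec n z (ball_subset_closedBall hz)] at h2
  rw [tendsto_nhds_unique h1 h2]
  simp [Polynomial.eval_finsetSum]

namespace HasDecomp

variable {ζ : ℂ} {s D : ℕ} {C : ℝ} {F G : ℂ → ℂ}

lemma nonneg (h : HasDecomp ζ s D C F) : 0 ≤ C := by
  obtain ⟨g, p, -, hgC, -⟩ := h
  exact (circleMeanSq_nonneg g).trans hgC

lemma mono (h : HasDecomp ζ s D C F) {D' : ℕ} {C' : ℝ} (hD : D ≤ D') (hC : C ≤ C') :
    HasDecomp ζ s D' C' F := by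
  obtain ⟨g, p, hg, hgC, hpD, hpC, hdec⟩ := h
  exact ⟨g, p, hg, hgC.trans hC, hpD.trans hD, fun j => (hpC j).trans hC, hdec⟩

lemma congr (h : HasDecomp ζ s D C F) (hFG : ∀ z ∈ closedBall (0 : ℂ) 1, G z = F z) :
    HasDecomp ζ s D C G := by
  obtain ⟨g, p, hg, hgC, hpD, hpC, hdec⟩ := h
  exact ⟨g, p, hg, hgC, hpD, hpC, fun z hz => (hFG z hz).trans (hdec z hz)⟩

lemma of_zero (hF : DifferentiableOn ℂ F (closedBall 0 1)) (hC : circleMeanSq F ≤ C) :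
    HasDecomp ζ 0 D C F :=
  ⟨F, 0, hF, hC, by simp, fun j => by simpa using (circleMeanSq_nonneg F).trans hC,
    fun z _ => by simp⟩

lemma one (ζ : ℂ) (s : ℕ) : HasDecomp ζ s 0 1 fun _ => 1 := by
  refine ⟨fun _ => 0, 1, by fun_prop, by simp [circleMeanSq, Real.circleAverage_const], by simp,
    fun j => ?_, by simp⟩
  rw [Polynomial.coeff_one]
  split_ifs <;> simp

lemma mul_sub (h : HasDecomp ζ s D C F) (hζ : ‖ζ‖ = 1) :
    HasDecomp ζ (s + 1) (D + 1) (2 * C) fun z => (z - ζ) * F z := by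
  have hC := h.nonneg
  obtain ⟨g, p, hg, hgC, hpD, hpC, hdec⟩ := h
  refine ⟨g, (Polynomial.X - Polynomial.C ζ) * p, hg, by linarith, ?_, fun j => ?_,
    fun z hz => ?_⟩
  · refine Polynomial.natDegree_mul_le.trans ?_
    rw [Polynomial.natDegree_X_sub_C]
    omega
  · have h1 : ‖(Polynomial.X * p).coeff j‖ ≤ C := by
      cases j with
      | zero => simpa using hC
      | succ j => simpa [Polynomial.coeff_X_mul] using hpC j
    rw [sub_mul, Polynomial.coeff_sub, Polynomial.coeff_C_mul]
    refine (norm_sub_le _ _).trans ?_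
    rw [norm_mul, hζ, one_mul]
    linarith [hpC j]
  · beta_reduce
    rw [hdec z hz]
    simp only [Polynomial.eval_mul, Polynomial.eval_sub, Polynomial.eval_X, Polynomial.eval_C]
    ring

lemma add (hF : HasDecomp ζ s D C F) (hG : HasDecomp ζ s D C G) :
    HasDecomp ζ s D (4 * C) fun z => F z + G z := by
  have hC := hF.nonneg
  obtain ⟨g, p, hg, hgC, hpD, hpC, hdec⟩ := hF
  obtain ⟨g', p', hg', hgC', hpD', hpC', hdec'⟩ := hG
  refine ⟨fun z => g z + g' z, p + p', hg.add hg', ?_, ?_, fun j => ?_, fun z hz => ?_⟩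
  · linarith [circleMeanSq_add_le (continuousOn_sphere hg) (continuousOn_sphere hg')]
  · exact (Polynomial.natDegree_add_le _ _).trans (max_le hpD hpD')
  · rw [Polynomial.coeff_add]
    linarith [norm_add_le (p.coeff j) (p'.coeff j), hpC j, hpC' j]
  · beta_reduce
    rw [hdec z hz, hdec' z hz, Polynomial.eval_add]
    ring

lemma sum {ι : Type*} (t : Finset ι) {c : ι → ℂ} {F : ι → ℂ → ℂ} {S : ℝ} (hC : 0 ≤ C)
    (hF : ∀ i ∈ t, HasDecomp ζ s D C (F i)) (hS : ∑ i ∈ t, ‖c i‖ ≤ S) :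
    HasDecomp ζ s D ((S ^ 2 + S) * C) fun z => ∑ i ∈ t, c i * F i z := by
  have hS0 : 0 ≤ S := (Finset.sum_nonneg fun _ _ => norm_nonneg _).trans hS
  choose! g p hg hgC hpD hpC hdec using hF
  refine ⟨fun z => ∑ i ∈ t, c i * g i z, ∑ i ∈ t, Polynomial.C (c i) * p i,
    DifferentiableOn.fun_sum fun i hi => (hg i hi).const_mul _, ?_, ?_, fun j => ?_,
    fun z hz => ?_⟩
  · refine (circleMeanSq_sum_le t c g (fun i hi => continuousOn_sphere (hg i hi)) hgC hC
      hS).trans ?_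
    nlinarith [mul_nonneg hS0 hC]
  · exact Polynomial.natDegree_sum_le_of_forall_le _ _ fun i hi =>
      (Polynomial.natDegree_C_mul_le _ _).trans (hpD i hi)
  · rw [Polynomial.finsetSum_coeff]
    calc ‖∑ i ∈ t, (Polynomial.C (c i) * p i).coeff j‖ ≤ ∑ i ∈ t, ‖c i‖ * C := by
          refine norm_sum_le_of_le _ fun i hi => ?_
          rw [Polynomial.coeff_C_mul, norm_mul]
          exact mul_le_mul_of_nonneg_left (hpC i hi j) (norm_nonneg _)
      _ ≤ S * C := by rw [← Finset.sum_mul]; gcongr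
      _ ≤ _ := by nlinarith [mul_nonneg (sq_nonneg S) hC]
  · rw [Polynomial.eval_finsetSum, Finset.mul_sum, ← Finset.sum_add_distrib]
    refine Finset.sum_congr rfl fun i hi => ?_
    rw [hdec i hi z hz, Polynomial.eval_mul, Polynomial.eval_C]
    ring

lemma const_mul (h : HasDecomp ζ s D C F) {u : ℂ} (hu : ‖u‖ = 1) :
    HasDecomp ζ s D C fun z => u * F z := by
  obtain ⟨g, p, hg, hgC, hpD, hpC, hdec⟩ := h
  refine ⟨fun z => u * g z, Polynomial.C u * p, hg.const_mul _, ?_,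
    (Polynomial.natDegree_C_mul_le _ _).trans hpD, fun j => ?_, fun z hz => ?_⟩
  · rwa [circleMeanSq_const_mul, hu, one_pow, one_mul]
  · rw [Polynomial.coeff_C_mul, norm_mul, hu, one_mul]
    exact hpC j
  · beta_reduce
    rw [hdec z hz, Polynomial.eval_mul, Polynomial.eval_C]
    ring

end HasDecomp

/-- The finite Blaschke product with zeros `w 0, …, w (n - 1)`, normalised to be `1` at `ζ`. -/
def normBlaschke (ζ : ℂ) (w : ℕ → ℂ) (n : ℕ) (z : ℂ) : ℂ :=
  ∏ i ∈ range n, (1 - (starRingEnd ℂ) (w i) * ζ) / (ζ - w i) * blaschkeFactor (w i) z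

section NormBlaschke

variable {ζ : ℂ} {w : ℕ → ℂ}

lemma sub_ne_zero_of_norm_lt {ζ w : ℂ} (hζ : ‖ζ‖ = 1) (hw : ‖w‖ < 1) : ζ - w ≠ 0 := by
  rw [sub_ne_zero]
  rintro rfl
  exact hw.ne hζ

lemma norm_normBlaschke_const {ζ w : ℂ} (hζ : ‖ζ‖ = 1) (hw : ‖w‖ < 1) :
    ‖(1 - (starRingEnd ℂ) w * ζ) / (ζ - w)‖ = 1 := by
  rw [norm_div, norm_one_sub_conj_mul hζ]
  exact div_self (norm_ne_zero_iff.mpr (sub_ne_zero_of_norm_lt hζ hw))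

lemma differentiableOn_normBlaschke (hw : ∀ k, ‖w k‖ < 1) (n : ℕ) :
    DifferentiableOn ℂ (normBlaschke ζ w n) (closedBall 0 1) :=
  DifferentiableOn.fun_finsetProd fun _ _ =>
    (differentiableOn_blaschkeFactor (hw _)).const_mul _

lemma norm_normBlaschke (hζ : ‖ζ‖ = 1) (hw : ∀ k, ‖w k‖ < 1) (n : ℕ) {z : ℂ} (hz : ‖z‖ = 1) :
    ‖normBlaschke ζ w n z‖ = 1 := by
  rw [normBlaschke, norm_prod]
  refine Finset.prod_eq_one fun i _ => ?_
  rw [norm_mul, norm_normBlaschke_const hζ (hw i), norm_blaschkeFactor (hw i) hz, one_mul]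

lemma normBlaschke_factor {ζ w z : ℂ} (hζ : ‖ζ‖ = 1) (hw : ‖w‖ < 1) (hz : ‖z‖ ≤ 1) :
    (1 - (starRingEnd ℂ) w * ζ) / (ζ - w) * blaschkeFactor w z
      = 1 + (z - ζ) * (((1 - ‖w‖ ^ 2 : ℝ) : ℂ) / (ζ - w) / (1 - (starRingEnd ℂ) w * z)) := by
  have h1 := sub_ne_zero_of_norm_lt hζ hw
  have h2 := one_sub_conj_mul_ne_zero hw hz
  have h3 : ((‖w‖ ^ 2 : ℝ) : ℂ) = w * (starRingEnd ℂ) w := by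
    rw [Complex.mul_conj, Complex.normSq_eq_norm_sq]
  rw [blaschkeFactor, Complex.ofReal_sub, h3, Complex.ofReal_one]
  generalize (starRingEnd ℂ) w = w' at *
  field_simp
  ring

lemma normBlaschke_eq_one_add (hζ : ‖ζ‖ = 1) (hw : ∀ k, ‖w k‖ < 1) (n : ℕ) {z : ℂ}
    (hz : ‖z‖ ≤ 1) :
    normBlaschke ζ w n z = 1 + (z - ζ) * ∑ k ∈ range n, normBlaschke ζ w k z *
      (((1 - ‖w k‖ ^ 2 : ℝ) : ℂ) / (ζ - w k) / (1 - (starRingEnd ℂ) (w k) * z)) := by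
  induction n with
  | zero => simp [normBlaschke]
  | succ n ih =>
    have h : normBlaschke ζ w (n + 1) z = normBlaschke ζ w n z
        * ((1 - (starRingEnd ℂ) (w n) * ζ) / (ζ - w n) * blaschkeFactor (w n) z) :=
      Finset.prod_range_succ _ _
    rw [h, normBlaschke_factor hζ (hw n) hz, Finset.sum_range_succ, mul_add, mul_one,
      mul_add (z - ζ), ← add_assoc, ← ih]
    ring

lemma div_one_sub_eq {ζ w z : ℂ} (hζ : ‖ζ‖ = 1) (hw : ‖w‖ < 1) (hz : ‖z‖ ≤ 1) (c : ℂ) :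
    c / (1 - (starRingEnd ℂ) w * z) = c / (1 - (starRingEnd ℂ) w * ζ) + (z - ζ) *
      (c / (1 - (starRingEnd ℂ) w * ζ) * (starRingEnd ℂ) w / (1 - (starRingEnd ℂ) w * z)) := by
  have h1 := one_sub_conj_mul_ne_zero hw hζ.le
  have h2 := one_sub_conj_mul_ne_zero hw hz
  field_simp
  ring

/-- Uniform decompositions at `ζ` of finite Blaschke products and of Malmquist sums. -/
lemma hasDecomp_normBlaschke_aux (hζ : ‖ζ‖ = 1) (hw : ∀ k, ‖w k‖ < 1) {m : ℕ}
    (hS : ∀ q ≤ 2 * m, ∃ S : ℝ, ∀ n,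
      ∑ k ∈ range n, (1 - ‖w k‖ ^ 2) / ‖ζ - w k‖ ^ q ≤ S) (s : ℕ) (hs : s ≤ m) :
    (∃ (C : ℝ) (D : ℕ), ∀ n, HasDecomp ζ s D C (normBlaschke ζ w n)) ∧
    ∀ q, q + s ≤ m → ∃ (C : ℝ) (D : ℕ), ∀ v : ℕ → ℂ,
      (∀ k, ‖v k‖ ≤ (1 - ‖w k‖ ^ 2) / ‖ζ - w k‖ ^ q) → ∀ n, HasDecomp ζ s D C
        fun z => ∑ k ∈ range n, normBlaschke ζ w k z *
          (v k / (1 - (starRingEnd ℂ) (w k) * z)) := by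
  have hd : ∀ k, 0 < ‖ζ - w k‖ := fun k =>
    norm_pos_iff.mpr (sub_ne_zero_of_norm_lt hζ (hw k))
  have hw2 : ∀ k, 0 < 1 - ‖w k‖ ^ 2 := fun k => by nlinarith [hw k, norm_nonneg (w k)]
  induction s with
  | zero =>
    refine ⟨⟨1, 0, fun n => .of_zero (differentiableOn_normBlaschke hw n) ?_⟩, fun q hq => ?_⟩
    · rw [circleMeanSq_congr (G := fun _ => 1)
        fun z hz => by simp [norm_normBlaschke hζ hw n hz]]
      simp [circleMeanSq, Real.circleAverage_const]
    · obtain ⟨S, hSq⟩ := hS (2 * q) (by omega)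
      refine ⟨S, 0, fun v hv n => .of_zero ?_ ?_⟩
      · exact DifferentiableOn.fun_sum fun k _ => (differentiableOn_normBlaschke hw k).mul
          (differentiableOn_const_div_one_sub (hw k) _)
      · refine (circleMeanSq_takenakaMalmquist n w _ v hw
          fun k => norm_normBlaschke_const hζ (hw k)).trans_le ?_
        refine (Finset.sum_le_sum fun k _ => ?_).trans (hSq n)
        rw [div_le_iff₀ (hw2 k)]
        calc ‖v k‖ ^ 2 ≤ ((1 - ‖w k‖ ^ 2) / ‖ζ - w k‖ ^ q) ^ 2 :=
              pow_le_pow_left₀ (norm_nonneg _) (hv k) 2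
          _ = _ := by
            rw [div_pow, ← pow_mul, mul_comm q]
            ring
  | succ s ih =>
    obtain ⟨-, hsum⟩ := ih (by omega)
    have hB : ∃ (C : ℝ) (D : ℕ), ∀ n, HasDecomp ζ (s + 1) D C (normBlaschke ζ w n) := by
      obtain ⟨C, D, h⟩ := hsum 1 (by omega)
      refine ⟨4 * max 1 (2 * C), D + 1, fun n => ?_⟩
      have h1 := (h (fun k => ((1 - ‖w k‖ ^ 2 : ℝ) : ℂ) / (ζ - w k)) (fun k => by
        rw [norm_div, Complex.norm_real, Real.norm_of_nonneg (hw2 k).le, pow_one]) n).mul_sub hζ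
      refine (((HasDecomp.one ζ (s + 1)).mono (Nat.zero_le _) (le_max_left _ _)).add
        (h1.mono le_rfl (le_max_right _ _))).congr fun z hz => ?_
      exact normBlaschke_eq_one_add hζ hw n (by simpa using hz)
    refine ⟨hB, fun q hq => ?_⟩
    obtain ⟨C₁, D₁, h₁⟩ := hB
    obtain ⟨C₂, D₂, h₂⟩ := hsum (q + 1) (by omega)
    obtain ⟨S, hSq⟩ := hS (q + 1) (by omega)
    refine ⟨4 * max ((S ^ 2 + S) * C₁) (2 * C₂), max D₁ (D₂ + 1), fun v hv n => ?_⟩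
    have hβ : ∀ k, ‖v k / (1 - (starRingEnd ℂ) (w k) * ζ)‖
        ≤ (1 - ‖w k‖ ^ 2) / ‖ζ - w k‖ ^ (q + 1) := fun k => by
      rw [norm_div, norm_one_sub_conj_mul hζ, pow_succ ‖ζ - w k‖ q, ← div_div]
      exact div_le_div_of_nonneg_right (hv k) (hd k).le
    have hA := HasDecomp.sum (range n) (h₁ 0).nonneg (fun k _ => h₁ k)
      ((Finset.sum_le_sum fun k _ => hβ k).trans (hSq n))
    have hE := (h₂ (fun k => v k / (1 - (starRingEnd ℂ) (w k) * ζ) * (starRingEnd ℂ) (w k))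
      (fun k => by
        rw [norm_mul, RCLike.norm_conj]
        exact (mul_le_of_le_one_right (norm_nonneg _) (hw k).le).trans (hβ k)) n).mul_sub hζ
    refine ((hA.mono (le_max_left _ _) (le_max_left _ _)).add
      (hE.mono (le_max_right _ _) (le_max_right _ _))).congr fun z hz => ?_
    rw [Finset.mul_sum, ← Finset.sum_add_distrib]
    refine Finset.sum_congr rfl fun k _ => ?_
    rw [div_one_sub_eq hζ (hw k) (by simpa using hz)]
    ring

end NormBlaschke

/-- Uniform decomposition at `ζ` of the partial Blaschke products. -/
lemma hasDecomp_blaschke_partial {ζ : ℂ} {w : ℕ → ℂ} {m : ℕ} (hζ : ‖ζ‖ = 1)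
    (hw : ∀ n, ‖w n‖ < 1 ∧ w n ≠ 0)
    (hsum : Summable fun n => (1 - ‖w n‖ ^ 2) / ‖ζ - w n‖ ^ (2 * m)) :
    ∃ (C : ℝ) (D : ℕ), ∀ n, HasDecomp ζ m D C fun z => ∏ k ∈ range n,
      ((‖w k‖ : ℂ) / w k) * ((w k - z) / (1 - (starRingEnd ℂ) (w k) * z)) := by
  have hd : ∀ k, 0 < ‖ζ - w k‖ := fun k =>
    norm_pos_iff.mpr (sub_ne_zero_of_norm_lt hζ (hw k).1)
  have hd2 : ∀ k, ‖ζ - w k‖ ≤ 2 := fun k => by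
    linarith [norm_sub_le ζ (w k), (hw k).1]
  have hw2 : ∀ k, 0 < 1 - ‖w k‖ ^ 2 := fun k => by
    nlinarith [(hw k).1, norm_nonneg (w k)]
  have hS : ∀ q ≤ 2 * m, ∃ S : ℝ, ∀ n,
      ∑ k ∈ range n, (1 - ‖w k‖ ^ 2) / ‖ζ - w k‖ ^ q ≤ S := fun q hq => by
    refine ⟨∑' k, 2 ^ (2 * m - q) * ((1 - ‖w k‖ ^ 2) / ‖ζ - w k‖ ^ (2 * m)), fun n => ?_⟩
    refine (Finset.sum_le_sum fun k _ => ?_).trans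
      ((hsum.mul_left (2 ^ (2 * m - q))).sum_le_tsum (range n)
        fun k _ => by have := hw2 k; positivity)
    have hpow : ‖ζ - w k‖ ^ (2 * m) = ‖ζ - w k‖ ^ (2 * m - q) * ‖ζ - w k‖ ^ q := by
      rw [← pow_add, Nat.sub_add_cancel hq]
    rw [mul_div_assoc', div_le_div_iff₀ (pow_pos (hd k) _) (pow_pos (hd k) _), hpow]
    have := pow_le_pow_left₀ (hd k).le (hd2 k) (2 * m - q)
    have h3 := mul_le_mul_of_nonneg_left this
      (mul_nonneg (hw2 k).le (pow_nonneg (hd k).le q))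
    linarith
  obtain ⟨⟨C, D, h⟩, -⟩ := hasDecomp_normBlaschke_aux hζ (fun k => (hw k).1) hS m le_rfl
  refine ⟨C, D, fun n => ?_⟩
  have hu : ∀ k, ‖-((‖w k‖ : ℂ) / w k) / ((1 - (starRingEnd ℂ) (w k) * ζ) / (ζ - w k))‖ = 1 :=
    fun k => by
    rw [norm_div, norm_normBlaschke_const hζ (hw k).1, norm_neg, norm_div, Complex.norm_real,
      norm_norm, div_one, div_self (norm_ne_zero_iff.mpr (hw k).2)]
  refine ((h n).const_mul (u := ∏ k ∈ range n,
    -((‖w k‖ : ℂ) / w k) / ((1 - (starRingEnd ℂ) (w k) * ζ) / (ζ - w k))) ?_).congr fun z _ => ?_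
  · rw [norm_prod]
    exact Finset.prod_eq_one fun k _ => hu k
  · rw [normBlaschke, ← Finset.prod_mul_distrib]
    refine Finset.prod_congr rfl fun k _ => ?_
    have hκ : (1 - (starRingEnd ℂ) (w k) * ζ) / (ζ - w k) ≠ 0 := by
      rw [← norm_ne_zero_iff, norm_normBlaschke_const hζ (hw k).1]
      exact one_ne_zero
    rw [← mul_assoc, div_mul_cancel₀ _ hκ, blaschkeFactor, ← neg_sub z (w k)]
    ring

section Hardy

variable {f g h : ℂ → ℂ}

lemma MemHardy2.of_norm_sq_le (hf : MemHardy2 f) (hg : MemHardy2 g)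
    (hh : DifferentiableOn ℂ h (ball 0 1)) {A : ℝ} (hA : 0 ≤ A)
    (hle : ∀ z ∈ ball (0 : ℂ) 1, ‖h z‖ ^ 2 ≤ A * (‖f z‖ ^ 2 + ‖g z‖ ^ 2)) : MemHardy2 h := by
  obtain ⟨hfd, Cf, hCf⟩ := hf
  obtain ⟨hgd, Cg, hCg⟩ := hg
  refine ⟨hh, A * (Cf + Cg), fun r hr0 hr1 => ?_⟩
  have hmem : ∀ t : ℝ, (r : ℂ) * Complex.exp ((t : ℂ) * Complex.I) ∈ ball (0 : ℂ) 1 :=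
    fun t => by
      rw [mem_ball_zero_iff, norm_mul, Complex.norm_exp_ofReal_mul_I, mul_one, Complex.norm_real,
        Real.norm_of_nonneg hr0.le]
      exact hr1
  have hint : ∀ {u : ℂ → ℂ}, DifferentiableOn ℂ u (ball 0 1) → IntervalIntegrable
      (fun t : ℝ => ‖u ((r : ℂ) * Complex.exp ((t : ℂ) * Complex.I))‖ ^ 2) volume 0
        (2 * Real.pi) := fun hu =>
    ((hu.continuousOn.comp_continuous (by fun_prop) hmem).norm.pow 2).intervalIntegrable _ _
  have hI := intervalIntegral.integral_mono_on (by positivity : (0 : ℝ) ≤ 2 * Real.pi) (hint hh)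
    (((hint hfd).add (hint hgd)).const_mul A) fun t _ => hle _ (hmem t)
  rw [intervalIntegral.integral_const_mul,
    intervalIntegral.integral_add (hint hfd) (hint hgd)] at hI
  calc _ ≤ (1 / (2 * Real.pi)) * _ := mul_le_mul_of_nonneg_left hI (by positivity)
    _ = A * (_ + _) := by rw [mul_left_comm, mul_add]
    _ ≤ _ := mul_le_mul_of_nonneg_left (add_le_add (hCf r hr0 hr1) (hCg r hr0 hr1)) hA

lemma MemHardy2.add (hf : MemHardy2 f) (hg : MemHardy2 g) : MemHardy2 fun z => f z + g z := by
  refine hf.of_norm_sq_le hg (hf.1.add hg.1) zero_le_two fun z _ => ?_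
  have := pow_le_pow_left₀ (norm_nonneg _) (norm_add_le (f z) (g z)) 2
  nlinarith [sq_nonneg (‖f z‖ - ‖g z‖)]

lemma MemHardy2.bdd_mul (hg : MemHardy2 g) (hh : DifferentiableOn ℂ h (ball 0 1)) {M : ℝ}
    (hM : ∀ z ∈ ball (0 : ℂ) 1, ‖h z‖ ≤ M) : MemHardy2 fun z => h z * g z := by
  refine hg.of_norm_sq_le hg (hh.mul hg.1) (sq_nonneg M) fun z hz => ?_
  rw [norm_mul, mul_pow]
  have := pow_le_pow_left₀ (norm_nonneg _) (hM z hz) 2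
  nlinarith [sq_nonneg M, sq_nonneg ‖g z‖, mul_le_mul_of_nonneg_right this (sq_nonneg ‖g z‖)]

lemma memHardy2_of_bdd (hh : DifferentiableOn ℂ h (ball 0 1)) {M : ℝ}
    (hM : ∀ z ∈ ball (0 : ℂ) 1, ‖h z‖ ≤ M) : MemHardy2 h := by
  have h1 : MemHardy2 fun _ => 1 := by
    refine ⟨differentiableOn_const _, 1, fun r _ _ => ?_⟩
    have := Real.pi_ne_zero
    simp only [norm_one, one_pow, intervalIntegral.integral_const, smul_eq_mul]
    field_simp
    norm_num
  simpa using h1.bdd_mul hh hM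

lemma exists_norm_eval_le (p : Polynomial ℂ) :
    ∃ M : ℝ, ∀ z ∈ ball (0 : ℂ) 1, ‖p.eval z‖ ≤ M := by
  obtain ⟨M, hM⟩ := (isCompact_closedBall (0 : ℂ) 1).exists_bound_of_continuousOn
    p.continuous.continuousOn
  exact ⟨M, fun z hz => hM z (ball_subset_closedBall hz)⟩

lemma MemHardy2.eval_mul (hg : MemHardy2 g) (p : Polynomial ℂ) :
    MemHardy2 fun z => p.eval z * g z := by
  obtain ⟨M, hM⟩ := exists_norm_eval_le p
  exact hg.bdd_mul p.differentiable.differentiableOn hM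

lemma memHardy2_eval (p : Polynomial ℂ) : MemHardy2 fun z => p.eval z := by
  obtain ⟨M, hM⟩ := exists_norm_eval_le p
  exact memHardy2_of_bdd p.differentiable.differentiableOn hM

end Hardy

/-- `F` belongs to `P · H² + ℂ[z]` on the unit disk. -/
def MemModHardy (P : Polynomial ℂ) (F : ℂ → ℂ) : Prop :=
  ∃ (g : ℂ → ℂ) (p : Polynomial ℂ), MemHardy2 g ∧
    ∀ z ∈ ball (0 : ℂ) 1, F z = P.eval z * g z + p.eval z

namespace MemModHardy

variable {P Q : Polynomial ℂ} {F : ℂ → ℂ}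

lemma mul_of_isCoprime (hPQ : IsCoprime P Q) (hP : MemModHardy P F) (hQ : MemModHardy Q F) :
    MemModHardy (P * Q) F := by
  obtain ⟨u, v, huv⟩ := hPQ
  obtain ⟨g₁, p₁, hg₁, h₁⟩ := hP
  obtain ⟨g₂, p₂, hg₂, h₂⟩ := hQ
  refine ⟨fun z => u.eval z * g₂ z + v.eval z * g₁ z, u * P * p₂ + v * Q * p₁,
    (hg₂.eval_mul u).add (hg₁.eval_mul v), fun z hz => ?_⟩
  have huv' : u.eval z * P.eval z + v.eval z * Q.eval z = 1 := by
    rw [← Polynomial.eval_mul, ← Polynomial.eval_mul, ← Polynomial.eval_add, huv,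
      Polynomial.eval_one]
  simp only [Polynomial.eval_mul, Polynomial.eval_add]
  linear_combination (-(F z)) * huv' + u.eval z * P.eval z * h₂ z hz
    + v.eval z * Q.eval z * h₁ z hz

lemma prod {ι : Type*} {t : Finset ι} {P : ι → Polynomial ℂ}
    (hP : Pairwise fun i j => IsCoprime (P i) (P j)) (hF : MemHardy2 F)
    (h : ∀ i ∈ t, MemModHardy (P i) F) : MemModHardy (∏ i ∈ t, P i) F := by
  classical
  induction t using Finset.induction_on with
  | empty => exact ⟨F, 0, hF, by simp⟩
  | insert i t hi ih =>
    rw [Finset.prod_insert hi]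
    refine mul_of_isCoprime (IsCoprime.prod_right fun j hj => hP ?_)
      (h i (Finset.mem_insert_self i t)) (ih fun j hj => h j (Finset.mem_insert_of_mem hj))
    rintro rfl
    exact hi hj

/-- Division with remainder bounds the degree of the polynomial part. -/
lemma exists_degree_lt (hP : P.Monic) (hF : MemModHardy P F) :
    ∃ (g : ℂ → ℂ) (p : Polynomial ℂ), MemHardy2 g ∧ p.degree < P.degree ∧
      ∀ z ∈ ball (0 : ℂ) 1, F z = P.eval z * g z + p.eval z := by
  obtain ⟨g, p, hg, h⟩ := hF
  refine ⟨fun z => g z + (p /ₘ P).eval z, p %ₘ P, hg.add (memHardy2_eval _),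
    Polynomial.degree_modByMonic_lt p hP, fun z hz => ?_⟩
  have hdiv := congrArg (Polynomial.eval z) (Polynomial.modByMonic_add_div p P)
  rw [Polynomial.eval_add, Polynomial.eval_mul] at hdiv
  linear_combination h z hz - hdiv

lemma mul_bdd {G : ℂ → ℂ} (hG : MemModHardy P G) (hF : MemModHardy P F)
    (hGd : DifferentiableOn ℂ G (ball 0 1)) {M : ℝ}
    (hM : ∀ z ∈ ball (0 : ℂ) 1, ‖G z‖ ≤ M) : MemModHardy P fun z => G z * F z := by
  obtain ⟨g₀, p₀, hg₀, h₀⟩ := hG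
  obtain ⟨g, p, hg, h⟩ := hF
  refine ⟨fun z => G z * g z + p.eval z * g₀ z, p * p₀, (hg.bdd_mul hGd hM).add (hg₀.eval_mul p),
    fun z hz => ?_⟩
  rw [Polynomial.eval_mul]
  linear_combination G z * h z hz + p.eval z * h₀ z hz

end MemModHardy

lemma memHb_iff {l : ℕ} {ζ : Fin l → ℂ} {m : Fin l → ℕ} {F : ℂ → ℂ} :
    MemHb ζ m F ↔ MemModHardy (∏ j, (X - C (ζ j)) ^ m j) F := by
  have hmonic : (∏ j, (X - C (ζ j)) ^ m j).Monic :=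
    Polynomial.monic_prod_of_monic _ _ fun j _ => (Polynomial.monic_X_sub_C _).pow _
  have hdeg : (∏ j, (X - C (ζ j)) ^ m j).degree = ((∑ j, m j : ℕ) : WithBot ℕ) := by
    rw [Polynomial.degree_prod, Nat.cast_sum]
    exact Finset.sum_congr rfl fun j _ => by
      rw [Polynomial.degree_pow, Polynomial.degree_X_sub_C, nsmul_one]
  have heval : ∀ z, (∏ j, (X - C (ζ j)) ^ m j).eval z = ∏ j, (z - ζ j) ^ m j := fun z => by
    simp [Polynomial.eval_prod]
  constructor
  · rintro ⟨g, p, hg, -, h⟩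
    exact ⟨g, p, hg, fun z hz => by rw [heval, h z hz]⟩
  · intro h
    obtain ⟨g, p, hg, hp, h⟩ := h.exists_degree_lt hmonic
    exact ⟨g, p, hg, hdeg ▸ hp, fun z hz => by rw [← heval, h z hz]⟩

lemma norm_blaschke_partial_le {w : ℕ → ℂ} (hw : ∀ n, ‖w n‖ < 1) (n : ℕ) {z : ℂ}
    (hz : ‖z‖ < 1) : ‖∏ k ∈ range n,
      ((‖w k‖ : ℂ) / w k) * ((w k - z) / (1 - (starRingEnd ℂ) (w k) * z))‖ ≤ 1 := by
  rw [norm_prod]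
  refine Finset.prod_le_one (fun _ _ => norm_nonneg _) fun k _ => ?_
  rw [norm_mul, norm_div, norm_div, Complex.norm_real, norm_norm]
  refine mul_le_one₀ (div_self_le_one _) (by positivity) ?_
  refine div_le_one_of_le₀ ?_ (norm_nonneg _)
  rw [← sq_le_sq₀ (norm_nonneg _) (norm_nonneg _), ← Complex.normSq_eq_norm_sq,
    ← Complex.normSq_eq_norm_sq]
  have h1 : ‖w k‖ ^ 2 < 1 := by nlinarith [hw k, norm_nonneg (w k)]
  have h2 : ‖z‖ ^ 2 < 1 := by nlinarith [norm_nonneg z]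
  rw [← Complex.normSq_eq_norm_sq, Complex.normSq_apply] at h1 h2
  simp only [Complex.normSq_apply, Complex.sub_re, Complex.sub_im, Complex.mul_re, Complex.mul_im,
    Complex.conj_re, Complex.conj_im, Complex.one_re, Complex.one_im]
  nlinarith [mul_pos (sub_pos.mpr h1) (sub_pos.mpr h2)]

/-- **Corollary.** Let `b` be rational, non-extreme, in the closed unit ball of `H^∞` with
`‖b‖_∞ = 1`, with Pythagorean mate `a` whose circle zeros are `ζ j` with multiplicities `m j`,
and `N = ∑ m j`.  If `Λ ⊂ 𝔻 ∖ {0}` satisfies `∑_n (1-|Λ n|²)/|ζ j - Λ n|^{2 m j} < ∞` for every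
`j`, then the Blaschke product `B_Λ` decomposes as `B_Λ = ∏ (z-ζ j)^{m j} · g + p` on `𝔻` with
`g ∈ H²` and `deg p < N`; in particular `B_Λ` is a multiplier of `H(b)`. -/
theorem statement11
    (b a : ℂ → ℂ) (l : ℕ) (ζ : Fin l → ℂ) (m : Fin l → ℕ)
    (hζ : ∀ j, ‖ζ j‖ = 1) (hζinj : Function.Injective ζ) (hm : ∀ j, 1 ≤ m j)
    (hb_rat : ∃ P Q : Polynomial ℂ, (∀ z : ℂ, ‖z‖ ≤ 1 → Q.eval z ≠ 0) ∧
      ∀ z : ℂ, ‖z‖ ≤ 1 → b z = P.eval z / Q.eval z)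
    (hb_le : ∀ z : ℂ, ‖z‖ ≤ 1 → ‖b z‖ ≤ 1)
    (hb_norm : ∃ z : ℂ, ‖z‖ = 1 ∧ ‖b z‖ = 1)
    (hb_nonextreme : ∃ z : ℂ, ‖z‖ = 1 ∧ ‖b z‖ < 1)
    (ha_form : ∃ P Q : Polynomial ℂ, (∀ z : ℂ, ‖z‖ ≤ 1 → P.eval z ≠ 0 ∧ Q.eval z ≠ 0) ∧
      ∀ z : ℂ, ‖z‖ ≤ 1 → a z = (∏ j, (z - ζ j) ^ m j) * P.eval z / Q.eval z)
    (ha_le : ∀ z : ℂ, ‖z‖ ≤ 1 → ‖a z‖ ≤ 1)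
    (ha0 : 0 < (a 0).re ∧ (a 0).im = 0)
    (hab : ∀ z : ℂ, ‖z‖ = 1 → ‖a z‖ ^ 2 + ‖b z‖ ^ 2 = 1)
    -- the sequence, in `𝔻 ∖ {0}`
    (Λ : ℕ → ℂ) (hΛ : ∀ n, ‖Λ n‖ < 1 ∧ Λ n ≠ 0)
    (hsum : ∀ j, Summable fun n => (1 - ‖Λ n‖ ^ 2) / ‖ζ j - Λ n‖ ^ (2 * m j))
    -- `B` is the Blaschke product with zeros `Λ` (limit of the partial products on `𝔻`)
    (B : ℂ → ℂ)
    (hB : ∀ z ∈ ball (0 : ℂ) 1,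
      Tendsto (fun n => ∏ k ∈ Finset.range n,
          ((‖Λ k‖ : ℂ) / Λ k) * ((Λ k - z) / (1 - (starRingEnd ℂ) (Λ k) * z)))
        atTop (𝓝 (B z))) :
    (∃ (g : ℂ → ℂ) (p : Polynomial ℂ), MemHardy2 g ∧ p.degree < ((∑ j, m j : ℕ) : ℕ) ∧
      ∀ z ∈ ball (0 : ℂ) 1, B z = (∏ j, (z - ζ j) ^ m j) * g z + p.eval z) ∧
    ∀ f : ℂ → ℂ, MemHb ζ m f → MemHb ζ m fun z => B z * f z := by
  obtain ⟨j₀⟩ : Nonempty (Fin l) := by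
    obtain ⟨z, hz, hbz⟩ := hb_norm
    obtain ⟨P, Q, hPQ, ha⟩ := ha_form
    by_contra hl
    have := not_nonempty_iff.mp hl
    have haz : a z = 0 := by simpa [hbz] using hab z hz
    rw [ha z hz.le, Fintype.prod_empty, one_mul, div_eq_zero_iff] at haz
    exact haz.elim (hPQ z hz.le).1 (hPQ z hz.le).2
  have hloc : ∀ j, MemModHardy ((X - C (ζ j)) ^ m j) B := fun j => by
    obtain ⟨K, D, h⟩ := hasDecomp_blaschke_partial (hζ j) hΛ (hsum j)
    obtain ⟨g, p, hg, hgp⟩ := exists_decomp_of_tendsto h hB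
    exact ⟨g, p, hg, fun z hz => by simp [hgp z hz]⟩
  have hBd : DifferentiableOn ℂ B (ball 0 1) := by
    obtain ⟨g, p, hg, h⟩ := hloc j₀
    exact ((hg.eval_mul _).1.add p.differentiable.differentiableOn).congr h
  have hB1 : ∀ z ∈ ball (0 : ℂ) 1, ‖B z‖ ≤ 1 := fun z hz =>
    le_of_tendsto' (hB z hz).norm fun n =>
      norm_blaschke_partial_le (fun k => (hΛ k).1) n (mem_ball_zero_iff.mp hz)
  have hmod : MemModHardy (∏ j, (X - C (ζ j)) ^ m j) B :=
    MemModHardy.prod (fun i j hij => (Polynomial.pairwise_coprime_X_sub_C hζinj hij).pow)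
      (memHardy2_of_bdd hBd hB1) fun j _ => hloc j
  exact ⟨memHb_iff.mpr hmod, fun f hf => memHb_iff.mpr (hmod.mul_bdd (memHb_iff.mp hf) hBd hB1)⟩
end
end
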